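/- arXiv:math/0311469 — 4 statements merged into one kernel-verified Lean document; each statement's English description precedes it below -/
import Mathlib

section
/- Suppose there is n₀ such that p_k = 1 for all k ≥ n₀ and q_k = 0 for all k ≥ n₀ (so J is a finite-rank perturbation of J₀). Then the set X of atoms of σ lying outside [−2,2] is finite, the function x ↦ log(√(4−x²)/(2π·w(x)))·A(x)·√(4−x²) is Lebesgue integrable on [−2,2], and Σ_{x∈X} F(x) + (1/2π)∫_{−2}^{2} log(√(4−x²)/(2π·w(x)))·A(x)·√(4−x²) dx = −a·Σ_{k=1}^{∞} log p_k + Σ_{k=0}^{∞} ⟨(Φ(J) − Φ(J₀)) e_k, e_k⟩, where both sums on the right-hand side have only finitely many nonzero terms. -/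
open MeasureTheory Polynomial Filter Topology
open scoped ENNReal RealInnerProductSpace Real

noncomputable section

/-- The real Hilbert space `ℓ²(ℕ)`. -/
abbrev H : Type := lp (fun _ : ℕ => ℝ) 2

/-- The standard orthonormal basis of `ℓ²(ℕ)`. -/
def e (k : ℕ) : H := lp.single 2 k 1

namespace FiniteRankJacobi

/-- `J` is the Jacobi operator with off-diagonal entries `p 1, p 2, …` and diagonal `q`. -/
structure IsJacobi (p q : ℕ → ℝ) (J : H →L[ℝ] H) : Prop where
  zero : J (e 0) = q 0 • e 0 + p 1 • e 1
  succ : ∀ k, J (e (k + 1)) = p (k + 1) • e k + q (k + 1) • e (k + 1) + p (k + 2) • e (k + 2)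

theorem inner_e (i j : ℕ) : ⟪e i, e j⟫ = if i = j then (1 : ℝ) else 0 := by
  rw [e, lp.inner_single_left]
  simp [e, Pi.single_apply, lp.single_apply]

theorem inner_e_left (i : ℕ) (v : H) : ⟪e i, v⟫ = v i := by
  rw [e, lp.inner_single_left]
  simp

theorem norm_e (i : ℕ) : ‖e i‖ = 1 := by
  have := real_inner_self_eq_norm_sq (e i)
  rw [inner_e, if_pos rfl] at this
  nlinarith [norm_nonneg (e i)]

theorem clm_ext {S T : H →L[ℝ] H} (h : ∀ k, S (e k) = T (e k)) : S = T := by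
  ext1 v
  have hv := lp.hasSum_single (E := fun _ : ℕ => ℝ) (p := 2) (by norm_num) v
  have h1 := hv.mapL S
  have h2 := hv.mapL T
  refine h1.unique (h2.congr_fun ?_)
  intro k
  have : (lp.single 2 k (v k) : H) = v k • e k := by
    rw [e, ← lp.single_smul]; simp
  rw [this, map_smul, map_smul, h]

theorem IsJacobi.isSelfAdjoint {p q : ℕ → ℝ} {J : H →L[ℝ] H} (hJ : IsJacobi p q J) :
    IsSelfAdjoint J := by
  rw [ContinuousLinearMap.isSelfAdjoint_iff']
  refine clm_ext fun k => lp.ext (funext fun j => ?_)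
  rw [← inner_e_left, ← inner_e_left, ContinuousLinearMap.adjoint_inner_right]
  rcases j with _ | j <;> rcases k with _ | k <;>
    simp only [hJ.zero, hJ.succ, inner_add_left, inner_add_right, real_inner_smul_left,
      real_inner_smul_right, inner_e] <;> grind

theorem IsJacobi.inner_aeval_comm {p q : ℕ → ℝ} {J : H →L[ℝ] H} (hJ : IsJacobi p q J)
    (f : ℝ[X]) (u v : H) : ⟪aeval J f u, v⟫ = ⟪u, aeval J f v⟫ := by
  have hs : IsSelfAdjoint (aeval J f) := by
    rw [IsSelfAdjoint, aeval_eq_sum_range, star_sum]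
    refine Finset.sum_congr rfl fun i _ => ?_
    rw [star_smul, star_pow, hJ.isSelfAdjoint.star_eq]; simp
  rw [ContinuousLinearMap.isSelfAdjoint_iff'] at hs
  conv_lhs => rw [← hs]
  rw [ContinuousLinearMap.adjoint_inner_left]

/-- The orthonormal polynomials of the Jacobi matrix with coefficients `p`, `q`. -/
def orthoPoly (p q : ℕ → ℝ) : ℕ → ℝ[X]
  | 0 => 1
  | 1 => C (p 1)⁻¹ * (X - C (q 0))
  | k + 2 => C (p (k + 2))⁻¹ *
      ((X - C (q (k + 1))) * orthoPoly p q (k + 1) - C (p (k + 1)) * orthoPoly p q k)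

section

variable {p q : ℕ → ℝ}

theorem orthoPoly_one (hp : ∀ k, 1 ≤ k → 0 < p k) :
    C (p 1) * orthoPoly p q 1 = X - C (q 0) := by
  rw [orthoPoly, ← mul_assoc, ← C_mul, mul_inv_cancel₀ (hp 1 le_rfl).ne', C_1, one_mul]

theorem orthoPoly_add_two (hp : ∀ k, 1 ≤ k → 0 < p k) (k : ℕ) :
    C (p (k + 2)) * orthoPoly p q (k + 2) =
      (X - C (q (k + 1))) * orthoPoly p q (k + 1) - C (p (k + 1)) * orthoPoly p q k := by
  rw [orthoPoly, ← mul_assoc, ← C_mul, mul_inv_cancel₀ (hp (k + 2) (by omega)).ne', C_1, one_mul]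

theorem orthoPoly_add_two_of_free (hp : ∀ k, 1 ≤ k → 0 < p k) {N : ℕ}
    (hN : ∀ k, N ≤ k → p k = 1 ∧ q k = 0) {k : ℕ} (hk : N ≤ k + 1) :
    orthoPoly p q (k + 2) = X * orthoPoly p q (k + 1) - orthoPoly p q k := by
  have := orthoPoly_add_two (q := q) hp k
  rw [(hN (k + 2) (by omega)).1, (hN (k + 1) hk).1, (hN (k + 1) hk).2] at this
  simpa using this

variable {J : H →L[ℝ] H}

theorem IsJacobi.aeval_orthoPoly (hJ : IsJacobi p q J) (hp : ∀ k, 1 ≤ k → 0 < p k) (k : ℕ) :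
    aeval J (orthoPoly p q k) (e 0) = e k := by
  induction k using Nat.twoStepInduction with
  | zero => simp [orthoPoly]
  | one =>
    have h1 := (hp 1 le_rfl).ne'
    simp [orthoPoly, hJ.zero, Algebra.algebraMap_eq_smul_one, smul_smul, h1]
  | more k h1 h2 =>
    have h3 := (hp (k + 2) (by omega)).ne'
    rw [orthoPoly, sub_mul]
    simp only [map_mul, map_sub, aeval_C, Algebra.algebraMap_eq_smul_one, aeval_X,
      mul_apply_eq_comp, _root_.sub_apply, h1, h2,
      _root_.smul_apply, one_apply_eq_self, hJ.succ]
    simp only [smul_add, smul_smul]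
    rw [inv_mul_cancel₀ h3, one_smul]
    abel

theorem IsJacobi.inner_aeval_e (hJ : IsJacobi p q J) (hp : ∀ k, 1 ≤ k → 0 < p k) (f : ℝ[X])
    (i j : ℕ) : ⟪aeval J f (e i), e j⟫ =
      ⟪aeval J (f * orthoPoly p q i * orthoPoly p q j) (e 0), e 0⟫ := by
  rw [mul_comm _ (orthoPoly p q j), map_mul, mul_apply_eq_comp,
    hJ.inner_aeval_comm (orthoPoly p q j), map_mul, mul_apply_eq_comp, hJ.aeval_orthoPoly hp,
    hJ.aeval_orthoPoly hp]

/-- A polynomial in a Jacobi matrix only sees the coefficients close to a given basis vector. -/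
theorem IsJacobi.aeval_e_eq {p' q' : ℕ → ℝ} {J' : H →L[ℝ] H} (hJ : IsJacobi p q J)
    (hJ' : IsJacobi p' q' J') {N : ℕ} (h : ∀ k, N ≤ k → p k = p' k ∧ q k = q' k) (f : ℝ[X])
    {j : ℕ} (hj : N + f.natDegree ≤ j) : aeval J f (e j) = aeval J' f (e j) := by
  have key : ∀ d j, N + d ≤ j → (J ^ d) (e j) = (J' ^ d) (e j) := by
    intro d
    induction d with
    | zero => simp
    | succ d ih =>
      intro j hj
      obtain ⟨j, rfl⟩ : ∃ i, j = i + 1 := ⟨j - 1, by omega⟩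
      simp only [pow_succ, mul_apply_eq_comp, hJ.succ, hJ'.succ, map_add, map_smul]
      rw [ih j (by omega), ih (j + 1) (by omega), ih (j + 2) (by omega),
        (h (j + 1) (by omega)).1, (h (j + 1) (by omega)).2, (h (j + 2) (by omega)).1]
  simp only [aeval_eq_sum_range, _root_.sum_apply, _root_.smul_apply]
  refine Finset.sum_congr rfl fun i hi => ?_
  rw [key i j (by simp at hi; omega)]

/-- The polynomial `|u|²`, where `u` is the Jost function, in the energy variable. -/
def jostSq (p q : ℕ → ℝ) (n : ℕ) : ℝ[X] :=
  orthoPoly p q (n + 1) ^ 2 + orthoPoly p q n ^ 2 - X * orthoPoly p q (n + 1) * orthoPoly p q n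

theorem jostSq_eq (hp : ∀ k, 1 ≤ k → 0 < p k) {N : ℕ}
    (hN : ∀ k, N ≤ k → p k = 1 ∧ q k = 0) {k : ℕ} (hk : N ≤ k) :
    jostSq p q k = jostSq p q N := by
  induction k, hk using Nat.le_induction with
  | base => rfl
  | succ k hk ih =>
    rw [← ih, jostSq, jostSq, orthoPoly_add_two_of_free hp hN (by omega)]
    ring

theorem jostSq_free : jostSq (fun _ => 1) (fun _ => 0) 0 = 1 := by
  simp [jostSq, orthoPoly]; ring

theorem IsJacobi.inner_jostSq {J₀ : H →L[ℝ] H} (hJ : IsJacobi p q J)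
    (hJ₀ : IsJacobi (fun _ => 1) (fun _ => 0) J₀) (hp : ∀ k, 1 ≤ k → 0 < p k) {N : ℕ}
    (hN : ∀ k, N ≤ k → p k = 1 ∧ q k = 0) (f : ℝ[X]) :
    ⟪aeval J (jostSq p q N * f) (e 0), e 0⟫ = ⟪aeval J₀ f (e 0), e 0⟫ := by
  have key : ∀ (p q : ℕ → ℝ) (J : H →L[ℝ] H) (hJ : IsJacobi p q J)
      (hp : ∀ k, 1 ≤ k → 0 < p k) (n : ℕ), ⟪aeval J (jostSq p q n * f) (e 0), e 0⟫ =
      ⟪aeval J f (e (n + 1)), e (n + 1)⟫ + ⟪aeval J f (e n), e n⟫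
        - ⟪aeval J (X * f) (e (n + 1)), e n⟫ := by
    intro p q J hJ hp n
    rw [hJ.inner_aeval_e hp f (n + 1), hJ.inner_aeval_e hp f n, hJ.inner_aeval_e hp (X * f),
      ← inner_add_left,
      ← inner_sub_left, ← _root_.add_apply, ← _root_.sub_apply,
      ← map_add, ← map_sub, jostSq]
    congr 4
    ring
  have hn : N ≤ N + (f.natDegree + 1) := by omega
  rw [← jostSq_eq hp hN hn, key p q J hJ hp]
  conv_rhs => rw [← one_mul f, ← jostSq_free, ← jostSq_eq (k := N + (f.natDegree + 1)) (by simp)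
    (by simp) (Nat.zero_le _), key _ _ J₀ hJ₀ (by simp)]
  have hd : (X * f).natDegree ≤ f.natDegree + 1 := natDegree_mul_le.trans (by simp; omega)
  rw [hJ.aeval_e_eq hJ₀ hN f (by omega), hJ.aeval_e_eq hJ₀ hN f (by omega),
    hJ.aeval_e_eq hJ₀ hN (X * f) (by omega)]

end

theorem image_two_mul_cos : (fun θ => 2 * Real.cos θ) '' Set.Icc 0 π = Set.Icc (-2 : ℝ) 2 := by
  ext x
  constructor
  · rintro ⟨θ, -, rfl⟩
    constructor <;> simp only <;> linarith [Real.neg_one_le_cos θ, Real.cos_le_one θ]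
  · intro hx
    refine ⟨Real.arccos (x / 2), ⟨Real.arccos_nonneg _, Real.arccos_le_pi _⟩, ?_⟩
    simp only
    rw [Real.cos_arccos (by linarith [hx.1]) (by linarith [hx.2])]
    ring

theorem injOn_two_mul_cos : Set.InjOn (fun θ => 2 * Real.cos θ) (Set.Icc 0 π) :=
  fun x hx y hy h => Real.injOn_cos hx hy (by simpa using h)

theorem hasDerivWithinAt_two_mul_cos (s : Set ℝ) (θ : ℝ) :
    HasDerivWithinAt (fun θ => 2 * Real.cos θ) (-(2 * Real.sin θ)) s θ := by
  simpa using ((Real.hasDerivAt_cos θ).const_mul 2).hasDerivWithinAt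

theorem abs_neg_two_mul_sin {θ : ℝ} (hθ : θ ∈ Set.Icc 0 π) :
    |-(2 * Real.sin θ)| = 2 * Real.sin θ := by
  rw [abs_neg, abs_of_nonneg]
  have := Real.sin_nonneg_of_nonneg_of_le_pi hθ.1 hθ.2
  positivity

theorem integral_Icc_eq_integral_cos (g : ℝ → ℝ) :
    ∫ x in Set.Icc (-2 : ℝ) 2, g x =
      ∫ θ in Set.Icc 0 π, 2 * Real.sin θ * g (2 * Real.cos θ) := by
  rw [← image_two_mul_cos, integral_image_eq_integral_abs_deriv_smul measurableSet_Icc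
    (fun θ _ => hasDerivWithinAt_two_mul_cos _ θ) injOn_two_mul_cos]
  refine setIntegral_congr_fun measurableSet_Icc fun θ hθ => ?_
  simp only [abs_neg_two_mul_sin hθ, smul_eq_mul]

theorem integrableOn_Icc_iff_cos (g : ℝ → ℝ) :
    IntegrableOn g (Set.Icc (-2 : ℝ) 2) ↔
      IntegrableOn (fun θ => 2 * Real.sin θ * g (2 * Real.cos θ)) (Set.Icc 0 π) := by
  rw [← image_two_mul_cos, integrableOn_image_iff_integrableOn_abs_deriv_smul measurableSet_Icc
    (fun θ _ => hasDerivWithinAt_two_mul_cos _ θ) injOn_two_mul_cos]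
  refine integrableOn_congr_fun (fun θ hθ => ?_) measurableSet_Icc
  simp only [abs_neg_two_mul_sin hθ, smul_eq_mul]

theorem sqrt_four_sub_two_mul_cos_sq {θ : ℝ} (hθ : θ ∈ Set.Icc 0 π) :
    √(4 - (2 * Real.cos θ) ^ 2) = 2 * Real.sin θ := by
  have := Real.sin_nonneg_of_nonneg_of_le_pi hθ.1 hθ.2
  rw [← Real.sqrt_sq (show 0 ≤ 2 * Real.sin θ by positivity)]
  congr 1
  linear_combination (-4) * Real.sin_sq_add_cos_sq θ

/-- The orthonormal polynomials of the free Jacobi matrix (rescaled Chebyshev polynomials of the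
second kind). -/
abbrev freePoly : ℕ → ℝ[X] := orthoPoly (fun _ => 1) (fun _ => 0)

theorem freePoly_zero : freePoly 0 = 1 := rfl

theorem freePoly_one : freePoly 1 = X := by simp [freePoly, orthoPoly]

theorem freePoly_add_two (k : ℕ) : freePoly (k + 2) = X * freePoly (k + 1) - freePoly k :=
  orthoPoly_add_two_of_free (by simp) (N := 0) (by simp) (by simp)

theorem sin_mul_freePoly (k : ℕ) (θ : ℝ) :
    Real.sin θ * (freePoly k).eval (2 * Real.cos θ) = Real.sin ((k + 1) * θ) := by
  induction k using Nat.twoStepInduction with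
  | zero => simp [freePoly_zero]
  | one => rw [freePoly_one, eval_X]; norm_num [Real.sin_two_mul]; ring
  | more k h1 h2 =>
    rw [freePoly_add_two, eval_sub, eval_mul, eval_X, mul_sub, h1, mul_left_comm, h2]
    push_cast
    rw [show (k + 2 + 1 : ℝ) * θ = (k + 1 + 1) * θ + θ by ring,
      show (k + 1 : ℝ) * θ = (k + 1 + 1) * θ - θ by ring, Real.sin_add, Real.sin_sub]
    ring

/-- The orthonormal polynomials span all polynomials. -/
theorem orthoPoly_induction {p q : ℕ → ℝ} (hp : ∀ k, 1 ≤ k → 0 < p k) {motive : ℝ[X] → Prop}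
    (hbasis : ∀ k, motive (orthoPoly p q k))
    (hadd : ∀ f g, motive f → motive g → motive (f + g))
    (hsmul : ∀ (c : ℝ) f, motive f → motive (c • f)) (f : ℝ[X]) : motive f := by
  let V : Submodule ℝ ℝ[X] :=
    { carrier := {f | motive f}
      add_mem' := fun {f g} hf hg => hadd f g hf hg
      zero_mem' := by simpa using hsmul 0 _ (hbasis 0)
      smul_mem' := fun c f hf => hsmul c f hf }
  set W := Submodule.span ℝ (Set.range (orthoPoly p q)) with hW
  have hS : W ≤ V := Submodule.span_le.2 (by rintro _ ⟨k, rfl⟩; exact hbasis k)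
  have hC : ∀ (c : ℝ) k, C c * orthoPoly p q k ∈ W := fun c k => by
    rw [← smul_eq_C_mul]
    exact Submodule.smul_mem _ _ (Submodule.subset_span ⟨k, rfl⟩)
  have hX : ∀ g ∈ W, X * g ∈ W := by
    intro g hg
    induction hg using Submodule.span_induction with
    | mem g hg =>
      obtain ⟨k, rfl⟩ := hg
      rcases k with _ | k
      · have : X * orthoPoly p q 0 = C (p 1) * orthoPoly p q 1 + C (q 0) * orthoPoly p q 0 := by
          rw [orthoPoly_one hp, orthoPoly]; ring
        rw [this]
        exact add_mem (hC _ _) (hC _ _)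
      · rw [show X * orthoPoly p q (k + 1) = C (p (k + 2)) * orthoPoly p q (k + 2) +
          C (q (k + 1)) * orthoPoly p q (k + 1) + C (p (k + 1)) * orthoPoly p q k by
          rw [orthoPoly_add_two hp]; ring]
        exact add_mem (add_mem (hC _ _) (hC _ _)) (hC _ _)
    | zero => simp
    | add g h _ _ hg hh => rw [mul_add]; exact add_mem hg hh
    | smul c g _ hg => rw [mul_smul_comm]; exact Submodule.smul_mem _ _ hg
  refine hS ?_
  induction f using Polynomial.induction_on with
  | C a => simpa [orthoPoly] using hC a 0
  | add f g hf hg => exact add_mem hf hg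
  | monomial n a h =>
    rw [pow_succ, ← mul_assoc, mul_comm]
    exact hX _ h

theorem two_mul_sin_mul_freePoly_mul_sqrt (g : ℝ → ℝ) (k : ℕ) {θ : ℝ} (hθ : θ ∈ Set.Icc 0 π) :
    2 * Real.sin θ * (g (2 * Real.cos θ) * (freePoly k).eval (2 * Real.cos θ) *
      √(4 - (2 * Real.cos θ) ^ 2)) =
      2 * (g (2 * Real.cos θ) * (Real.cos (k * θ) - Real.cos ((k + 2) * θ))) := by
  rw [sqrt_four_sub_two_mul_cos_sq hθ]
  have h := sin_mul_freePoly k θ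
  rw [show (k : ℝ) * θ = (k + 1) * θ - θ by ring, show ((k : ℝ) + 2) * θ = (k + 1) * θ + θ by ring,
    Real.cos_sub, Real.cos_add, ← h]
  ring

theorem integral_mul_freePoly (g : ℝ → ℝ) (k : ℕ) :
    ∫ x in Set.Icc (-2 : ℝ) 2, g x * (freePoly k).eval x * √(4 - x ^ 2) =
      2 * ∫ θ in (0)..π, g (2 * Real.cos θ) * (Real.cos (k * θ) - Real.cos ((k + 2) * θ)) := by
  rw [integral_Icc_eq_integral_cos, intervalIntegral.integral_of_le Real.pi_pos.le,
    integral_Icc_eq_integral_Ioc, ← integral_const_mul]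
  refine setIntegral_congr_fun measurableSet_Ioc fun θ hθ => ?_
  exact two_mul_sin_mul_freePoly_mul_sqrt g k (Set.Ioc_subset_Icc_self hθ)

theorem integral_cos_mul {c : ℝ} (hc : c ≠ 0) :
    ∫ θ in (0)..π, Real.cos (c * θ) = Real.sin (c * π) / c := by
  rw [intervalIntegral.integral_comp_mul_left _ hc]
  simp [div_eq_inv_mul]

theorem integral_freePoly (k : ℕ) :
    ∫ x in Set.Icc (-2 : ℝ) 2, (freePoly k).eval x * √(4 - x ^ 2) =
      if k = 0 then 2 * π else 0 := by
  have := integral_mul_freePoly (fun _ => 1) k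
  simp only [one_mul] at this
  rw [this, intervalIntegral.integral_sub (Continuous.intervalIntegrable (by fun_prop) _ _)
    (Continuous.intervalIntegrable (by fun_prop) _ _), integral_cos_mul (c := k + 2) (by positivity)]
  have h2 : Real.sin ((k + 2) * π) = 0 := by exact_mod_cast Real.sin_nat_mul_pi (k + 2)
  rw [h2]
  split_ifs with hk
  · simp [hk]
  · rw [integral_cos_mul (by exact_mod_cast hk), Real.sin_nat_mul_pi]
    simp

theorem integral_semicircle {J₀ : H →L[ℝ] H} (hJ₀ : IsJacobi (fun _ => 1) (fun _ => 0) J₀)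
    (f : ℝ[X]) :
    ∫ x in Set.Icc (-2 : ℝ) 2, f.eval x * √(4 - x ^ 2) =
      2 * π * ⟪aeval J₀ f (e 0), e 0⟫ := by
  have hint : ∀ f : ℝ[X], IntegrableOn (fun x => f.eval x * √(4 - x ^ 2)) (Set.Icc (-2 : ℝ) 2) :=
    fun f => (Continuous.continuousOn (by fun_prop)).integrableOn_Icc
  induction f using orthoPoly_induction (p := fun _ => 1) (q := fun _ => 0) (by simp) with
  | hbasis k =>
    rw [integral_freePoly, hJ₀.aeval_orthoPoly (by simp), inner_e]
    split_ifs <;> simp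
  | hadd f g hf hg =>
    simp only [eval_add, add_mul, map_add, _root_.add_apply, inner_add_left, mul_add]
    rw [integral_add (hint f) (hint g), hf, hg]
  | hsmul c f hf =>
    simp only [eval_smul, smul_eq_mul, map_smul, _root_.smul_apply, real_inner_smul_left, mul_assoc]
    rw [integral_const_mul, hf]
    ring

theorem IsJacobi.pow_e_zero {p q : ℕ → ℝ} {J : H →L[ℝ] H} (hJ : IsJacobi p q J)
    (k j : ℕ) (hj : k < j) : ⟪(J ^ k) (e 0), e j⟫ = 0 := by
  induction k generalizing j with
  | zero => simp [inner_e]; omega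
  | succ k ih =>
    obtain ⟨j, rfl⟩ : ∃ i, j = i + 1 := ⟨j - 1, by omega⟩
    have := hJ.inner_aeval_comm X ((J ^ k) (e 0)) (e (j + 1))
    rw [aeval_X] at this
    rw [pow_succ', mul_apply_eq_comp, this, hJ.succ]
    simp only [inner_add_right, real_inner_smul_right, ih j (by omega), ih (j + 1) (by omega),
      ih (j + 2) (by omega), mul_zero, add_zero]

theorem IsJacobi.pow_e_zero_pos {p q : ℕ → ℝ} {J : H →L[ℝ] H} (hJ : IsJacobi p q J)
    (hp : ∀ k, 1 ≤ k → 0 < p k) (k : ℕ) : 0 < ⟪(J ^ k) (e 0), e k⟫ := by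
  induction k with
  | zero => simp [norm_e]
  | succ k ih =>
    have := hJ.inner_aeval_comm X ((J ^ k) (e 0)) (e (k + 1))
    rw [aeval_X] at this
    rw [pow_succ', mul_apply_eq_comp, this, hJ.succ]
    simp only [inner_add_right, real_inner_smul_right, hJ.pow_e_zero k (k + 1) (by omega),
      hJ.pow_e_zero k (k + 2) (by omega)]
    have := hp (k + 1) (by omega)
    simp only [mul_zero, add_zero]
    positivity

/-- `σ` has the moments of the spectral measure of `J` at `e 0`. -/
def IsSpectral (J : H →L[ℝ] H) (σ : Measure ℝ) : Prop :=
  ∀ k : ℕ, (∫ x, x ^ k ∂σ) = ⟪(J ^ k) (e 0), e 0⟫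

section

variable {p q : ℕ → ℝ} {J : H →L[ℝ] H} {σ : Measure ℝ}

theorem IsSpectral.even_moment (hσ : IsSpectral J σ) (hJ : IsJacobi p q J) (k : ℕ) :
    ∫ x, x ^ (2 * k) ∂σ = ‖(J ^ k) (e 0)‖ ^ 2 := by
  rw [hσ, ← real_inner_self_eq_norm_sq, two_mul, pow_add, mul_apply_eq_comp]
  have := hJ.inner_aeval_comm (X ^ k) ((J ^ k) (e 0)) (e 0)
  simpa using this

theorem IsSpectral.integrable_pow_even (hσ : IsSpectral J σ) (hJ : IsJacobi p q J)
    (hp : ∀ k, 1 ≤ k → 0 < p k) (k : ℕ) : Integrable (fun x => x ^ (2 * k)) σ := by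
  by_contra h
  have h1 := hσ.even_moment hJ k
  rw [integral_undef h] at h1
  have h2 := hJ.pow_e_zero_pos hp k
  have h3 : (J ^ k) (e 0) = 0 := by simpa using h1.symm
  simp [h3] at h2

theorem IsSpectral.integrable_eval [IsProbabilityMeasure σ] (hσ : IsSpectral J σ) (hJ : IsJacobi p q J)
    (hp : ∀ k, 1 ≤ k → 0 < p k) (f : ℝ[X]) : Integrable (fun x => f.eval x) σ := by
  have hpow : ∀ k, Integrable (fun x : ℝ => x ^ k) σ := by
    intro k
    refine ((integrable_const (1 : ℝ)).add (hσ.integrable_pow_even hJ hp k)).mono'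
      (by fun_prop) (ae_of_all _ fun x => ?_)
    simp only [Real.norm_eq_abs, abs_pow, Pi.add_apply, pow_mul']
    rw [← sq_abs (x ^ k), abs_pow]
    nlinarith [sq_nonneg (|x| ^ k - 1)]
  simp only [eval_eq_sum_range]
  exact integrable_finsetSum _ fun i _ => (hpow i).const_mul _

theorem IsSpectral.integral_eval [IsProbabilityMeasure σ] (hσ : IsSpectral J σ) (hJ : IsJacobi p q J)
    (hp : ∀ k, 1 ≤ k → 0 < p k) (f : ℝ[X]) :
    ∫ x, f.eval x ∂σ = ⟪aeval J f (e 0), e 0⟫ := by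
  have hpow : ∀ k, Integrable (fun x : ℝ => x ^ k) σ := fun k => by
    simpa using hσ.integrable_eval hJ hp (X ^ k)
  simp only [eval_eq_sum_range, aeval_eq_sum_range, _root_.sum_apply, _root_.smul_apply, sum_inner,
    real_inner_smul_left]
  rw [integral_finsetSum _ fun i _ => (hpow i).const_mul _]
  exact Finset.sum_congr rfl fun i _ => by rw [integral_const_mul, hσ]

theorem IsSpectral.ae_abs_le [IsProbabilityMeasure σ] (hσ : IsSpectral J σ)
    (hJ : IsJacobi p q J) (hp : ∀ k, 1 ≤ k → 0 < p k) : ∀ᵐ x ∂σ, |x| ≤ ‖J‖ + 1 := by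
  set M := ‖J‖ + 1 with hM
  have hM0 : 0 < M := by positivity
  have hr : ‖J‖ ^ 2 / M ^ 2 < 1 := by
    rw [div_lt_one (by positivity)]
    have := norm_nonneg J
    nlinarith
  have key : ∀ k : ℕ, σ.real {x | M < |x|} ≤ (‖J‖ ^ 2 / M ^ 2) ^ k := by
    intro k
    have h1 : M ^ (2 * k) * σ.real {x | M ^ (2 * k) ≤ x ^ (2 * k)} ≤ ∫ x, x ^ (2 * k) ∂σ :=
      mul_meas_ge_le_integral_of_nonneg (ae_of_all _ fun x => by simp [pow_mul]; positivity)
        (hσ.integrable_pow_even hJ hp k) _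
    have h2 : σ.real {x | M < |x|} ≤ σ.real {x | M ^ (2 * k) ≤ x ^ (2 * k)} := by
      refine measureReal_mono fun x hx => ?_
      simp only [Set.mem_ofPred_eq] at hx ⊢
      rw [pow_mul, pow_mul, ← sq_abs x]
      gcongr
    have h3 : ‖(J ^ k) (e 0)‖ ≤ ‖J‖ ^ k := by
      clear h1 h2
      induction k with
      | zero => simp [norm_e]
      | succ k ih =>
        rw [pow_succ', mul_apply_eq_comp, pow_succ']
        exact (J.le_opNorm _).trans (by gcongr)
    rw [hσ.even_moment hJ] at h1
    rw [div_pow, le_div_iff₀ (by positivity), ← pow_mul, ← pow_mul]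
    calc σ.real {x | M < |x|} * M ^ (2 * k) ≤ M ^ (2 * k) * σ.real {x | M ^ (2 * k) ≤ x ^ (2 * k)} := by
          rw [mul_comm]; gcongr
      _ ≤ _ := h1
      _ ≤ (‖J‖ ^ k) ^ 2 := by gcongr
      _ = _ := by rw [← pow_mul, mul_comm]
  have h0 : σ.real {x | M < |x|} ≤ 0 :=
    ge_of_tendsto' (tendsto_pow_atTop_nhds_zero_of_lt_one (by positivity) hr) key
  rw [ae_iff]
  simp only [not_le]
  exact (measureReal_eq_zero_iff).1 (le_antisymm h0 measureReal_nonneg)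

end

/-- Compactly supported finite measures on the line are determined by their moments. -/
theorem measure_ext_of_moments {μ ν : Measure ℝ} [IsFiniteMeasure μ] [IsFiniteMeasure ν] {M : ℝ}
    (hμ : ∀ᵐ x ∂μ, |x| ≤ M) (hν : ∀ᵐ x ∂ν, |x| ≤ M)
    (h : ∀ f : ℝ[X], ∫ x, f.eval x ∂μ = ∫ x, f.eval x ∂ν) : μ = ν := by
  refine ext_of_forall_integral_eq_of_IsFiniteMeasure fun g => ?_
  have hint : ∀ (μ : Measure ℝ) [IsFiniteMeasure μ] (hμ : ∀ᵐ x ∂μ, |x| ≤ M) (f : ℝ[X]),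
      Integrable (fun x => f.eval x) μ := by
    intro μ _ hμ f
    obtain ⟨K, hK⟩ := (isCompact_Icc (a := -M) (b := M)).exists_bound_of_continuousOn
      (f := fun x => f.eval x) (by fun_prop)
    refine Integrable.of_bound (by fun_prop) K ?_
    filter_upwards [hμ] with x hx using hK x (abs_le.1 hx)
  refine eq_of_abs_sub_le_all fun ε hε => ?_
  set δ := ε / (μ.real Set.univ + ν.real Set.univ + 1) with hδ
  have hδ0 : 0 < δ := by positivity
  obtain ⟨f, hf⟩ := exists_polynomial_near_of_continuousOn (-M) M g (by fun_prop) δ hδ0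
  have hclose : ∀ (μ : Measure ℝ) [IsFiniteMeasure μ] (hμ : ∀ᵐ x ∂μ, |x| ≤ M),
      |∫ x, g x ∂μ - ∫ x, f.eval x ∂μ| ≤ δ * μ.real Set.univ := by
    intro μ _ hμ
    rw [← integral_sub (g.integrable μ) (hint μ hμ f), ← Real.norm_eq_abs]
    refine norm_integral_le_of_norm_le_const ?_
    filter_upwards [hμ] with x hx
    rw [norm_sub_rev]
    exact (hf x (abs_le.1 hx)).le
  have h1 := abs_le.1 (hclose μ hμ)
  have h2 := abs_le.1 (hclose ν hν)
  rw [h f] at h1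
  have h3 : δ * (μ.real Set.univ + ν.real Set.univ + 1) = ε := by rw [hδ]; field_simp
  rw [abs_le]
  constructor <;> nlinarith

theorem jostSq_nonneg (p q : ℕ → ℝ) (n : ℕ) {x : ℝ} (hx : x ∈ Set.Icc (-2 : ℝ) 2) :
    0 ≤ (jostSq p q n).eval x := by
  simp only [jostSq, eval_sub, eval_add, eval_pow, eval_mul, eval_X]
  obtain ⟨h1, h2⟩ := hx
  set a := (orthoPoly p q (n + 1)).eval x
  set b := (orthoPoly p q n).eval x
  nlinarith [mul_nonneg (by linarith : 0 ≤ 2 - x) (sq_nonneg (a + b)),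
    mul_nonneg (by linarith : 0 ≤ 2 + x) (sq_nonneg (a - b))]

section

variable {p q : ℕ → ℝ} {J J₀ : H →L[ℝ] H} {σ : Measure ℝ}

theorem jostSq_mul_sqrt_nonneg (p q : ℕ → ℝ) (n : ℕ) (x : ℝ) :
    0 ≤ (jostSq p q n).eval x * √(4 - x ^ 2) / (2 * π) := by
  by_cases hx : x ∈ Set.Icc (-2 : ℝ) 2
  · have := jostSq_nonneg p q n hx
    positivity
  · rw [Real.sqrt_eq_zero_of_nonpos, mul_zero, zero_div]
    rw [Set.mem_Icc, not_and_or, not_le, not_le] at hx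
    rcases hx with h | h <;> nlinarith

theorem sqrt_four_sub_sq_eq_zero {x : ℝ} (hx : x ∉ Set.Icc (-2 : ℝ) 2) : √(4 - x ^ 2) = 0 := by
  apply Real.sqrt_eq_zero_of_nonpos
  rw [Set.mem_Icc, not_and_or, not_le, not_le] at hx
  rcases hx with h | h <;> nlinarith

theorem IsSpectral.withDensity_jostSq [IsProbabilityMeasure σ] (hσ : IsSpectral J σ)
    (hJ : IsJacobi p q J) (hp : ∀ k, 1 ≤ k → 0 < p k)
    (hJ₀ : IsJacobi (fun _ => 1) (fun _ => 0) J₀) {N : ℕ}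
    (hN : ∀ k, N ≤ k → p k = 1 ∧ q k = 0) :
    σ.withDensity (fun x => ENNReal.ofReal ((jostSq p q N).eval x ^ 2)) =
      volume.withDensity
        (fun x => ENNReal.ofReal ((jostSq p q N).eval x * √(4 - x ^ 2) / (2 * π))) := by
  set R := jostSq p q N with hR
  have hi1 : Integrable (fun x => R.eval x ^ 2) σ := by
    have := hσ.integrable_eval hJ hp (R ^ 2)
    simp only [eval_pow] at this
    exact this
  have hsupp : ∀ f : ℝ[X], (fun x => f.eval x * (R.eval x * √(4 - x ^ 2) / (2 * π))) =
      (Set.Icc (-2 : ℝ) 2).indicator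
        (fun x => (2 * π)⁻¹ * ((R * f).eval x * √(4 - x ^ 2))) := by
    intro f
    ext x
    by_cases hx : x ∈ Set.Icc (-2 : ℝ) 2
    · rw [Set.indicator_of_mem hx, eval_mul]
      field_simp
    · rw [Set.indicator_of_notMem hx, sqrt_four_sub_sq_eq_zero hx]
      simp
  have hi2 : Integrable (fun x => R.eval x * √(4 - x ^ 2) / (2 * π)) := by
    have := hsupp 1
    simp only [eval_one, one_mul] at this
    rw [this, integrable_indicator_iff measurableSet_Icc]
    exact (Continuous.continuousOn (by fun_prop)).integrableOn_Icc
  have : IsFiniteMeasure (σ.withDensity (fun x => ENNReal.ofReal (R.eval x ^ 2))) :=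
    isFiniteMeasure_withDensity_ofReal hi1.2
  have : IsFiniteMeasure (volume.withDensity
      (fun x => ENNReal.ofReal (R.eval x * √(4 - x ^ 2) / (2 * π)))) :=
    isFiniteMeasure_withDensity_ofReal hi2.2
  refine measure_ext_of_moments (M := max (‖J‖ + 1) 2) ?_ ?_ fun f => ?_
  · refine (withDensity_absolutelyContinuous _ _).ae_le ?_
    filter_upwards [hσ.ae_abs_le hJ hp] with x hx using hx.trans (le_max_left _ _)
  · rw [ae_withDensity_iff (by fun_prop)]
    refine ae_of_all _ fun x hx => le_trans ?_ (le_max_right _ _)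
    by_contra h
    apply hx
    rw [sqrt_four_sub_sq_eq_zero (fun h' => h (abs_le.2 h'))]
    simp
  · rw [integral_withDensity_eq_integral_toReal_smul (by fun_prop) (by simp),
      integral_withDensity_eq_integral_toReal_smul (by fun_prop) (by simp)]
    have h1 : ∀ x, (ENNReal.ofReal (R.eval x ^ 2)).toReal • f.eval x = (R * (R * f)).eval x := by
      intro x
      rw [ENNReal.toReal_ofReal (sq_nonneg _), eval_mul, eval_mul, smul_eq_mul]
      ring
    have h2 : ∀ x, (ENNReal.ofReal (R.eval x * √(4 - x ^ 2) / (2 * π))).toReal • f.eval x =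
        f.eval x * (R.eval x * √(4 - x ^ 2) / (2 * π)) := by
      intro x
      rw [ENNReal.toReal_ofReal (jostSq_mul_sqrt_nonneg _ _ _ _), smul_eq_mul, mul_comm]
    simp only [h1, h2]
    rw [hσ.integral_eval hJ hp, hJ.inner_jostSq hJ₀ hp hN, hsupp,
      integral_indicator measurableSet_Icc, integral_const_mul, integral_semicircle hJ₀]
    field_simp

theorem IsJacobi.jostSq_ne_zero (hJ : IsJacobi p q J) (hp : ∀ k, 1 ≤ k → 0 < p k)
    (hJ₀ : IsJacobi (fun _ => 1) (fun _ => 0) J₀) {N : ℕ}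
    (hN : ∀ k, N ≤ k → p k = 1 ∧ q k = 0) : jostSq p q N ≠ 0 := by
  intro h
  have := hJ.inner_jostSq hJ₀ hp hN 1
  simp [h, norm_e] at this

theorem IsSpectral.ae_density_eq [IsProbabilityMeasure σ] (hσ : IsSpectral J σ)
    (hJ : IsJacobi p q J) (hp : ∀ k, 1 ≤ k → 0 < p k)
    (hJ₀ : IsJacobi (fun _ => 1) (fun _ => 0) J₀) {N : ℕ}
    (hN : ∀ k, N ≤ k → p k = 1 ∧ q k = 0) :
    ∀ᵐ x ∂(volume.restrict (Set.Icc (-2 : ℝ) 2)),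
      √(4 - x ^ 2) / (2 * π * (σ.rnDeriv volume x).toReal) = (jostSq p q N).eval x := by
  have h0 := hσ.withDensity_jostSq hJ hp hJ₀ hN
  set R := jostSq p q N with hR
  have h1 := Measure.rnDeriv_withDensity_left (μ := σ) (ν := volume)
    (f := fun x => ENNReal.ofReal (R.eval x ^ 2)) (by fun_prop) (by simp)
  have h2 := Measure.rnDeriv_withDensity (volume : Measure ℝ)
    (f := fun x => ENNReal.ofReal (R.eval x * √(4 - x ^ 2) / (2 * π))) (by fun_prop)
  have h3 : ∀ᵐ x ∂(volume : Measure ℝ), R.eval x ≠ 0 := by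
    have : {x | R.eval x = 0}.Countable := by
      refine (R.roots.toFinset.finite_toSet.subset fun x hx => ?_).countable
      simpa [hR, hJ.jostSq_ne_zero hp hJ₀ hN] using hx
    simpa using this.ae_notMem volume
  rw [h0] at h1
  have h4 : ∀ᵐ x ∂(volume.restrict (Set.Icc (-2 : ℝ) 2)), x ∈ Set.Ioo (-2 : ℝ) 2 := by
    rw [← restrict_Ioo_eq_restrict_Icc]
    exact ae_restrict_mem measurableSet_Ioo
  filter_upwards [h4, ae_restrict_of_ae h1, ae_restrict_of_ae h2, ae_restrict_of_ae h3]
    with x hx h1 h2 h3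
  have hs : 0 < √(4 - x ^ 2) := Real.sqrt_pos.2 (by nlinarith [hx.1, hx.2])
  have hRx : 0 < R.eval x :=
    lt_of_le_of_ne (jostSq_nonneg p q N (Set.Ioo_subset_Icc_self hx)) h3.symm
  have h5 := congrArg ENNReal.toReal (h1.symm.trans h2)
  rw [ENNReal.toReal_mul, ENNReal.toReal_ofReal (sq_nonneg _),
    ENNReal.toReal_ofReal (jostSq_mul_sqrt_nonneg _ _ _ _), ← hR] at h5
  have h6 : (σ.rnDeriv volume x).toReal = √(4 - x ^ 2) / (2 * π * R.eval x) := by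
    field_simp at h5 ⊢
    linarith
  rw [h6]
  field_simp

end

/-- The reversed orthonormal polynomials `z ^ k * P k (z + 1 / z)`. -/
def revPoly (p q : ℕ → ℝ) : ℕ → ℝ[X]
  | 0 => 1
  | 1 => C (p 1)⁻¹ * (1 + X ^ 2 - C (q 0) * X)
  | k + 2 => C (p (k + 2))⁻¹ *
      ((1 + X ^ 2 - C (q (k + 1)) * X) * revPoly p q (k + 1) - C (p (k + 1)) * X ^ 2 * revPoly p q k)

/-- The Jost function of a finite rank perturbation of the free Jacobi matrix, as a polynomial. -/
def jostPoly (p q : ℕ → ℝ) (n : ℕ) : ℝ[X] := revPoly p q (n + 1) - X ^ 2 * revPoly p q n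

section

variable {p q : ℕ → ℝ} {N : ℕ}

theorem revPoly_add_two (hp : ∀ k, 1 ≤ k → 0 < p k) (k : ℕ) :
    C (p (k + 2)) * revPoly p q (k + 2) = (1 + X ^ 2 - C (q (k + 1)) * X) * revPoly p q (k + 1) -
      C (p (k + 1)) * X ^ 2 * revPoly p q k := by
  rw [revPoly, ← mul_assoc, ← C_mul, mul_inv_cancel₀ (hp (k + 2) (by omega)).ne', C_1, one_mul]

theorem aeval_revPoly {K : Type*} [Field K] [Algebra ℝ K] {z : K} (hz : z ≠ 0) (k : ℕ) :
    aeval z (revPoly p q k) = z ^ k * aeval (z + z⁻¹) (orthoPoly p q k) := by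
  induction k using Nat.twoStepInduction with
  | zero => simp [revPoly, orthoPoly]
  | one =>
    simp only [revPoly, orthoPoly, map_mul, map_sub, map_add, aeval_C, aeval_X, map_one, map_pow]
    field_simp
    ring
  | more k h1 h2 =>
    simp only [revPoly, orthoPoly, map_mul, map_sub, map_add, aeval_C, aeval_X, map_one, map_pow,
      h1, h2]
    field_simp
    ring

theorem jostPoly_eq (hp : ∀ k, 1 ≤ k → 0 < p k) (hN : ∀ k, N ≤ k → p k = 1 ∧ q k = 0) {n : ℕ}
    (hn : N ≤ n) : jostPoly p q n = jostPoly p q N := by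
  induction n, hn using Nat.le_induction with
  | base => rfl
  | succ n hn ih =>
    have := revPoly_add_two (q := q) hp n
    rw [(hN (n + 2) (by omega)).1, (hN (n + 1) (by omega)).1, (hN (n + 1) (by omega)).2, C_1,
      C_0, one_mul, one_mul, zero_mul, sub_zero] at this
    rw [← ih, jostPoly, jostPoly, this]
    ring

theorem aeval_jostPoly {K : Type*} [Field K] [Algebra ℝ K] {z : K} (hz : z ≠ 0) (n : ℕ) :
    aeval z (jostPoly p q n) = z ^ (n + 1) *
      (aeval (z + z⁻¹) (orthoPoly p q (n + 1)) - z * aeval (z + z⁻¹) (orthoPoly p q n)) := by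
  simp only [jostPoly, map_sub, map_mul, map_pow, aeval_X, aeval_revPoly hz]
  ring

theorem aeval_jostSq {K : Type*} [Field K] [Algebra ℝ K] {z : K} (hz : z ≠ 0) (n : ℕ) :
    aeval (z + z⁻¹) (jostSq p q n) = aeval z (jostPoly p q n) * aeval z⁻¹ (jostPoly p q n) := by
  rw [aeval_jostPoly hz, aeval_jostPoly (inv_ne_zero hz), inv_inv, add_comm z⁻¹ z, jostSq]
  simp only [map_sub, map_add, map_mul, map_pow, aeval_X]
  have h1 : z ^ (n + 1) * z⁻¹ ^ (n + 1) = 1 := by rw [← mul_pow, mul_inv_cancel₀ hz, one_pow]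
  have h2 : z * z⁻¹ = 1 := mul_inv_cancel₀ hz
  generalize aeval (z + z⁻¹) (orthoPoly p q (n + 1)) = a
  generalize aeval (z + z⁻¹) (orthoPoly p q n) = b
  linear_combination (-(a - z * b) * (a - z⁻¹ * b)) * h1 - b ^ 2 * h2

theorem eval_zero_revPoly (k : ℕ) :
    (revPoly p q k).eval 0 = ∏ i ∈ Finset.range k, (p (i + 1))⁻¹ := by
  induction k using Nat.twoStepInduction with
  | zero => simp [revPoly]
  | one => simp [revPoly]
  | more k h1 h2 =>
    rw [Finset.prod_range_succ, ← h2]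
    rw [revPoly, mul_comm]
    simp

theorem eval_zero_jostPoly (n : ℕ) :
    (jostPoly p q n).eval 0 = ∏ i ∈ Finset.range (n + 1), (p (i + 1))⁻¹ := by
  simp [jostPoly, eval_zero_revPoly]

theorem eval_zero_jostPoly_pos (hp : ∀ k, 1 ≤ k → 0 < p k) (n : ℕ) :
    0 < (jostPoly p q n).eval 0 := by
  rw [eval_zero_jostPoly]
  exact Finset.prod_pos fun i _ => inv_pos.2 (hp _ (by omega))

/-- The Christoffel–Darboux formula on the diagonal. -/
theorem christoffel_darboux (hp : ∀ k, 1 ≤ k → 0 < p k) (x : ℝ) (k : ℕ) :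
    p (k + 1) * ((derivative (orthoPoly p q (k + 1))).eval x * (orthoPoly p q k).eval x -
      (orthoPoly p q (k + 1)).eval x * (derivative (orthoPoly p q k)).eval x) =
      ∑ j ∈ Finset.range (k + 1), (orthoPoly p q j).eval x ^ 2 := by
  induction k with
  | zero =>
    have h := congrArg (fun f => (derivative f).eval x) (orthoPoly_one (q := q) hp)
    simp at h
    simp [orthoPoly, (hp 1 le_rfl).ne']
  | succ k ih =>
    have h := congrArg (fun f => (derivative f).eval x) (orthoPoly_add_two (q := q) hp k)
    have h' := congrArg (fun f => f.eval x) (orthoPoly_add_two (q := q) hp k)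
    simp only [derivative_mul, derivative_sub, derivative_C, derivative_X, eval_sub, eval_add,
      eval_mul, eval_C, eval_X, eval_one, zero_mul, zero_add, sub_zero] at h h'
    rw [Finset.sum_range_succ, ← ih]
    linear_combination (orthoPoly p q (k + 1)).eval x * h -
      (derivative (orthoPoly p q (k + 1))).eval x * h'

theorem christoffel_darboux_im (hp : ∀ k, 1 ≤ k → 0 < p k) (x : ℂ) (k : ℕ) :
    p (k + 1) * (aeval x (orthoPoly p q (k + 1)) *
      (starRingEnd ℂ) (aeval x (orthoPoly p q k))).im =
      x.im * ∑ j ∈ Finset.range (k + 1), Complex.normSq (aeval x (orthoPoly p q j)) := by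
  induction k with
  | zero =>
    have h1 := (hp 1 le_rfl).ne'
    simp [orthoPoly]
    field_simp
  | succ k ih =>
    have h' := congrArg (fun f => aeval x f) (orthoPoly_add_two (q := q) hp k)
    simp only [map_mul, map_sub, aeval_C, aeval_X, Complex.coe_algebraMap] at h'
    rw [Finset.sum_range_succ, mul_add, ← ih]
    have hre := congrArg Complex.re h'
    have him := congrArg Complex.im h'
    simp only [Complex.mul_re, Complex.mul_im, Complex.sub_re, Complex.sub_im, Complex.ofReal_re,
      Complex.ofReal_im, zero_mul, sub_zero, add_zero, Complex.conj_re, Complex.conj_im,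
      Complex.normSq_apply] at hre him ⊢
    linear_combination (aeval x (orthoPoly p q (k + 1))).re * him -
      (aeval x (orthoPoly p q (k + 1))).im * hre

theorem im_eq_zero_of_jostPoly (hp : ∀ k, 1 ≤ k → 0 < p k)
    (hN : ∀ k, N ≤ k → p k = 1 ∧ q k = 0) {z : ℂ} (hz1 : ‖z‖ < 1)
    (h : aeval z (jostPoly p q N) = 0) : z.im = 0 := by
  rcases eq_or_ne z 0 with rfl | hz
  · simp
  rw [aeval_jostPoly hz, mul_eq_zero, or_iff_right (pow_ne_zero _ hz), sub_eq_zero] at h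
  have hcd := christoffel_darboux_im (q := q) hp (z + z⁻¹) N
  rw [h, (hN (N + 1) (by omega)).1, one_mul, mul_assoc, Complex.mul_conj, Complex.mul_im,
    Complex.ofReal_re, Complex.ofReal_im, Complex.add_im, Complex.inv_im] at hcd
  have hs : 1 ≤ ∑ j ∈ Finset.range (N + 1),
      Complex.normSq (aeval (z + z⁻¹) (orthoPoly p q j)) := by
    rw [Finset.sum_range_succ']
    have : Complex.normSq (aeval (z + z⁻¹) (orthoPoly p q 0)) = 1 := by simp [orthoPoly]
    rw [this]
    linarith [Finset.sum_nonneg fun j (_ : j ∈ Finset.range N) =>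
      Complex.normSq_nonneg (aeval (z + z⁻¹) (orthoPoly p q (j + 1)))]
  set S := ∑ j ∈ Finset.range (N + 1), Complex.normSq (aeval (z + z⁻¹) (orthoPoly p q j))
  set B := Complex.normSq (aeval (z + z⁻¹) (orthoPoly p q N))
  have hB : 0 ≤ B := Complex.normSq_nonneg _
  have hr : 0 < Complex.normSq z := Complex.normSq_pos.2 hz
  have hr1 : Complex.normSq z < 1 := by
    rw [Complex.normSq_eq_norm_sq]; nlinarith [norm_nonneg z]
  have hfac : z.im * (B * Complex.normSq z + (1 - Complex.normSq z) * S) = 0 := by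
    field_simp at hcd
    linear_combination hcd
  have hpos : 0 < B * Complex.normSq z + (1 - Complex.normSq z) * S := by
    have : 0 < (1 - Complex.normSq z) * S := mul_pos (by linarith) (by linarith)
    positivity
  exact (mul_eq_zero.1 hfac).resolve_right hpos.ne'

theorem derivative_jostPoly_ne_zero (hp : ∀ k, 1 ≤ k → 0 < p k)
    (hN : ∀ k, N ≤ k → p k = 1 ∧ q k = 0) {z : ℝ} (hz1 : |z| < 1)
    (h : (jostPoly p q N).eval z = 0) : (derivative (jostPoly p q N)).eval z ≠ 0 := by
  have hz : z ≠ 0 := by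
    rintro rfl
    exact (eval_zero_jostPoly_pos (q := q) hp N).ne' h
  have hf : ∀ y : ℝ, y ≠ 0 → (jostPoly p q N).eval y = y ^ (N + 1) *
      ((orthoPoly p q (N + 1)).eval (y + y⁻¹) - y * (orthoPoly p q N).eval (y + y⁻¹)) := by
    intro y hy
    simpa [coe_aeval_eq_eval] using aeval_jostPoly (p := p) (q := q) hy N
  rw [hf z hz, mul_eq_zero, or_iff_right (pow_ne_zero _ hz)] at h
  have hx : HasDerivAt (fun y : ℝ => y + y⁻¹) (1 - (z ^ 2)⁻¹) z :=
    ((hasDerivAt_id z).add (hasDerivAt_inv hz)).congr_deriv (sub_eq_add_neg _ _).symm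
  have hP : ∀ k, HasDerivAt (fun y : ℝ => (orthoPoly p q k).eval (y + y⁻¹))
      ((derivative (orthoPoly p q k)).eval (z + z⁻¹) * (1 - (z ^ 2)⁻¹)) z := fun k =>
    HasDerivAt.comp (h₂ := fun x => (orthoPoly p q k).eval x) z
      ((orthoPoly p q k).hasDerivAt (z + z⁻¹)) hx
  have hd := (hasDerivAt_pow (N + 1) z).mul ((hP (N + 1)).sub ((hasDerivAt_id z).mul (hP N)))
  have hd' := ((jostPoly p q N).hasDerivAt z).unique
    (hd.congr_of_eventuallyEq ((eventually_ne_nhds hz).mono hf))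
  have hcd := christoffel_darboux (q := q) hp (z + z⁻¹) N
  rw [(hN (N + 1) (by omega)).1, one_mul] at hcd
  simp only [Pi.sub_apply, Pi.mul_apply, id] at hd'
  rw [h, mul_zero, zero_add] at hd'
  have hs : 1 ≤ ∑ j ∈ Finset.range (N + 1), (orthoPoly p q j).eval (z + z⁻¹) ^ 2 := by
    rw [Finset.sum_range_succ']
    have : (orthoPoly p q 0).eval (z + z⁻¹) ^ 2 = 1 := by simp [orthoPoly]
    rw [this]
    linarith [Finset.sum_nonneg fun j (_ : j ∈ Finset.range N) =>
      sq_nonneg ((orthoPoly p q (j + 1)).eval (z + z⁻¹))]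
  rw [← hcd] at hs
  intro h0
  rw [h0, eq_comm, mul_eq_zero, or_iff_right (pow_ne_zero _ hz)] at hd'
  have hz2 : 1 < (z ^ 2)⁻¹ := by
    rw [one_lt_inv₀ (by positivity)]
    rw [← sq_abs]; nlinarith [abs_nonneg z]
  rw [sub_eq_zero] at h
  rw [h] at hs
  nlinarith [sq_nonneg ((orthoPoly p q N).eval (z + z⁻¹)),
    congrArg (· * (orthoPoly p q N).eval (z + z⁻¹)) hd']

end

section

variable {p q : ℕ → ℝ} {J : H →L[ℝ] H} {σ : Measure ℝ} {N : ℕ}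

theorem eval_jostPoly {z : ℝ} (hz : z ≠ 0) (n : ℕ) :
    (jostPoly p q n).eval z = z ^ (n + 1) *
      ((orthoPoly p q (n + 1)).eval (z + z⁻¹) - z * (orthoPoly p q n).eval (z + z⁻¹)) := by
  simpa [coe_aeval_eq_eval] using aeval_jostPoly (p := p) (q := q) hz n

theorem IsSpectral.integral_eval_sq [IsProbabilityMeasure σ] (hσ : IsSpectral J σ)
    (hJ : IsJacobi p q J) (hp : ∀ k, 1 ≤ k → 0 < p k) (f : ℝ[X]) :
    ∫ x, f.eval x ^ 2 ∂σ = ‖aeval J f (e 0)‖ ^ 2 := by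
  have := hσ.integral_eval hJ hp (f * f)
  rw [map_mul, mul_apply_eq_comp, hJ.inner_aeval_comm, real_inner_self_eq_norm_sq] at this
  simpa [sq] using this

theorem IsSpectral.measureReal_singleton_mul_le [IsProbabilityMeasure σ] (hσ : IsSpectral J σ)
    (hJ : IsJacobi p q J) (hp : ∀ k, 1 ≤ k → 0 < p k) (x : ℝ) (f : ℝ[X]) :
    σ.real {x} * f.eval x ^ 2 ≤ ‖aeval J f (e 0)‖ ^ 2 := by
  rw [← hσ.integral_eval_sq hJ hp]
  have hi : Integrable (fun x => f.eval x ^ 2) σ :=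
    (hσ.integrable_eval hJ hp (f ^ 2)).congr (ae_of_all _ fun x => eval_pow 2)
  have := setIntegral_le_integral (s := {x}) hi (ae_of_all _ fun x => sq_nonneg (f.eval x))
  rwa [integral_singleton, smul_eq_mul] at this

theorem IsSpectral.jostPoly_eq_zero [IsProbabilityMeasure σ] (hσ : IsSpectral J σ)
    (hJ : IsJacobi p q J) (hp : ∀ k, 1 ≤ k → 0 < p k)
    (hN : ∀ k, N ≤ k → p k = 1 ∧ q k = 0) {z : ℝ} (hz : z ≠ 0) (hz1 : |z| < 1)
    (h : σ {z + z⁻¹} ≠ 0) : (jostPoly p q N).eval z = 0 := by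
  have hpos : 0 < σ.real {z + z⁻¹} := ENNReal.toReal_pos h (measure_ne_top _ _)
  set c := σ.real {z + z⁻¹}
  have hb : ∀ k, |(orthoPoly p q k).eval (z + z⁻¹)| ≤ c⁻¹ + 1 := by
    intro k
    have := hσ.measureReal_singleton_mul_le hJ hp (z + z⁻¹) (orthoPoly p q k)
    rw [hJ.aeval_orthoPoly hp, norm_e, one_pow, ← le_div_iff₀' hpos, one_div, ← sq_abs] at this
    have h0 : 0 < c⁻¹ := inv_pos.2 hpos
    nlinarith [abs_nonneg ((orthoPoly p q k).eval (z + z⁻¹))]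
  have hle : ∀ n, N ≤ n → ‖(jostPoly p q N).eval z‖ ≤ |z| ^ n * (2 * (c⁻¹ + 1)) := by
    intro n hn
    rw [← jostPoly_eq hp hN hn, eval_jostPoly hz, Real.norm_eq_abs, abs_mul, abs_pow, pow_succ,
      mul_assoc]
    refine mul_le_mul_of_nonneg_left ?_ (by positivity)
    calc _ ≤ 1 * (|(orthoPoly p q (n + 1)).eval (z + z⁻¹)| +
          |z * (orthoPoly p q n).eval (z + z⁻¹)|) :=
          mul_le_mul hz1.le (abs_sub _ _) (abs_nonneg _) zero_le_one
      _ ≤ _ := by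
          rw [abs_mul]
          nlinarith [hb n, hb (n + 1), abs_nonneg ((orthoPoly p q n).eval (z + z⁻¹))]
  have ht : Tendsto (fun n : ℕ => |z| ^ n * (2 * (c⁻¹ + 1))) atTop (𝓝 0) := by
    simpa using (tendsto_pow_atTop_nhds_zero_of_lt_one (abs_nonneg z) hz1).mul_const (2 * (c⁻¹ + 1))
  exact norm_le_zero_iff.1 (ge_of_tendsto ht (eventually_atTop.2 ⟨N, hle⟩))

/-- A square summable sequence of values of the orthonormal polynomials is an eigenvector, hence
produces an atom. -/
theorem IsSpectral.measure_singleton_ne_zero [IsProbabilityMeasure σ] (hσ : IsSpectral J σ)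
    (hJ : IsJacobi p q J) (hp : ∀ k, 1 ≤ k → 0 < p k) {x : ℝ}
    (hx : Summable fun k => (orthoPoly p q k).eval x ^ 2) : σ {x} ≠ 0 := by
  let v : H := ⟨fun k => (orthoPoly p q k).eval x, memℓp_gen (by simpa using hx)⟩
  have hv : ∀ f : ℝ[X], ⟪aeval J f (e 0), v⟫ = f.eval x := by
    refine orthoPoly_induction (q := q) hp (fun k => ?_) (fun f g hf hg => ?_) (fun c f hf => ?_)
    · rw [hJ.aeval_orthoPoly hp, inner_e_left]
    · rw [map_add, _root_.add_apply, inner_add_left, hf, hg, eval_add]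
    · rw [map_smul, _root_.smul_apply, real_inner_smul_left, hf, eval_smul, smul_eq_mul]
  have hle : ∀ f : ℝ[X], f.eval x ^ 2 ≤ ‖v‖ ^ 2 * ∫ t, f.eval t ^ 2 ∂σ := by
    intro f
    rw [hσ.integral_eval_sq hJ hp, ← hv f, ← mul_pow, mul_comm]
    exact sq_le_sq' (neg_le_of_abs_le (abs_real_inner_le_norm _ _)) (real_inner_le_norm _ _)
  set L := ‖J‖ + 1 + |x|
  have hL : 0 < L := by positivity
  let f : ℕ → ℝ[X] := fun n => (1 - C (L ^ 2)⁻¹ * (X - C x) ^ 2) ^ n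
  have hfe : ∀ n t, (f n).eval t = (1 - (L ^ 2)⁻¹ * (t - x) ^ 2) ^ n := fun n t => by simp [f]
  have hbd : ∀ᵐ t ∂σ, 0 ≤ 1 - (L ^ 2)⁻¹ * (t - x) ^ 2 := by
    filter_upwards [hσ.ae_abs_le hJ hp] with t ht
    rw [sub_nonneg, inv_mul_le_iff₀ (by positivity), mul_one]
    refine sq_le_sq' ?_ ?_ <;> linarith [abs_le.1 ht, le_abs_self x, neg_abs_le x]
  have ht : Tendsto (fun n => ∫ t, (f n).eval t ^ 2 ∂σ) atTop
      (𝓝 (∫ t, Set.indicator {x} (fun _ => (1 : ℝ)) t ∂σ)) := by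
    refine tendsto_integral_of_dominated_convergence (fun _ => 1)
      (fun n => (Continuous.aestronglyMeasurable (by fun_prop))) (integrable_const _)
      (fun n => ?_) ?_
    · filter_upwards [hbd] with t ht
      have h1 : 1 - (L ^ 2)⁻¹ * (t - x) ^ 2 ≤ 1 := by
        have : 0 ≤ (L ^ 2)⁻¹ * (t - x) ^ 2 := by positivity
        linarith
      rw [hfe, Real.norm_of_nonneg (by positivity), ← pow_mul]
      exact pow_le_one₀ ht h1
    · filter_upwards [hbd] with t ht
      simp only [hfe, ← pow_mul]
      by_cases htx : t = x
      · simp [htx]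
      · rw [Set.indicator_of_notMem (by simpa using htx)]
        have h1 : 1 - (L ^ 2)⁻¹ * (t - x) ^ 2 < 1 := by
          have : 0 < (L ^ 2)⁻¹ * (t - x) ^ 2 := by
            have := sub_ne_zero.2 htx
            positivity
          linarith
        exact (tendsto_pow_atTop_nhds_zero_of_lt_one ht h1).comp
          (tendsto_id.atTop_mul_const' two_pos)
  rw [integral_indicator (measurableSet_singleton x)] at ht
  intro h0
  rw [Measure.restrict_eq_zero.2 h0, integral_zero_measure] at ht
  have h1 : ∀ n, 1 ≤ ‖v‖ ^ 2 * ∫ t, (f n).eval t ^ 2 ∂σ := fun n =>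
    le_of_eq_of_le (by simp [hfe]) (hle (f n))
  have hge := ge_of_tendsto' (ht.const_mul (‖v‖ ^ 2)) h1
  linarith

theorem IsSpectral.measure_singleton_ne_zero_of_jostPoly [IsProbabilityMeasure σ]
    (hσ : IsSpectral J σ) (hJ : IsJacobi p q J) (hp : ∀ k, 1 ≤ k → 0 < p k)
    (hN : ∀ k, N ≤ k → p k = 1 ∧ q k = 0) {z : ℝ} (hz : z ≠ 0) (hz1 : |z| < 1)
    (h : (jostPoly p q N).eval z = 0) : σ {z + z⁻¹} ≠ 0 := by
  refine hσ.measure_singleton_ne_zero hJ hp ((summable_nat_add_iff N).1 ?_)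
  have hgeo : ∀ j, (orthoPoly p q (j + N)).eval (z + z⁻¹) =
      z ^ j * (orthoPoly p q N).eval (z + z⁻¹) := by
    intro j
    induction j with
    | zero => simp
    | succ j ih =>
      have := h
      rw [← jostPoly_eq hp hN (show N ≤ j + N by omega), eval_jostPoly hz, mul_eq_zero,
        or_iff_right (pow_ne_zero _ hz), sub_eq_zero] at this
      rw [add_right_comm, this, ih, pow_succ]
      ring
  simp only [hgeo, mul_pow, pow_right_comm z _ 2]
  refine (summable_geometric_of_lt_one (sq_nonneg z) ?_).mul_right _
  rwa [sq_lt_one_iff_abs_lt_one]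

end

theorem exists_add_inv {x : ℝ} (hx : x ∉ Set.Icc (-2 : ℝ) 2) :
    ∃ z : ℝ, z ≠ 0 ∧ |z| < 1 ∧ z + z⁻¹ = x := by
  have key : ∀ x : ℝ, 2 < x → ∃ z : ℝ, z ≠ 0 ∧ |z| < 1 ∧ z + z⁻¹ = x := by
    intro x hx
    have hs : √(x ^ 2 - 4) ^ 2 = x ^ 2 - 4 := Real.sq_sqrt (by nlinarith)
    have hs0 := Real.sqrt_nonneg (x ^ 2 - 4)
    set s := √(x ^ 2 - 4)
    have hsx : s < x := by nlinarith
    have hz : 0 < (x - s) / 2 := by linarith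
    refine ⟨(x - s) / 2, hz.ne', ?_, ?_⟩
    · rw [abs_of_pos hz]
      nlinarith
    · have : ((x - s) / 2)⁻¹ = (x + s) / 2 := by
        refine inv_eq_of_mul_eq_one_right ?_
        linear_combination (-1 / 4) * hs
      rw [this]; ring
  rw [Set.mem_Icc, not_and_or, not_le, not_le] at hx
  rcases hx with h | h
  · obtain ⟨z, hz, hz1, h⟩ := key (-x) (by linarith)
    exact ⟨-z, neg_ne_zero.2 hz, by rwa [abs_neg], by rw [inv_neg]; linarith⟩
  · exact key x h

theorem two_lt_add_inv {z : ℝ} (hz : 0 < z) (hz1 : z < 1) : 2 < z + z⁻¹ := by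
  have : z + z⁻¹ - 2 = (1 - z) ^ 2 / z := by field_simp; ring
  have h : 0 < (1 - z) ^ 2 / z := by
    have := sub_pos.2 hz1
    positivity
  linarith

theorem add_inv_notMem {z : ℝ} (hz : z ≠ 0) (hz1 : |z| < 1) : z + z⁻¹ ∉ Set.Icc (-2 : ℝ) 2 := by
  rintro ⟨h1, h2⟩
  rw [abs_lt] at hz1
  rcases hz.lt_or_gt with h | h
  · have := two_lt_add_inv (neg_pos.2 h) (by linarith)
    rw [inv_neg] at this
    linarith
  · linarith [two_lt_add_inv h (by linarith)]

theorem add_inv_injOn : Set.InjOn (fun z : ℝ => z + z⁻¹) {z | z ≠ 0 ∧ |z| < 1} := by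
  rintro x ⟨hx, hx1⟩ y ⟨hy, hy1⟩ h
  have h1 : (x - y) * (1 - x * y) = 0 := by
    simp only at h
    field_simp at h
    linear_combination (-1) * h
  rcases mul_eq_zero.1 h1 with h | h
  · linarith
  · have : |x * y| < 1 := by
      rw [abs_mul]
      nlinarith [abs_nonneg x, abs_nonneg y]
    rw [abs_lt] at this
    linarith

section

variable {p q : ℕ → ℝ} {J : H →L[ℝ] H} {σ : Measure ℝ} {N : ℕ}

theorem jostPoly_ne_zero (hp : ∀ k, 1 ≤ k → 0 < p k) (n : ℕ) : jostPoly p q n ≠ 0 := by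
  intro h
  have := eval_zero_jostPoly_pos (q := q) hp n
  simp [h] at this

theorem aeval_ofReal_jostPoly (n : ℕ) (z : ℝ) :
    aeval (z : ℂ) (jostPoly p q n) = (((jostPoly p q n).eval z : ℝ) : ℂ) := by
  have := aeval_algebraMap_apply ℂ z (jostPoly p q n)
  simpa [coe_aeval_eq_eval] using this

theorem IsSpectral.setOf_atoms [IsProbabilityMeasure σ] (hσ : IsSpectral J σ)
    (hJ : IsJacobi p q J) (hp : ∀ k, 1 ≤ k → 0 < p k)
    (hN : ∀ k, N ≤ k → p k = 1 ∧ q k = 0) :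
    {x : ℝ | σ {x} ≠ 0 ∧ x ∉ Set.Icc (-2 : ℝ) 2} =
      (fun z => z + z⁻¹) '' {z : ℝ | |z| < 1 ∧ (jostPoly p q N).eval z = 0} := by
  have hz0 : ∀ z : ℝ, (jostPoly p q N).eval z = 0 → z ≠ 0 := by
    rintro z h rfl
    exact (eval_zero_jostPoly_pos (q := q) hp N).ne' h
  ext x
  constructor
  · rintro ⟨h, hx⟩
    obtain ⟨z, hz, hz1, rfl⟩ := exists_add_inv hx
    exact ⟨z, ⟨hz1, hσ.jostPoly_eq_zero hJ hp hN hz hz1 h⟩, rfl⟩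
  · rintro ⟨z, ⟨hz1, h⟩, rfl⟩
    exact ⟨hσ.measure_singleton_ne_zero_of_jostPoly hJ hp hN (hz0 z h) hz1 h,
      add_inv_notMem (hz0 z h) hz1⟩

theorem finite_jostPoly_zeros (hp : ∀ k, 1 ≤ k → 0 < p k) :
    {z : ℝ | |z| < 1 ∧ (jostPoly p q N).eval z = 0}.Finite :=
  (jostPoly p q N).roots.toFinset.finite_toSet.subset fun z hz => by
    simpa [jostPoly_ne_zero hp] using hz.2

theorem nodup_filter_aroots (hp : ∀ k, 1 ≤ k → 0 < p k)
    (hN : ∀ k, N ≤ k → p k = 1 ∧ q k = 0) :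
    (((jostPoly p q N).aroots ℂ).filter (‖·‖ < 1)).Nodup := by
  have hD := jostPoly_ne_zero (q := q) hp N
  rw [Multiset.nodup_iff_count_le_one]
  intro ζ
  by_cases hζ : ‖ζ‖ < 1
  · rw [Multiset.count_filter_of_pos (p := fun ζ : ℂ => ‖ζ‖ < 1) hζ, aroots, count_roots]
    by_contra! hc
    rw [one_lt_rootMultiplicity_iff_isRoot (map_ne_zero hD)] at hc
    obtain ⟨h2, h1⟩ := hc
    rw [IsRoot, eval_map_algebraMap] at h2
    rw [IsRoot, derivative_map, eval_map_algebraMap] at h1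
    have him := im_eq_zero_of_jostPoly hp hN hζ h2
    obtain ⟨z, rfl⟩ : ∃ z : ℝ, (z : ℂ) = ζ := ⟨ζ.re, Complex.ext rfl him.symm⟩
    have h1' := aeval_algebraMap_apply ℂ z (derivative (jostPoly p q N))
    rw [aeval_ofReal_jostPoly, Complex.ofReal_eq_zero] at h2
    rw [Complex.coe_algebraMap, h1, coe_aeval_eq_eval, eq_comm, Complex.ofReal_eq_zero] at h1'
    exact derivative_jostPoly_ne_zero hp hN (by simpa using hζ) h2 h1'
  · rw [Multiset.count_eq_zero_of_notMem]
    · exact zero_le_one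
    · simp [hζ]

/-- A sum over the atoms outside `[-2, 2]` is a sum over the zeros of the Jost function in the
unit disc. -/
theorem IsSpectral.tsum_atoms [IsProbabilityMeasure σ] (hσ : IsSpectral J σ)
    (hJ : IsJacobi p q J) (hp : ∀ k, 1 ≤ k → 0 < p k)
    (hN : ∀ k, N ≤ k → p k = 1 ∧ q k = 0) (F : ℝ → ℝ) :
    ∑' x : {x : ℝ | σ {x} ≠ 0 ∧ x ∉ Set.Icc (-2 : ℝ) 2}, F x =
      ((((jostPoly p q N).aroots ℂ).filter (‖·‖ < 1)).map
        fun ζ => F (ζ.re + ζ.re⁻¹)).sum := by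
  have hD := jostPoly_ne_zero (q := q) hp N
  have hz0 : ∀ z : ℝ, (jostPoly p q N).eval z = 0 → z ≠ 0 := by
    rintro z h rfl
    exact (eval_zero_jostPoly_pos (q := q) hp N).ne' h
  have hinj : Set.InjOn (fun z : ℝ => z + z⁻¹) {z | |z| < 1 ∧ (jostPoly p q N).eval z = 0} :=
    add_inv_injOn.mono fun z (hz : _ ∧ _) => And.intro (hz0 z hz.2) hz.1
  rw [hσ.setOf_atoms hJ hp hN, tsum_image F hinj]
  have hfin := finite_jostPoly_zeros (q := q) (N := N) hp
  let S : Finset ℂ := ⟨_, nodup_filter_aroots hp hN⟩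
  have hS : S = hfin.toFinset.map ⟨((↑) : ℝ → ℂ), Complex.ofReal_injective⟩ := by
    ext ζ
    simp only [S, Finset.mem_mk, Multiset.mem_filter, mem_aroots, Finset.mem_map,
      Set.Finite.mem_toFinset, Set.mem_ofPred_eq, Function.Embedding.coeFn_mk]
    constructor
    · rintro ⟨⟨-, h⟩, hζ⟩
      have him := im_eq_zero_of_jostPoly hp hN hζ h
      obtain ⟨z, rfl⟩ : ∃ z : ℝ, (z : ℂ) = ζ := ⟨ζ.re, Complex.ext rfl him.symm⟩
      rw [aeval_ofReal_jostPoly, Complex.ofReal_eq_zero] at h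
      exact ⟨z, ⟨by simpa using hζ, h⟩, rfl⟩
    · rintro ⟨z, ⟨hz, h⟩, rfl⟩
      rw [aeval_ofReal_jostPoly, h]
      exact ⟨⟨hD, rfl⟩, by simpa using hz⟩
  change _ = ∑ ζ ∈ S, F (ζ.re + ζ.re⁻¹)
  rw [hS, Finset.sum_map, ← Finset.tsum_subtype']
  exact (tsum_congr_set_coe (fun z : ℝ => F (z + z⁻¹)) hfin.coe_toFinset).symm

end

theorem integral_cos_int_mul (m : ℤ) :
    ∫ θ in (0)..(2 * π), Real.cos (m * θ) = if m = 0 then 2 * π else 0 := by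
  split_ifs with h
  · simp [h]
  · have h' : (m : ℝ) ≠ 0 := by exact_mod_cast h
    rw [intervalIntegral.integral_comp_mul_left _ h', integral_cos]
    simp [show (m : ℝ) * (2 * π) = (2 * m : ℤ) * π by push_cast; ring, -Int.cast_mul,
      Real.sin_int_mul_pi]

theorem integral_sin_int_mul (m : ℤ) : ∫ θ in (0)..(2 * π), Real.sin (m * θ) = 0 := by
  by_cases h : m = 0
  · simp [h]
  · have h' : (m : ℝ) ≠ 0 := by exact_mod_cast h
    rw [intervalIntegral.integral_comp_mul_left _ h', integral_sin]
    simp [Real.cos_int_mul_two_pi]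

theorem integral_cos_mul_cos (n : ℕ) {k : ℕ} (hk : k ≠ 0) :
    ∫ θ in (0)..(2 * π), Real.cos (n * θ) * Real.cos (k * θ) = if n = k then π else 0 := by
  have h : ∀ θ : ℝ, Real.cos (n * θ) * Real.cos (k * θ) =
      2⁻¹ * Real.cos ((n - k : ℤ) * θ) + 2⁻¹ * Real.cos ((n + k : ℤ) * θ) := fun θ => by
    push_cast
    rw [sub_mul, add_mul, Real.cos_sub, Real.cos_add]
    ring
  simp only [h]
  rw [intervalIntegral.integral_add (Continuous.intervalIntegrable (by fun_prop) _ _)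
    (Continuous.intervalIntegrable (by fun_prop) _ _), intervalIntegral.integral_const_mul,
    intervalIntegral.integral_const_mul, integral_cos_int_mul, integral_cos_int_mul,
    if_neg (by omega : ¬ (n + k : ℤ) = 0)]
  by_cases hnk : n = k
  · simp [hnk]
  · rw [if_neg (by omega : ¬ (n - k : ℤ) = 0), if_neg hnk]
    simp

theorem integral_sin_mul_cos (n k : ℕ) :
    ∫ θ in (0)..(2 * π), Real.sin (n * θ) * Real.cos (k * θ) = 0 := by
  have h : ∀ θ : ℝ, Real.sin (n * θ) * Real.cos (k * θ) =
      2⁻¹ * Real.sin ((n - k : ℤ) * θ) + 2⁻¹ * Real.sin ((n + k : ℤ) * θ) := fun θ => by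
    push_cast
    rw [sub_mul, add_mul, Real.sin_sub, Real.sin_add]
    ring
  simp only [h]
  rw [intervalIntegral.integral_add (Continuous.intervalIntegrable (by fun_prop) _ _)
    (Continuous.intervalIntegrable (by fun_prop) _ _), intervalIntegral.integral_const_mul,
    intervalIntegral.integral_const_mul, integral_sin_int_mul, integral_sin_int_mul]
  simp

theorem hasSum_log_norm_one_sub {u : ℂ} (hu : ‖u‖ < 1) :
    HasSum (fun n : ℕ => -(u ^ n / n).re) (Real.log ‖1 - u‖) := by
  have := (Complex.hasSum_re (Complex.hasSum_taylorSeries_neg_log hu)).neg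
  simpa [Complex.log_re] using this

theorem circleMap_zero_one_pow (θ : ℝ) (n : ℕ) :
    circleMap 0 1 θ ^ n = (Real.cos (n * θ) : ℂ) + (Real.sin (n * θ) : ℂ) * Complex.I := by
  rw [circleMap_zero, Complex.ofReal_one, one_mul, ← Complex.exp_nat_mul, ← mul_assoc,
    Complex.exp_mul_I]
  push_cast
  rfl

theorem norm_mul_circleMap (w : ℂ) (θ : ℝ) : ‖w * circleMap 0 1 θ‖ = ‖w‖ := by
  simp

theorem integral_log_norm_one_sub_of_lt {w : ℂ} (hw : ‖w‖ < 1) {k : ℕ} (hk : k ≠ 0) :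
    ∫ θ in (0)..(2 * π), Real.log ‖1 - w * circleMap 0 1 θ‖ * Real.cos (k * θ) =
      -(π / k) * (w ^ k).re := by
  have key := intervalIntegral.hasSum_integral_of_dominated_convergence (μ := volume)
    (a := 0) (b := 2 * π)
    (F := fun (n : ℕ) θ => -((w * circleMap 0 1 θ) ^ n / n).re * Real.cos (k * θ))
    (f := fun θ => Real.log ‖1 - w * circleMap 0 1 θ‖ * Real.cos (k * θ))
    (fun n _ => ‖w‖ ^ n)
    (fun n => (Continuous.aestronglyMeasurable (by fun_prop)))
    (fun n => ae_of_all _ fun θ _ => by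
      rw [norm_mul, norm_neg, Real.norm_eq_abs, Real.norm_eq_abs]
      calc _ ≤ ‖w‖ ^ n * 1 := by
            refine mul_le_mul ?_ (Real.abs_cos_le_one _) (abs_nonneg _) (by positivity)
            refine (Complex.abs_re_le_norm _).trans ?_
            rw [norm_div, norm_pow, norm_mul_circleMap, Complex.norm_natCast]
            rcases Nat.eq_zero_or_pos n with rfl | hn
            · simp
            · exact div_le_self (by positivity) (by exact_mod_cast hn)
        _ = _ := mul_one _)
    (ae_of_all _ fun θ _ => summable_geometric_of_lt_one (norm_nonneg _) hw)
    intervalIntegrable_const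
    (ae_of_all _ fun θ _ => (hasSum_log_norm_one_sub (by rwa [norm_mul_circleMap])).mul_right _)
  have hterm : ∀ n : ℕ, ∫ θ in (0)..(2 * π),
      -((w * circleMap 0 1 θ) ^ n / n).re * Real.cos (k * θ) =
      if n = k then -(π / k) * (w ^ k).re else 0 := by
    intro n
    have h : ∀ θ : ℝ, -((w * circleMap 0 1 θ) ^ n / n).re * Real.cos (k * θ) =
        -((w ^ n).re / n) * (Real.cos (n * θ) * Real.cos (k * θ)) +
        ((w ^ n).im / n) * (Real.sin (n * θ) * Real.cos (k * θ)) := fun θ => by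
      rw [mul_pow, circleMap_zero_one_pow, Complex.div_natCast_re, Complex.mul_re]
      simp only [Complex.add_re, Complex.add_im, Complex.mul_re, Complex.mul_im,
        Complex.ofReal_re, Complex.ofReal_im, Complex.I_re, Complex.I_im]
      ring
    simp only [h]
    rw [intervalIntegral.integral_add (Continuous.intervalIntegrable (by fun_prop) _ _)
      (Continuous.intervalIntegrable (by fun_prop) _ _), intervalIntegral.integral_const_mul,
      intervalIntegral.integral_const_mul, integral_cos_mul_cos n hk, integral_sin_mul_cos]
    split_ifs with hnk
    · subst hnk; ring
    · simp
  simp only [hterm] at key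
  refine key.unique ?_
  have := hasSum_ite_eq k (-(π / k) * (w ^ k).re)
  exact this

theorem intervalIntegrable_log_norm_one_sub (w : ℂ) :
    IntervalIntegrable (fun θ => Real.log ‖1 - w * circleMap 0 1 θ‖) volume 0 (2 * π) := by
  have h : MeromorphicOn (fun z : ℂ => 1 - w * z) (Metric.sphere 0 |1|) := by
    intro z _
    exact AnalyticAt.meromorphicAt (by fun_prop)
  exact h.circleIntegrable_log_norm

theorem integral_log_norm_one_sub {w : ℂ} (hw : ‖w‖ ≤ 1) {k : ℕ} (hk : k ≠ 0) :
    ∫ θ in (0)..(2 * π), Real.log ‖1 - w * circleMap 0 1 θ‖ * Real.cos (k * θ) =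
      -(π / k) * (w ^ k).re := by
  rcases hw.lt_or_eq with hw1 | hw1
  · exact integral_log_norm_one_sub_of_lt hw1 hk
  let r : ℕ → ℝ := fun n => 1 - 1 / ((n : ℝ) + 1)
  have hr : Tendsto r atTop (𝓝 1) := by
    simpa [r] using tendsto_one_div_add_atTop_nhds_zero_nat.const_sub (1 : ℝ)
  have hr0 : ∀ n, 0 ≤ r n := fun n => by
    have : 1 / ((n : ℝ) + 1) ≤ 1 := by
      rw [div_le_one (by positivity)]; linarith [n.cast_nonneg (α := ℝ)]
    simp only [r]; linarith
  have hr1 : ∀ n, r n < 1 := fun n => by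
    have : 0 < 1 / ((n : ℝ) + 1) := by positivity
    simp only [r]; linarith
  have hne : ∀ᵐ θ ∂(volume : Measure ℝ), w * circleMap 0 1 θ ≠ 1 := by
    have hc : (circleMap 0 1 ⁻¹' {w⁻¹}).Countable :=
      (Set.countable_singleton w⁻¹).preimage_circleMap 0 one_ne_zero
    filter_upwards [hc.ae_notMem volume] with θ hθ h
    exact hθ (eq_inv_of_mul_eq_one_right h)
  have key := intervalIntegral.tendsto_integral_filter_of_dominated_convergence
    (μ := volume) (a := 0) (b := 2 * π) (l := atTop)
    (F := fun (n : ℕ) θ => Real.log ‖1 - (r n * w : ℂ) * circleMap 0 1 θ‖ * Real.cos (k * θ))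
    (f := fun θ => Real.log ‖1 - w * circleMap 0 1 θ‖ * Real.cos (k * θ))
    (fun θ => |Real.log ‖1 - w * circleMap 0 1 θ‖| + Real.log 2)
    (Eventually.of_forall fun n => Measurable.aestronglyMeasurable (by fun_prop))
    (Eventually.of_forall fun n => by
      filter_upwards [hne] with θ hθ _
      rw [norm_mul, Real.norm_eq_abs, Real.norm_eq_abs]
      refine (mul_le_of_le_one_right (abs_nonneg _) (Real.abs_cos_le_one _)).trans ?_
      have hu : ‖w * circleMap 0 1 θ‖ = 1 := by rw [norm_mul_circleMap, hw1]
      rw [mul_assoc]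
      generalize w * circleMap 0 1 θ = u at hθ hu
      have h1 : ‖(r n : ℂ) * u‖ = r n := by
        rw [norm_mul, hu, mul_one, Complex.norm_real, Real.norm_of_nonneg (hr0 n)]
      have hpos : 0 < ‖1 - u‖ := norm_pos_iff.2 (sub_ne_zero.2 hθ.symm)
      have hle2 : ‖1 - (r n : ℂ) * u‖ ≤ 2 := by
        refine (norm_sub_le _ _).trans ?_
        rw [h1, norm_one]; linarith [hr1 n]
      have hge : ‖1 - u‖ / 2 ≤ ‖1 - (r n : ℂ) * u‖ := by
        have ha : ‖1 - u‖ ≤ ‖1 - (r n : ℂ) * u‖ + ‖((r n : ℂ) - 1) * u‖ := by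
          refine le_trans (le_of_eq ?_) (norm_add_le _ _)
          congr 1; ring
        have hb : ‖((r n : ℂ) - 1) * u‖ = 1 - r n := by
          rw [norm_mul, hu, mul_one, ← Complex.ofReal_one, ← Complex.ofReal_sub, Complex.norm_real,
            Real.norm_eq_abs, abs_sub_comm, abs_of_nonneg (by linarith [hr1 n])]
        have hc : ‖(1 : ℂ)‖ - ‖(r n : ℂ) * u‖ ≤ ‖1 - (r n : ℂ) * u‖ := norm_sub_norm_le _ _
        rw [h1, norm_one] at hc
        linarith
      have hl2 : 0 < Real.log 2 := Real.log_pos one_lt_two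
      have hup := Real.log_le_log (lt_of_lt_of_le (by positivity) hge) hle2
      have hlo := Real.log_le_log (by positivity) hge
      rw [Real.log_div hpos.ne' two_ne_zero] at hlo
      rw [abs_le]
      constructor
      · linarith [neg_abs_le (Real.log ‖1 - u‖)]
      · linarith [abs_nonneg (Real.log ‖1 - u‖)])
    ((intervalIntegrable_log_norm_one_sub w).abs.add intervalIntegrable_const)
    (by
      filter_upwards [hne] with θ hθ _
      refine Tendsto.mul_const _ ((Real.continuousAt_log ?_).tendsto.comp ?_)
      · exact (norm_pos_iff.2 (sub_ne_zero.2 hθ.symm)).ne'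
      · have : Continuous fun s : ℝ => ‖1 - (s * w : ℂ) * circleMap 0 1 θ‖ := by fun_prop
        simpa [Function.comp_def] using (this.tendsto 1).comp hr)
  refine tendsto_nhds_unique key ?_
  have hlt : ∀ n, ‖(r n : ℂ) * w‖ < 1 := fun n => by
    rw [norm_mul, hw1, mul_one, Complex.norm_real, Real.norm_of_nonneg (hr0 n)]
    exact hr1 n
  simp only [fun n => integral_log_norm_one_sub_of_lt (hlt n) hk]
  have : Continuous fun s : ℝ => -(π / k) * (((s : ℂ) * w) ^ k).re := by fun_prop
  simpa [Function.comp_def] using (this.tendsto 1).comp hr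

theorem intervalIntegrable_log_norm_sub (ζ : ℂ) :
    IntervalIntegrable (fun θ => Real.log ‖circleMap 0 1 θ - ζ‖) volume 0 (2 * π) :=
  circleIntegrable_log_norm_sub_const (c := 0) 1

theorem integral_log_norm_sub (ζ : ℂ) :
    ∫ θ in (0)..(2 * π), Real.log ‖circleMap 0 1 θ - ζ‖ = 2 * π * log⁺ ‖ζ‖ := by
  rw [← circleAverage_log_norm_sub_const_eq_posLog, Real.circleAverage_def, smul_eq_mul,
    mul_inv_cancel_left₀ Real.two_pi_pos.ne']

/-- Reflection of a nonzero complex number into the closed unit disc. -/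
def reflect (ζ : ℂ) : ℂ := if ‖ζ‖ < 1 then ζ else ζ⁻¹

theorem integral_log_norm_sub_mul_cos {ζ : ℂ} (hζ : ζ ≠ 0) {k : ℕ} (hk : k ≠ 0) :
    ∫ θ in (0)..(2 * π), Real.log ‖circleMap 0 1 θ - ζ‖ * Real.cos (k * θ) =
      -(π / k) * (reflect ζ ^ k).re := by
  rw [reflect]
  split_ifs with h
  · have h1 : ∀ θ, ‖circleMap 0 1 θ - ζ‖ = ‖1 - (starRingEnd ℂ) ζ * circleMap 0 1 θ‖ := by
      intro θ
      have hu : (starRingEnd ℂ) (circleMap 0 1 θ) * circleMap 0 1 θ = 1 := by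
        rw [Complex.conj_mul', norm_circleMap_zero]; simp
      have : 1 - (starRingEnd ℂ) ζ * circleMap 0 1 θ =
          (starRingEnd ℂ) (circleMap 0 1 θ - ζ) * circleMap 0 1 θ := by
        rw [map_sub, sub_mul, hu]
      rw [this, norm_mul, RCLike.norm_conj]
      simp
    simp only [h1]
    rw [integral_log_norm_one_sub (by rw [RCLike.norm_conj]; exact h.le) hk, ← map_pow,
      Complex.conj_re]
  · rw [not_lt] at h
    have hw : ‖ζ⁻¹‖ ≤ 1 := by rw [norm_inv]; exact inv_le_one_of_one_le₀ h
    have hz : ∀ u : ℂ, 1 - ζ⁻¹ * u = -ζ⁻¹ * (u - ζ) := fun u => by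
      field_simp; ring
    have hne : ∀ᵐ θ ∂(volume : Measure ℝ), circleMap 0 1 θ ≠ ζ := by
      have hc : (circleMap 0 1 ⁻¹' {ζ}).Countable :=
        (Set.countable_singleton ζ).preimage_circleMap 0 one_ne_zero
      exact hc.ae_notMem volume
    have hcongr : ∫ θ in (0)..(2 * π), Real.log ‖circleMap 0 1 θ - ζ‖ * Real.cos (k * θ) =
        ∫ θ in (0)..(2 * π), (Real.log ‖1 - ζ⁻¹ * circleMap 0 1 θ‖ * Real.cos (k * θ) +
          Real.log ‖ζ‖ * Real.cos (k * θ)) := by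
      refine intervalIntegral.integral_congr_ae ?_
      filter_upwards [hne] with θ hθ _
      rw [hz, norm_mul, norm_neg, norm_inv, Real.log_mul (by simpa using hζ)
        (norm_ne_zero_iff.2 (sub_ne_zero.2 hθ)), Real.log_inv]
      ring
    have h0 := integral_cos_int_mul k
    rw [if_neg (by exact_mod_cast hk), Int.cast_natCast] at h0
    rw [hcongr, intervalIntegral.integral_add
      ((intervalIntegrable_log_norm_one_sub _).mul_continuousOn (by fun_prop))
      (Continuous.intervalIntegrable (by fun_prop) _ _), integral_log_norm_one_sub hw hk,
      intervalIntegral.integral_const_mul, h0, mul_zero, add_zero]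

theorem intervalIntegrable_multiset_sum_mul_cos (s : Multiset ℂ) (k : ℕ) :
    IntervalIntegrable (fun θ => (s.map fun ζ => Real.log ‖circleMap 0 1 θ - ζ‖).sum *
      Real.cos (k * θ)) volume 0 (2 * π) := by
  refine IntervalIntegrable.mul_continuousOn ?_ (by fun_prop)
  induction s using Multiset.induction with
  | empty => simp
  | cons ζ s ih => simpa using (intervalIntegrable_log_norm_sub ζ).add ih

theorem integral_multiset_sum_mul_cos (s : Multiset ℂ) (k : ℕ) :
    ∫ θ in (0)..(2 * π), (s.map fun ζ => Real.log ‖circleMap 0 1 θ - ζ‖).sum * Real.cos (k * θ) =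
      (s.map fun ζ => ∫ θ in (0)..(2 * π),
        Real.log ‖circleMap 0 1 θ - ζ‖ * Real.cos (k * θ)).sum := by
  induction s using Multiset.induction with
  | empty => simp
  | cons ζ s ih =>
    simp only [Multiset.map_cons, Multiset.sum_cons, add_mul]
    rw [intervalIntegral.integral_add
      ((intervalIntegrable_log_norm_sub ζ).mul_continuousOn (by fun_prop))
      (intervalIntegrable_multiset_sum_mul_cos s k), ih]

theorem log_norm_aeval {f : ℝ[X]} (hf : f ≠ 0) {z : ℂ} (hz : z ∉ f.aroots ℂ) :
    Real.log ‖aeval z f‖ =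
      Real.log |f.leadingCoeff| + ((f.aroots ℂ).map fun ζ => Real.log ‖z - ζ‖).sum := by
  have hs := IsAlgClosed.splits (f.map (algebraMap ℝ ℂ))
  have h0 : ∀ ζ ∈ f.aroots ℂ, ‖z - ζ‖ ≠ 0 := fun ζ hζ =>
    norm_ne_zero_iff.2 (sub_ne_zero.2 (ne_of_mem_of_not_mem hζ hz).symm)
  have hm : ∀ s : Multiset ℂ, ‖(s.map fun ζ => z - ζ).prod‖ = (s.map fun ζ => ‖z - ζ‖).prod := by
    intro s
    induction s using Multiset.induction with
    | empty => simp
    | cons ζ s ih => simp [ih]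
  have h0' : ((f.aroots ℂ).map fun ζ => ‖z - ζ‖).prod ≠ 0 := by
    rw [Ne, Multiset.prod_eq_zero_iff, Multiset.mem_map]
    rintro ⟨ζ, hζ, h⟩
    exact h0 ζ hζ h
  rw [hs.aeval_eq_prod_aroots, norm_mul, hm, Real.log_mul (by simpa using hf) h0',
    Real.log_multiset_prod (fun x hx => by
      obtain ⟨ζ, hζ, rfl⟩ := Multiset.mem_map.1 hx
      exact h0 ζ hζ), Multiset.map_map]
  simp

theorem ae_circleMap_notMem_aroots (f : ℝ[X]) :
    ∀ᵐ θ ∂(volume : Measure ℝ), circleMap 0 1 θ ∉ f.aroots ℂ := by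
  have hc : (circleMap 0 1 ⁻¹' ((f.aroots ℂ).toFinset : Set ℂ)).Countable :=
    (Finset.countable_toSet _).preimage_circleMap 0 one_ne_zero
  simpa using hc.ae_notMem volume

theorem ae_log_norm_aeval_mul_cos {f : ℝ[X]} (hf : f ≠ 0) (k : ℕ) :
    ∀ᵐ θ ∂(volume : Measure ℝ), Real.log ‖aeval (circleMap 0 1 θ) f‖ * Real.cos (k * θ) =
      Real.log |f.leadingCoeff| * Real.cos (k * θ) +
      ((f.aroots ℂ).map fun ζ => Real.log ‖circleMap 0 1 θ - ζ‖).sum * Real.cos (k * θ) := by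
  filter_upwards [ae_circleMap_notMem_aroots f] with θ hθ
  rw [log_norm_aeval hf hθ, add_mul]

theorem intervalIntegrable_log_norm_aeval_mul_cos {f : ℝ[X]} (hf : f ≠ 0) (k : ℕ) :
    IntervalIntegrable (fun θ => Real.log ‖aeval (circleMap 0 1 θ) f‖ * Real.cos (k * θ))
      volume 0 (2 * π) := by
  have h1 : IntervalIntegrable (fun θ => Real.log |f.leadingCoeff| * Real.cos (k * θ))
      volume 0 (2 * π) := Continuous.intervalIntegrable (by fun_prop) _ _
  refine (h1.add (intervalIntegrable_multiset_sum_mul_cos (f.aroots ℂ) k)).congr_ae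
    (ae_restrict_of_ae ?_)
  filter_upwards [ae_log_norm_aeval_mul_cos hf k] with θ hθ
  exact hθ.symm

theorem integral_log_norm_aeval_mul_cos {f : ℝ[X]} (hf : f.eval 0 ≠ 0) {k : ℕ} (hk : k ≠ 0) :
    ∫ θ in (0)..(2 * π), Real.log ‖aeval (circleMap 0 1 θ) f‖ * Real.cos (k * θ) =
      -(π / k) * ((f.aroots ℂ).map fun ζ => (reflect ζ ^ k).re).sum := by
  have hf0 : f ≠ 0 := by rintro rfl; simp at hf
  have h0 := integral_cos_int_mul k
  rw [if_neg (by exact_mod_cast hk), Int.cast_natCast] at h0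
  rw [intervalIntegral.integral_congr_ae ((ae_log_norm_aeval_mul_cos hf0 k).mono fun _ h _ => h),
    intervalIntegral.integral_add (Continuous.intervalIntegrable (by fun_prop) _ _)
      (intervalIntegrable_multiset_sum_mul_cos _ k), intervalIntegral.integral_const_mul, h0,
    mul_zero, zero_add, integral_multiset_sum_mul_cos, ← Multiset.sum_map_mul_left]
  refine congrArg Multiset.sum (Multiset.map_congr rfl fun ζ hζ => ?_)
  refine integral_log_norm_sub_mul_cos ?_ hk
  rintro rfl
  have := (mem_aroots.1 hζ).2
  rw [← map_zero (algebraMap ℝ ℂ), aeval_algebraMap_apply, coe_aeval_eq_eval] at this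
  exact hf (by simpa using this)

theorem integral_log_norm_aeval {f : ℝ[X]} (hf : f.eval 0 ≠ 0) :
    ∫ θ in (0)..(2 * π), Real.log ‖aeval (circleMap 0 1 θ) f‖ =
      2 * π * (Real.log |f.eval 0| + ((f.aroots ℂ).map fun ζ => log⁺ ‖ζ‖⁻¹).sum) := by
  have hf0 : f ≠ 0 := by rintro rfl; simp at hf
  have hz : aeval (0 : ℂ) f = ((f.eval 0 : ℝ) : ℂ) := by
    rw [← map_zero (algebraMap ℝ ℂ), aeval_algebraMap_apply, coe_aeval_eq_eval]
    rfl
  have h0 : (0 : ℂ) ∉ f.aroots ℂ := fun h => hf (by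
    have := (mem_aroots.1 h).2
    rwa [hz, Complex.ofReal_eq_zero] at this)
  have hl := log_norm_aeval hf0 h0
  rw [hz, Complex.norm_real, Real.norm_eq_abs] at hl
  have hi := intervalIntegrable_multiset_sum_mul_cos (f.aroots ℂ) 0
  have hs := integral_multiset_sum_mul_cos (f.aroots ℂ) 0
  have ha := ae_log_norm_aeval_mul_cos hf0 0
  simp only [Nat.cast_zero, zero_mul, Real.cos_zero, mul_one] at hi hs ha
  rw [intervalIntegral.integral_congr_ae (ha.mono fun _ h _ => h),
    intervalIntegral.integral_add intervalIntegrable_const hi, hs,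
    intervalIntegral.integral_const, hl, add_assoc, ← Multiset.sum_map_add, mul_add,
    smul_eq_mul, sub_zero]
  simp only [integral_log_norm_sub, zero_sub, norm_neg]
  rw [Multiset.sum_map_mul_left]
  congr 3
  refine Multiset.map_congr rfl fun ζ _ => ?_
  rw [← Real.posLog_sub_posLog_inv (x := ‖ζ‖), sub_add_cancel]

theorem integral_zero_two_pi_of_symm {g : ℝ → ℝ} (hg : ∀ θ, g (2 * π - θ) = g θ)
    (hi : IntervalIntegrable g volume 0 (2 * π)) :
    ∫ θ in (0)..(2 * π), g θ = 2 * ∫ θ in (0)..π, g θ := by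
  have hpi := Real.pi_pos
  have h1 : IntervalIntegrable g volume 0 π :=
    hi.mono_set (Set.uIcc_subset_uIcc_left (by
      rw [Set.uIcc_of_le (by positivity)]; constructor <;> linarith))
  have h2 : IntervalIntegrable g volume π (2 * π) :=
    hi.mono_set (Set.uIcc_subset_uIcc_right (by
      rw [Set.uIcc_of_le (by positivity)]; constructor <;> linarith))
  have h3 := intervalIntegral.integral_comp_sub_left (a := 0) (b := π) g (2 * π)
  rw [← intervalIntegral.integral_add_adjacent_intervals h1 h2, two_mul (∫ θ in (0)..π, g θ)]
  simp only [hg] at h3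
  rw [h3]
  congr 2 <;> ring

section

variable {p q : ℕ → ℝ} {N : ℕ}

theorem circleMap_add_inv (θ : ℝ) :
    circleMap 0 1 θ + (circleMap 0 1 θ)⁻¹ = ((2 * Real.cos θ : ℝ) : ℂ) := by
  rw [circleMap_zero, Complex.ofReal_one, one_mul, ← Complex.exp_neg, ← neg_mul]
  push_cast
  rw [Complex.two_cos]

theorem jostSq_two_mul_cos (n : ℕ) (θ : ℝ) :
    (jostSq p q n).eval (2 * Real.cos θ) = ‖aeval (circleMap 0 1 θ) (jostPoly p q n)‖ ^ 2 := by
  have hz : circleMap 0 1 θ ≠ 0 := circleMap_ne_center one_ne_zero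
  have hinv : (circleMap 0 1 θ)⁻¹ = (starRingEnd ℂ) (circleMap 0 1 θ) := by
    rw [Complex.inv_def, Complex.normSq_eq_norm_sq, norm_circleMap_zero]
    simp
  have h := aeval_jostSq (p := p) (q := q) hz n
  have hc : aeval ((starRingEnd ℂ) (circleMap 0 1 θ)) (jostPoly p q n) =
      (starRingEnd ℂ) (aeval (circleMap 0 1 θ) (jostPoly p q n)) :=
    (aeval_algHom_apply Complex.conjAe.toAlgHom _ _)
  have h2 := aeval_algebraMap_apply ℂ (2 * Real.cos θ) (jostSq p q n)
  rw [Complex.coe_algebraMap, ← circleMap_add_inv, h, hinv, hc, Complex.mul_conj',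
    coe_aeval_eq_eval] at h2
  exact_mod_cast h2.symm

theorem log_jostSq_two_mul_cos (n : ℕ) (θ : ℝ) :
    Real.log ((jostSq p q n).eval (2 * Real.cos θ)) =
      2 * Real.log ‖aeval (circleMap 0 1 θ) (jostPoly p q n)‖ := by
  rw [jostSq_two_mul_cos, Real.log_pow, Nat.cast_ofNat]

theorem intervalIntegrable_log_jostSq_mul_cos (hp : ∀ k, 1 ≤ k → 0 < p k) (k : ℕ) :
    IntervalIntegrable (fun θ => Real.log ((jostSq p q N).eval (2 * Real.cos θ)) *
      Real.cos (k * θ)) volume 0 (2 * π) := by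
  simp only [log_jostSq_two_mul_cos, mul_assoc]
  exact (intervalIntegrable_log_norm_aeval_mul_cos (jostPoly_ne_zero hp N) k).const_mul 2

theorem intervalIntegrable_log_jostSq_mul_cos_pi (hp : ∀ k, 1 ≤ k → 0 < p k) (k : ℕ) :
    IntervalIntegrable (fun θ => Real.log ((jostSq p q N).eval (2 * Real.cos θ)) *
      Real.cos (k * θ)) volume 0 π :=
  (intervalIntegrable_log_jostSq_mul_cos hp k).mono_set (Set.uIcc_subset_uIcc_left (by
    have hpi := Real.pi_pos
    rw [Set.uIcc_of_le (by positivity)]; constructor <;> linarith))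

theorem integral_log_jostSq_mul_cos_eq (hp : ∀ k, 1 ≤ k → 0 < p k) (k : ℕ) :
    ∫ θ in (0)..π, Real.log ((jostSq p q N).eval (2 * Real.cos θ)) * Real.cos (k * θ) =
      ∫ θ in (0)..(2 * π), Real.log ‖aeval (circleMap 0 1 θ) (jostPoly p q N)‖ *
        Real.cos (k * θ) := by
  have h := integral_zero_two_pi_of_symm (fun θ => ?_)
    (intervalIntegrable_log_jostSq_mul_cos (q := q) (N := N) hp k)
  · simp only [log_jostSq_two_mul_cos, mul_assoc, intervalIntegral.integral_const_mul] at h ⊢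
    linarith
  · rw [Real.cos_two_pi_sub, mul_sub, Real.cos_nat_mul_two_pi_sub]

theorem integral_log_jostSq_mul_cos (hp : ∀ k, 1 ≤ k → 0 < p k) {k : ℕ} (hk : k ≠ 0) :
    ∫ θ in (0)..π, Real.log ((jostSq p q N).eval (2 * Real.cos θ)) * Real.cos (k * θ) =
      -(π / k) * (((jostPoly p q N).aroots ℂ).map fun ζ => (reflect ζ ^ k).re).sum := by
  rw [integral_log_jostSq_mul_cos_eq hp,
    integral_log_norm_aeval_mul_cos (eval_zero_jostPoly_pos hp N).ne' hk]

theorem integral_log_jostSq (hp : ∀ k, 1 ≤ k → 0 < p k) :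
    ∫ θ in (0)..π, Real.log ((jostSq p q N).eval (2 * Real.cos θ)) =
      2 * π * (Real.log ((jostPoly p q N).eval 0) +
        (((jostPoly p q N).aroots ℂ).map fun ζ => log⁺ ‖ζ‖⁻¹).sum) := by
  have h := integral_log_jostSq_mul_cos_eq (q := q) (N := N) hp 0
  simp only [Nat.cast_zero, zero_mul, Real.cos_zero, mul_one] at h
  rw [h, integral_log_norm_aeval (eval_zero_jostPoly_pos hp N).ne',
    abs_of_pos (eval_zero_jostPoly_pos hp N)]

theorem integrableOn_log_jostSq_mul (hp : ∀ k, 1 ≤ k → 0 < p k) (f : ℝ[X]) :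
    IntegrableOn (fun x => Real.log ((jostSq p q N).eval x) * f.eval x * √(4 - x ^ 2))
      (Set.Icc (-2) 2) := by
  rw [integrableOn_Icc_iff_cos]
  have h := intervalIntegrable_log_jostSq_mul_cos_pi (q := q) (N := N) hp 0
  simp only [Nat.cast_zero, zero_mul, Real.cos_zero, mul_one] at h
  rw [integrableOn_Icc_iff_integrableOn_Ioc,
    ← intervalIntegrable_iff_integrableOn_Ioc_of_le Real.pi_pos.le]
  have h2 : ContinuousOn (fun θ => 2 * Real.sin θ * (f.eval (2 * Real.cos θ) *
      √(4 - (2 * Real.cos θ) ^ 2))) (Set.uIcc 0 π) := by fun_prop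
  refine (h.mul_continuousOn h2).congr fun θ _ => ?_
  ring

theorem integral_log_jostSq_mul_freePoly (hp : ∀ k, 1 ≤ k → 0 < p k) (k : ℕ) :
    1 / (2 * π) * ∫ x in Set.Icc (-2 : ℝ) 2,
      Real.log ((jostSq p q N).eval x) * (freePoly k).eval x * √(4 - x ^ 2) =
    (if k = 0 then 2 * (Real.log ((jostPoly p q N).eval 0) +
        (((jostPoly p q N).aroots ℂ).map fun ζ => log⁺ ‖ζ‖⁻¹).sum)
      else -(1 / k) * (((jostPoly p q N).aroots ℂ).map fun ζ => (reflect ζ ^ k).re).sum) +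
    1 / (k + 2) * (((jostPoly p q N).aroots ℂ).map fun ζ => (reflect ζ ^ (k + 2)).re).sum := by
  have hpi := Real.pi_pos.ne'
  have h2 := intervalIntegrable_log_jostSq_mul_cos_pi (q := q) (N := N) hp (k + 2)
  have h3 := integral_log_jostSq_mul_cos (q := q) (N := N) hp (k := k + 2) (by omega)
  push_cast at h2 h3
  rw [integral_mul_freePoly]
  simp only [mul_sub]
  rw [intervalIntegral.integral_sub (intervalIntegrable_log_jostSq_mul_cos_pi hp k) h2, h3]
  split_ifs with hk
  · subst hk
    simp only [Nat.cast_zero, zero_mul, Real.cos_zero, mul_one]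
    rw [integral_log_jostSq hp]
    field_simp
    ring
  · rw [integral_log_jostSq_mul_cos hp hk]
    have : (k : ℝ) ≠ 0 := by exact_mod_cast hk
    field_simp
    ring

end

section

variable {p q : ℕ → ℝ} {N : ℕ} {K : Type*} [Field K] [Algebra ℝ K] {z : K}

theorem aeval_derivative_revPoly (hz : z ≠ 0) (k : ℕ) :
    z * aeval z (derivative (revPoly p q k)) = k * aeval z (revPoly p q k) +
      z ^ k * (z - z⁻¹) * aeval (z + z⁻¹) (derivative (orthoPoly p q k)) := by
  rw [aeval_revPoly hz]
  induction k using Nat.twoStepInduction with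
  | zero => simp [revPoly, orthoPoly]
  | one =>
    simp only [revPoly, orthoPoly, derivative_mul, derivative_C,
      derivative_X, derivative_X_sq, derivative_one, map_mul, map_sub, map_add, aeval_C, aeval_X,
      map_one, map_zero, map_ofNat]
    field_simp
    push_cast
    ring
  | more k h1 h2 =>
    simp only [revPoly, orthoPoly, derivative_mul, derivative_C,
      derivative_X, derivative_X_sq, derivative_one, map_mul, map_sub, map_add, aeval_C, aeval_X,
      map_one, map_zero, map_pow, map_ofNat, aeval_revPoly hz]
    have hinv : z * z⁻¹ = 1 := mul_inv_cancel₀ hz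
    generalize aeval (z + z⁻¹) (orthoPoly p q (k + 1)) = a at *
    generalize aeval (z + z⁻¹) (orthoPoly p q k) = b at *
    generalize aeval (z + z⁻¹) (derivative (orthoPoly p q (k + 1))) = a' at *
    generalize aeval (z + z⁻¹) (derivative (orthoPoly p q k)) = b' at *
    generalize aeval z (derivative (revPoly p q (k + 1))) = r at *
    generalize aeval z (derivative (revPoly p q k)) = s at *
    generalize (algebraMap ℝ K) (p (k + 2))⁻¹ = α
    generalize (algebraMap ℝ K) (p (k + 1)) = β
    generalize (algebraMap ℝ K) (q (k + 1)) = γ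
    push_cast at h2 ⊢
    linear_combination α * (1 + z ^ 2 - γ * z) * h2 - α * β * z ^ 2 * h1 -
      ((k + 1) * α * z ^ (k + 1) * a + α * z ^ (k + 1) * (z - z⁻¹) * a') * hinv

variable {g : ℕ → ℕ → K}

/-- On and above the diagonal the resolvent kernel factorizes. -/
theorem kernel_eq_mul (hp : ∀ k, 1 ≤ k → 0 < p k) (hz : z ≠ 0)
    (h0 : ∀ j, (1 + z ^ 2) * g 0 j = z * (algebraMap ℝ K (q 0) * g 0 j +
      algebraMap ℝ K (p 1) * g 1 j) + if 0 = j then 1 else 0)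
    (hs : ∀ i j, (1 + z ^ 2) * g (i + 1) j = z * (algebraMap ℝ K (p (i + 1)) * g i j +
      algebraMap ℝ K (q (i + 1)) * g (i + 1) j + algebraMap ℝ K (p (i + 2)) * g (i + 2) j) +
      if i + 1 = j then 1 else 0) {i j : ℕ} (hij : i ≤ j) :
    g i j = aeval (z + z⁻¹) (orthoPoly p q i) * g 0 j := by
  have hpK : ∀ k, 1 ≤ k → algebraMap ℝ K (p k) ≠ 0 := fun k hk => by
    simpa using (hp k hk).ne'
  induction i using Nat.twoStepInduction with
  | zero => simp [orthoPoly]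
  | one =>
    have h := congrArg (aeval (z + z⁻¹)) (orthoPoly_one (q := q) hp)
    have h0 := h0 j
    rw [if_neg (by omega)] at h0
    simp only [map_mul, map_sub, aeval_C, aeval_X] at h
    refine mul_left_cancel₀ (mul_ne_zero hz (hpK 1 le_rfl)) ?_
    linear_combination (-1) * h0 - z * g 0 j * h - g 0 j * mul_inv_cancel₀ hz
  | more i h1 h2 =>
    have h := congrArg (aeval (z + z⁻¹)) (orthoPoly_add_two (q := q) hp i)
    have hs := hs i j
    rw [if_neg (by omega), h1 (by omega), h2 (by omega)] at hs
    simp only [map_mul, map_sub, aeval_C, aeval_X] at h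
    refine mul_left_cancel₀ (mul_ne_zero hz (hpK (i + 2) (by omega))) ?_
    linear_combination (-1) * hs - z * g 0 j * h - g 0 j *
      aeval (z + z⁻¹) (orthoPoly p q (i + 1)) * mul_inv_cancel₀ hz

/-- A finite trace of the resolvent in terms of the logarithmic derivative of the Jost function. -/
theorem jostPoly_derivative_eq (hp : ∀ k, 1 ≤ k → 0 < p k)
    (hN : ∀ k, N ≤ k → p k = 1 ∧ q k = 0) (hz : z ≠ 0) (hsymm : ∀ i j, g i j = g j i)
    (h0 : ∀ j, (1 + z ^ 2) * g 0 j = z * (algebraMap ℝ K (q 0) * g 0 j +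
      algebraMap ℝ K (p 1) * g 1 j) + if 0 = j then 1 else 0)
    (hs : ∀ i j, (1 + z ^ 2) * g (i + 1) j = z * (algebraMap ℝ K (p (i + 1)) * g i j +
      algebraMap ℝ K (q (i + 1)) * g (i + 1) j + algebraMap ℝ K (p (i + 2)) * g (i + 2) j) +
      if i + 1 = j then 1 else 0)
    {m : ℕ} (hm : N ≤ m) (hfree : g 0 (m + 1) = z * g 0 m) :
    z * aeval z (derivative (jostPoly p q N)) = (m + 1) * aeval z (jostPoly p q N) +
      (z ^ 2 - 1) * aeval z (jostPoly p q N) * ∑ j ∈ Finset.range (m + 1), g j j -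
      z ^ 2 * aeval z (revPoly p q m) := by
  have hinv := mul_inv_cancel₀ hz
  set x := z + z⁻¹ with hx
  set P : ℕ → K := fun k => aeval x (orthoPoly p q k) with hP
  set P' : ℕ → K := fun k => aeval x (derivative (orthoPoly p q k)) with hP'
  have hrec : ∀ k, algebraMap ℝ K (p (k + 2)) * P (k + 2) =
      (x - algebraMap ℝ K (q (k + 1))) * P (k + 1) - algebraMap ℝ K (p (k + 1)) * P k := fun k => by
    simpa using congrArg (aeval x) (orthoPoly_add_two (q := q) hp k)
  have hrec' : ∀ k, algebraMap ℝ K (p (k + 2)) * P' (k + 2) = P (k + 1) +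
      (x - algebraMap ℝ K (q (k + 1))) * P' (k + 1) - algebraMap ℝ K (p (k + 1)) * P' k := fun k => by
    simpa [derivative_mul] using
      congrArg (fun f => aeval x (derivative f)) (orthoPoly_add_two (q := q) hp k)
  have hrec1 : algebraMap ℝ K (p 1) * P 1 = x - algebraMap ℝ K (q 0) := by
    simpa using congrArg (aeval x) (orthoPoly_one (q := q) hp)
  have hrec1' : algebraMap ℝ K (p 1) * P' 1 = 1 := by
    simpa [derivative_mul] using
      congrArg (fun f => aeval x (derivative f)) (orthoPoly_one (q := q) hp)
  have hP0 : P 0 = 1 := by simp [hP, orthoPoly]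
  have hP0' : P' 0 = 0 := by simp [hP', orthoPoly]
  have hψ : ∀ j, (1 + z ^ 2) * g 0 (j + 1) = z * (algebraMap ℝ K (p (j + 1)) * g 0 j +
      algebraMap ℝ K (q (j + 1)) * g 0 (j + 1) + algebraMap ℝ K (p (j + 2)) * g 0 (j + 2)) :=
    fun j => by simpa [hsymm _ 0] using hs j 0
  have hψ0 := h0 0
  rw [if_pos rfl, hsymm 1 0] at hψ0
  have hwr : ∀ k, z * (algebraMap ℝ K (p (k + 1)) * (P (k + 1) * g 0 k - P k * g 0 (k + 1))) = 1 := by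
    intro k
    induction k with
    | zero =>
      rw [hP0]
      linear_combination z * g 0 0 * hrec1 + hψ0 + z * g 0 0 * hx + g 0 0 * hinv
    | succ k ih =>
      rw [← ih]
      linear_combination z * g 0 (k + 1) * hrec k + P (k + 1) * hψ k +
        z * P (k + 1) * g 0 (k + 1) * hx + P (k + 1) * g 0 (k + 1) * hinv
  have hT : ∀ k, ∑ j ∈ Finset.range (k + 1), g j j =
      algebraMap ℝ K (p (k + 1)) * (P' (k + 1) * g 0 k - P' k * g 0 (k + 1)) := by
    intro k
    induction k with
    | zero =>
      rw [hP0', Finset.sum_range_one]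
      linear_combination (-g 0 0) * hrec1'
    | succ k ih =>
      rw [Finset.sum_range_succ, ih, kernel_eq_mul hp hz h0 hs le_rfl]
      change _ + P (k + 1) * _ = _
      refine mul_left_cancel₀ hz ?_
      linear_combination (-z) * g 0 (k + 1) * hrec' k - P' (k + 1) * hψ k -
        z * P' (k + 1) * g 0 (k + 1) * hx - P' (k + 1) * g 0 (k + 1) * hinv
  have hwr := hwr m
  have hT := hT m
  rw [(hN (m + 1) (by omega)).1, map_one, one_mul, hfree] at hwr hT
  have hD : aeval z (jostPoly p q N) = z ^ (m + 1) * (P (m + 1) - z * P m) := by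
    rw [← jostPoly_eq hp hN hm, aeval_jostPoly hz]
  have hψD : g 0 m * aeval z (jostPoly p q N) = z ^ m := by
    rw [hD]
    linear_combination z ^ m * hwr
  have hA := aeval_derivative_revPoly (p := p) (q := q) hz m
  have hA1 := aeval_derivative_revPoly (p := p) (q := q) hz (m + 1)
  have hD2 : aeval z (jostPoly p q N) = aeval z (revPoly p q (m + 1)) - z ^ 2 * aeval z (revPoly p q m) := by
    rw [← jostPoly_eq hp hN hm, jostPoly]; simp
  have hdD : z * aeval z (derivative (jostPoly p q N)) =
      z * aeval z (derivative (revPoly p q (m + 1))) -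
      2 * z ^ 2 * aeval z (revPoly p q m) - z ^ 2 * (z * aeval z (derivative (revPoly p q m))) := by
    rw [← jostPoly_eq hp hN hm, jostPoly]
    simp
    ring
  have hTD : aeval z (jostPoly p q N) * ∑ j ∈ Finset.range (m + 1), g j j =
      z ^ m * (P' (m + 1) - z * P' m) := by
    rw [hT]
    linear_combination (P' (m + 1) - z * P' m) * hψD
  rw [hdD, hA, hA1, mul_assoc (z ^ 2 - 1), hTD]
  push_cast
  change _ + _ * P' (m + 1) - _ - z ^ 2 * (_ + _ * P' m) = _
  linear_combination (-(m : K) - 1) * hD2 - (z ^ m * (P' (m + 1) - z * P' m)) * hinv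

end

section

variable {p q : ℕ → ℝ} {N : ℕ} {J J₀ : H →L[ℝ] H}

/-- The matrix elements of the resolvent, as power series in the uniformizing variable. -/
def green (J : H →L[ℝ] H) (u v : H) : PowerSeries ℝ :=
  PowerSeries.mk fun k => ⟪aeval J (freePoly k) u, v⟫

theorem green_add (u u' v : H) : green J (u + u') v = green J u v + green J u' v := by
  ext k; simp [green, inner_add_left]

theorem green_smul (c : ℝ) (u v : H) : green J (c • u) v = PowerSeries.C c * green J u v := by
  ext k; simp [green, inner_smul_left]

theorem one_add_sq_mul_green (u v : H) : (1 + PowerSeries.X ^ 2) * green J u v =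
    PowerSeries.X * green J (J u) v + PowerSeries.C ⟪u, v⟫ := by
  ext k
  rw [add_mul, one_mul, map_add, map_add]
  match k with
  | 0 => simp [green, freePoly_zero, PowerSeries.coeff_X_pow_mul', PowerSeries.coeff_zero_X_mul]
  | 1 =>
    simp [green, freePoly_zero, freePoly_one, PowerSeries.coeff_X_pow_mul',
      PowerSeries.coeff_succ_X_mul]
  | k + 2 =>
    rw [PowerSeries.coeff_X_pow_mul, PowerSeries.coeff_succ_X_mul, PowerSeries.coeff_C,
      if_neg (by omega), add_zero]
    simp only [green, PowerSeries.coeff_mk]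
    rw [← inner_add_left, freePoly_add_two, mul_comm, map_sub, map_mul, aeval_X, sub_apply,
      mul_apply_eq_comp, sub_add_cancel]

theorem IsJacobi.green_comm (hJ : IsJacobi p q J) (u v : H) : green J u v = green J v u := by
  ext k
  simp only [green, PowerSeries.coeff_mk]
  rw [hJ.inner_aeval_comm, real_inner_comm]

theorem IsJacobi.green_zero (hJ : IsJacobi p q J) (j : ℕ) :
    (1 + PowerSeries.X ^ 2) * green J (e 0) (e j) =
      PowerSeries.X * (PowerSeries.C (q 0) * green J (e 0) (e j) +
        PowerSeries.C (p 1) * green J (e 1) (e j)) + if 0 = j then 1 else 0 := by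
  rw [one_add_sq_mul_green, hJ.zero, green_add, green_smul, green_smul, inner_e]
  split_ifs <;> simp

theorem IsJacobi.green_succ (hJ : IsJacobi p q J) (i j : ℕ) :
    (1 + PowerSeries.X ^ 2) * green J (e (i + 1)) (e j) =
      PowerSeries.X * (PowerSeries.C (p (i + 1)) * green J (e i) (e j) +
        PowerSeries.C (q (i + 1)) * green J (e (i + 1)) (e j) +
        PowerSeries.C (p (i + 2)) * green J (e (i + 2)) (e j)) + if i + 1 = j then 1 else 0 := by
  rw [one_add_sq_mul_green, hJ.succ, green_add, green_add, green_smul, green_smul, green_smul,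
    inner_e]
  split_ifs <;> simp

theorem IsJacobi.green_free (hJ : IsJacobi p q J) (hN : ∀ k, N ≤ k → p k = 1 ∧ q k = 0) {m : ℕ}
    (hm : N ≤ m) : green J (e 0) (e (m + 1)) = PowerSeries.X * green J (e 0) (e m) := by
  set d : ℕ → PowerSeries ℝ := fun j =>
    green J (e 0) (e (j + 1)) - PowerSeries.X * green J (e 0) (e j) with hd
  have hstep : ∀ j, N ≤ j → d j = PowerSeries.X * d (j + 1) := by
    intro j hj
    have h := hJ.green_succ j 0
    rw [(hN (j + 1) (by omega)).1, (hN (j + 2) (by omega)).1, (hN (j + 1) (by omega)).2,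
      if_neg (by omega), hJ.green_comm, hJ.green_comm (e j), hJ.green_comm (e (j + 2))] at h
    simp only [hd]
    simp only [map_one, map_zero] at h
    linear_combination h
  have hpow : ∀ k j, N ≤ j → d j = PowerSeries.X ^ k * d (j + k) := by
    intro k
    induction k with
    | zero => simp
    | succ k ih =>
      intro j hj
      rw [ih j hj, hstep (j + k) (by omega)]
      ring_nf
  refine sub_eq_zero.1 (show d m = 0 from ?_)
  ext k
  rw [hpow (k + 1) m hm, PowerSeries.coeff_X_pow_mul', if_neg (by omega), map_zero]

theorem IsJacobi.X_mul_derivative_jostPoly (hJ : IsJacobi p q J) (hp : ∀ k, 1 ≤ k → 0 < p k)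
    (hN : ∀ k, N ≤ k → p k = 1 ∧ q k = 0) {m : ℕ} (hm : N ≤ m) :
    PowerSeries.X * (derivative (jostPoly p q N) : PowerSeries ℝ) =
      ((m : PowerSeries ℝ) + 1) * (jostPoly p q N : PowerSeries ℝ) +
      (PowerSeries.X ^ 2 - 1) * (jostPoly p q N : PowerSeries ℝ) *
        ∑ j ∈ Finset.range (m + 1), green J (e j) (e j) -
      PowerSeries.X ^ 2 * (revPoly p q m : PowerSeries ℝ) := by
  set K := FractionRing (PowerSeries ℝ)
  set φ := algebraMap (PowerSeries ℝ) K with hφ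
  have hinj : Function.Injective φ := IsFractionRing.injective _ _
  have hC : ∀ c : ℝ, algebraMap ℝ K c = φ (PowerSeries.C c) := fun c => by
    rw [IsScalarTower.algebraMap_apply ℝ (PowerSeries ℝ) K]; rfl
  have haev : ∀ f : ℝ[X], aeval (φ PowerSeries.X) f = φ (f : PowerSeries ℝ) := fun f => by
    rw [aeval_algebraMap_apply]
    congr 1
    induction f using Polynomial.induction_on' with
    | add f g hf hg => simp [hf, hg]
    | monomial n a =>
      rw [← C_mul_X_pow_eq_monomial]
      simp
  have h := jostPoly_derivative_eq (K := K) (z := φ PowerSeries.X)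
    (g := fun i j => φ (green J (e i) (e j))) hp hN
    (by rw [ne_eq, map_eq_zero_iff φ hinj]; exact PowerSeries.X_ne_zero)
    (fun i j => by rw [hJ.green_comm])
    (fun j => by
      have := congrArg φ (hJ.green_zero j)
      rw [hC, hC]
      simpa [apply_ite φ] using this)
    (fun i j => by
      have := congrArg φ (hJ.green_succ i j)
      rw [hC, hC, hC]
      simpa [apply_ite φ] using this)
    hm
    (by simpa using congrArg φ (hJ.green_free hN hm))
  rw [haev, haev, haev] at h
  apply hinj
  simpa using h

end

/-- The polynomials `z ^ k + z ^ (-k)` in the variable `z + 1 / z`, normalized to `1` for `k = 0`. -/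
def freeDiff : ℕ → ℝ[X]
  | 0 => 1
  | 1 => X
  | k + 2 => freePoly (k + 2) - freePoly k

/-- The generating function of the negative power sums of a multiset. -/
def powerSum (s : Multiset ℂ) : PowerSeries ℂ :=
  PowerSeries.mk fun k => if k = 0 then 0 else (s.map fun ζ => ζ⁻¹ ^ k).sum

theorem powerSum_cons (ζ : ℂ) (s : Multiset ℂ) : powerSum (ζ ::ₘ s) = powerSum {ζ} + powerSum s := by
  ext k
  by_cases hk : k = 0 <;> simp [powerSum, hk]

theorem sub_mul_powerSum_singleton {ζ : ℂ} (hζ : ζ ≠ 0) :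
    (PowerSeries.X - PowerSeries.C ζ) * powerSum {ζ} = -PowerSeries.X := by
  ext k
  rw [sub_mul, map_sub, PowerSeries.coeff_C_mul]
  match k with
  | 0 => simp [powerSum]
  | 1 => simp [powerSum, PowerSeries.coeff_succ_X_mul, hζ]
  | k + 2 =>
    simp only [powerSum, PowerSeries.coeff_succ_X_mul, PowerSeries.coeff_mk, PowerSeries.coeff_X,
      map_neg]
    simp [pow_succ]
    field_simp
    simp

theorem X_mul_derivative_prod (s : Multiset ℂ) (hs : (0 : ℂ) ∉ s) :
    PowerSeries.X * (derivative (s.map fun ζ => X - C ζ).prod : PowerSeries ℂ) =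
      -(((s.map fun ζ => X - C ζ).prod : ℂ[X]) : PowerSeries ℂ) * powerSum s := by
  induction s using Multiset.induction_on with
  | empty =>
    have : powerSum 0 = 0 := by ext; simp [powerSum]
    simp [this]
  | cons ζ s ih =>
    rw [Multiset.mem_cons, not_or] at hs
    have h1 := sub_mul_powerSum_singleton (Ne.symm hs.1)
    have h2 := ih hs.2
    rw [powerSum_cons, Multiset.map_cons, Multiset.prod_cons, derivative_mul]
    simp only [derivative_sub, derivative_X, derivative_C, sub_zero, one_mul, Polynomial.coe_add,
      Polynomial.coe_mul, Polynomial.coe_sub, Polynomial.coe_X, Polynomial.coe_C]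
    linear_combination (PowerSeries.X - PowerSeries.C ζ) * h2 +
      (((s.map fun ζ => X - C ζ).prod : ℂ[X]) : PowerSeries ℂ) * h1

theorem X_mul_derivative_eq_powerSum {f : ℂ[X]} (hf : f.eval 0 ≠ 0) :
    PowerSeries.X * (derivative f : PowerSeries ℂ) = -(f : PowerSeries ℂ) * powerSum f.roots := by
  have h0 : (0 : ℂ) ∉ f.roots := fun h => hf (isRoot_of_mem_roots h)
  have h := (IsAlgClosed.splits f).eq_prod_roots
  have h1 := X_mul_derivative_prod f.roots h0
  generalize f.roots = s, f.leadingCoeff = c at *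
  rw [h, derivative_C_mul]
  simp only [Polynomial.coe_mul, Polynomial.coe_C]
  linear_combination PowerSeries.C c * h1

section

variable {p q : ℕ → ℝ} {N : ℕ} {J J₀ : H →L[ℝ] H}

theorem natDegree_orthoPoly_le (p q : ℕ → ℝ) (k : ℕ) : (orthoPoly p q k).natDegree ≤ k := by
  induction k using Nat.twoStepInduction with
  | zero => simp [orthoPoly]
  | one =>
    rw [orthoPoly]
    exact (natDegree_C_mul_le _ _).trans (natDegree_X_sub_C_le _)
  | more k h1 h2 =>
    rw [orthoPoly]
    refine (natDegree_C_mul_le _ _).trans ((natDegree_sub_le _ _).trans (max_le ?_ ?_))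
    · refine natDegree_mul_le.trans ?_
      have := natDegree_X_sub_C_le (q (k + 1))
      omega
    · exact (natDegree_C_mul_le _ _).trans (h1.trans (by omega))

theorem natDegree_freeDiff_le (k : ℕ) : (freeDiff k).natDegree ≤ k := by
  match k with
  | 0 => simp [freeDiff]
  | 1 => simp [freeDiff]
  | k + 2 =>
    exact (natDegree_sub_le _ _).trans (max_le (natDegree_orthoPoly_le _ _ _)
      ((natDegree_orthoPoly_le _ _ _).trans (by omega)))

theorem coeff_one_sub_sq_mul_green (u v : H) (k : ℕ) :
    PowerSeries.coeff k ((1 - PowerSeries.X ^ 2) * green J u v) = ⟪aeval J (freeDiff k) u, v⟫ := by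
  rw [sub_mul, one_mul, map_sub]
  match k with
  | 0 => simp [green, freePoly_zero, PowerSeries.coeff_X_pow_mul', freeDiff]
  | 1 => simp [green, freePoly_one, PowerSeries.coeff_X_pow_mul', freeDiff]
  | k + 2 =>
    rw [PowerSeries.coeff_X_pow_mul]
    simp only [green, PowerSeries.coeff_mk, freeDiff]
    rw [← inner_sub_left, map_sub, sub_apply]

/-- The difference of the diagonal matrix elements of a polynomial in two operators. -/
def diagDiff (J J₀ : H →L[ℝ] H) (f : ℝ[X]) (k : ℕ) : ℝ :=
  ⟪(aeval J f - aeval J₀ f) (e k), e k⟫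

theorem diagDiff_eq_zero (hJ : IsJacobi p q J) (hJ₀ : IsJacobi (fun _ => 1) (fun _ => 0) J₀)
    (hN : ∀ k, N ≤ k → p k = 1 ∧ q k = 0) (f : ℝ[X]) {k : ℕ} (hk : N + f.natDegree ≤ k) :
    diagDiff J J₀ f k = 0 := by
  rw [diagDiff, sub_apply, hJ.aeval_e_eq hJ₀ hN f hk, sub_self, inner_zero_left]

theorem revPoly_sub_free (hp : ∀ k, 1 ≤ k → 0 < p k)
    (hN : ∀ k, N ≤ k → p k = 1 ∧ q k = 0) (k : ℕ) :
    revPoly p q (N + k) - jostPoly p q N * revPoly (fun _ => 1) (fun _ => 0) (N + k) =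
      X ^ (2 * k) *
        (revPoly p q N - jostPoly p q N * revPoly (fun _ => 1) (fun _ => 0) N) := by
  have hfree : jostPoly (fun _ => 1) (fun _ => 0) 0 = 1 := by
    simp [jostPoly, revPoly]
  induction k with
  | zero => simp
  | succ k ih =>
    have h1 := jostPoly_eq hp hN (n := N + k) (by omega)
    have h2 := jostPoly_eq (p := fun _ => 1) (q := fun _ => 0) (N := 0) (n := N + k) (by simp)
      (by simp) (by omega)
    rw [hfree] at h2
    rw [jostPoly] at h1 h2
    rw [← add_assoc]
    rw [mul_add, pow_add]
    linear_combination h1 - jostPoly p q N * h2 + X ^ 2 * ih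

theorem sum_diagDiff_freeDiff (hJ : IsJacobi p q J)
    (hJ₀ : IsJacobi (fun _ => 1) (fun _ => 0) J₀) (hp : ∀ k, 1 ≤ k → 0 < p k)
    (hN : ∀ k, N ≤ k → p k = 1 ∧ q k = 0) {k : ℕ} (hk : k ≠ 0) :
    ((∑ j ∈ Finset.range (N + k + 1), diagDiff J J₀ (freeDiff k) j : ℝ) : ℂ) =
      (((jostPoly p q N).aroots ℂ).map fun ζ => ζ⁻¹ ^ k).sum := by
  set D := jostPoly p q N with hD
  set Q : PowerSeries ℝ := (1 - PowerSeries.X ^ 2) *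
    ∑ j ∈ Finset.range (N + k + 1), (green J (e j) (e j) - green J₀ (e j) (e j)) with hQ
  have hfree : jostPoly (fun _ => 1) (fun _ => 0) 0 = 1 := by
    simp [jostPoly, revPoly]
  obtain ⟨u, hu⟩ : ∃ u : PowerSeries ℝ, -(PowerSeries.X * (derivative D : PowerSeries ℝ)) =
      (D : PowerSeries ℝ) * Q + PowerSeries.X ^ (2 * k + 2) * u := by
    refine ⟨(revPoly p q N - D * revPoly (fun _ => 1) (fun _ => 0) N : ℝ[X]), ?_⟩
    have h1 := hJ.X_mul_derivative_jostPoly hp hN (m := N + k) (by omega)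
    have h2 := hJ₀.X_mul_derivative_jostPoly (N := 0) (by simp) (by simp) (m := N + k) (by omega)
    have h3 := congrArg (fun f : ℝ[X] => (f : PowerSeries ℝ)) (revPoly_sub_free hp hN k)
    rw [hfree] at h2
    simp only [Polynomial.coe_mul, Polynomial.coe_sub, Polynomial.coe_X, Polynomial.coe_pow,
      Polynomial.coe_one, derivative_one, Polynomial.coe_zero, mul_zero, ← hD] at h1 h2 h3 ⊢
    rw [hQ, Finset.sum_sub_distrib, pow_add]
    linear_combination (-1) * h1 + (D : PowerSeries ℝ) * h2 + PowerSeries.X ^ 2 * h3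
  have hD0 : (D.map (algebraMap ℝ ℂ)).eval 0 ≠ 0 := by
    have := (eval_zero_jostPoly_pos (q := q) hp N).ne'
    rw [← hD] at this
    rw [eval_map_algebraMap, ← map_zero (algebraMap ℝ ℂ), aeval_algebraMap_apply]
    simpa using this
  have hlog := X_mul_derivative_eq_powerSum hD0
  have hu' := congrArg (PowerSeries.map (algebraMap ℝ ℂ)) hu
  have hmapcoe : ∀ f : ℝ[X], PowerSeries.map (algebraMap ℝ ℂ) (f : PowerSeries ℝ) =
      ((f.map (algebraMap ℝ ℂ) : ℂ[X]) : PowerSeries ℂ) := fun f => by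
    ext; simp
  have hunit : IsUnit ((D.map (algebraMap ℝ ℂ) : ℂ[X]) : PowerSeries ℂ) := by
    rw [PowerSeries.isUnit_iff_constantCoeff, Polynomial.constantCoeff_coe, isUnit_iff_ne_zero,
      coeff_zero_eq_eval_zero]
    exact hD0
  simp only [map_neg, map_mul, map_add, map_pow, PowerSeries.map_X, hmapcoe] at hu'
  rw [derivative_map] at hlog
  have hfin : PowerSeries.X ^ (2 * k + 2) ∣
      (powerSum (D.aroots ℂ) - PowerSeries.map (algebraMap ℝ ℂ) Q) := by
    rw [← hunit.dvd_mul_left]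
    refine ⟨PowerSeries.map (algebraMap ℝ ℂ) u, ?_⟩
    rw [aroots_def]
    linear_combination hlog + hu'
  have := PowerSeries.X_pow_dvd_iff.1 hfin k (by omega)
  rw [map_sub, sub_eq_zero, powerSum, PowerSeries.coeff_mk, if_neg hk, PowerSeries.coeff_map, hQ,
    Finset.mul_sum, map_sum] at this
  rw [this]
  simp only [mul_sub, map_sub, coeff_one_sub_sq_mul_green, Complex.coe_algebraMap]
  simp only [diagDiff, sub_apply, inner_sub_left]

theorem tsum_diagDiff_freeDiff (hJ : IsJacobi p q J)
    (hJ₀ : IsJacobi (fun _ => 1) (fun _ => 0) J₀) (hp : ∀ k, 1 ≤ k → 0 < p k)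
    (hN : ∀ k, N ≤ k → p k = 1 ∧ q k = 0) {k : ℕ} (hk : k ≠ 0) :
    ∑' j, diagDiff J J₀ (freeDiff k) j =
      (((jostPoly p q N).aroots ℂ).map fun ζ => (ζ⁻¹ ^ k).re).sum := by
  rw [tsum_eq_sum (s := Finset.range (N + k + 1)) fun j hj => ?_]
  · have := congrArg Complex.re (sum_diagDiff_freeDiff hJ hJ₀ hp hN hk)
    rw [Complex.ofReal_re] at this
    rw [this]
    exact (map_multiset_sum Complex.reAddGroupHom _).trans (by rw [Multiset.map_map]; rfl)
  · have := natDegree_freeDiff_le k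
    refine diagDiff_eq_zero hJ hJ₀ hN _ ?_
    rw [Finset.mem_range] at hj
    omega

end

section

theorem freeDiff_add_three (k : ℕ) :
    freeDiff (k + 3) = X * freeDiff (k + 2) - freeDiff (k + 1) := by
  match k with
  | 0 =>
    simp only [freeDiff, freePoly_add_two, freePoly_one, freePoly_zero]
    ring
  | k + 1 =>
    simp only [freeDiff, freePoly_add_two]
    ring

theorem derivative_freeDiff (k : ℕ) :
    derivative (freeDiff (k + 1)) = ((k : ℝ[X]) + 1) * freePoly k := by
  induction k using Nat.twoStepInduction with
  | zero => simp [freeDiff, freePoly_zero]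
  | one =>
    simp [freeDiff, freePoly_add_two, freePoly_one, freePoly_zero]
    ring
  | more k h1 h2 =>
    rw [freeDiff_add_three, derivative_sub, derivative_mul, h1, h2, derivative_X, freeDiff,
      freePoly_add_two (k := k)]
    push_cast
    ring

theorem integrableOn_dividedDiff (A : ℝ[X]) (z : ℝ) :
    IntegrableOn (fun x => (A.eval x - A.eval z) / (x - z) * √(4 - x ^ 2)) (Set.Icc (-2 : ℝ) 2) := by
  obtain ⟨R, hR⟩ : (X - C z) ∣ A - C (A.eval z) := by
    rw [dvd_iff_isRoot]; simp
  have h : IntegrableOn (fun x => R.eval x * √(4 - x ^ 2)) (Set.Icc (-2 : ℝ) 2) :=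
    Continuous.integrableOn_Icc (by fun_prop)
  refine h.congr (ae_restrict_of_ae ?_)
  filter_upwards [Measure.ae_ne volume z] with x hx
  have := congrArg (eval x) hR
  simp only [eval_sub, eval_C, eval_mul, eval_X] at this
  rw [this, mul_div_cancel_left₀ _ (sub_ne_zero.2 hx)]

/-- The integral of a divided difference against the semicircle density. -/
def secondKind (A : ℝ[X]) (z : ℝ) : ℝ :=
  1 / π * ∫ x in Set.Icc (-2 : ℝ) 2, (A.eval x - A.eval z) / (x - z) * √(4 - x ^ 2)

theorem secondKind_add (A B : ℝ[X]) (z : ℝ) :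
    secondKind (A + B) z = secondKind A z + secondKind B z := by
  rw [secondKind, secondKind, secondKind, ← mul_add,
    ← integral_add (integrableOn_dividedDiff A z) (integrableOn_dividedDiff B z)]
  congr 2
  ext x
  simp only [eval_add]
  ring

theorem secondKind_smul (c : ℝ) (A : ℝ[X]) (z : ℝ) :
    secondKind (c • A) z = c * secondKind A z := by
  rw [secondKind, secondKind, mul_left_comm, ← integral_const_mul c]
  congr 2
  funext x
  simp only [eval_smul, smul_eq_mul]
  ring

theorem secondKind_X_mul (A : ℝ[X]) (z : ℝ) :
    secondKind (X * A) z = 1 / π * (∫ x in Set.Icc (-2 : ℝ) 2, A.eval x * √(4 - x ^ 2)) +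
      z * secondKind A z := by
  rw [secondKind, secondKind, mul_left_comm, ← mul_add, ← integral_const_mul z, ← integral_add
    (Continuous.integrableOn_Icc (by fun_prop)) ((integrableOn_dividedDiff A z).const_mul z)]
  congr 1
  refine integral_congr_ae (ae_restrict_of_ae ?_)
  filter_upwards [Measure.ae_ne volume z] with x hx
  have := sub_ne_zero.2 hx
  simp only [eval_mul, eval_X]
  field_simp
  ring

theorem secondKind_freePoly_zero (z : ℝ) : secondKind (freePoly 0) z = 0 := by
  simp [secondKind, freePoly_zero]

theorem secondKind_freePoly_succ (k : ℕ) (z : ℝ) :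
    secondKind (freePoly (k + 1)) z = 2 * (freePoly k).eval z := by
  have h1 : secondKind (freePoly 1) z = 2 := by
    rw [freePoly_one, ← mul_one X, ← freePoly_zero, secondKind_X_mul, integral_freePoly,
      secondKind_freePoly_zero, if_pos rfl]
    have := Real.pi_pos.ne'
    field_simp
    simp
  have hrec : ∀ k, secondKind (freePoly (k + 2)) z =
      z * secondKind (freePoly (k + 1)) z - secondKind (freePoly k) z := fun k => by
    have : freePoly (k + 2) = X * freePoly (k + 1) + (-1 : ℝ) • freePoly k := by
      rw [freePoly_add_two, neg_one_smul, sub_eq_add_neg]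
    rw [this, secondKind_add, secondKind_smul, secondKind_X_mul, integral_freePoly,
      if_neg (by omega)]
    ring
  induction k using Nat.twoStepInduction with
  | zero => simp [h1, freePoly_zero]
  | one => rw [hrec, h1, secondKind_freePoly_zero, freePoly_one, eval_X]; ring
  | more k h2 h3 =>
    rw [hrec, h3, h2, freePoly_add_two k]
    simp only [eval_sub, eval_mul, eval_X]
    ring

/-- A potential for the polynomial `freePoly k`. -/
def freePotential (k : ℕ) : ℝ[X] :=
  (1 / ((k : ℝ) + 2)) • freeDiff (k + 2) - (1 / (k : ℝ)) • freeDiff k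

theorem eval_derivative_freePotential (k : ℕ) (z : ℝ) :
    (derivative (freePotential k)).eval z = z * (freePoly k).eval z - secondKind (freePoly k) z := by
  rw [freePotential, derivative_sub, derivative_smul, derivative_smul, derivative_freeDiff]
  match k with
  | 0 =>
    rw [secondKind_freePoly_zero]
    simp [freePoly_one, freePoly_zero]
    ring
  | k + 1 =>
    rw [secondKind_freePoly_succ, derivative_freeDiff, freePoly_add_two]
    simp only [eval_sub, eval_smul, eval_mul, eval_add, eval_natCast, eval_one, eval_X, smul_eq_mul]
    push_cast
    field_simp
    ring

/-- The contribution of an eigenvalue outside `[-2, 2]` to the sum rule. -/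
def eigenWeight (A : ℝ[X]) (x : ℝ) : ℝ :=
  if 2 < x then ∫ t in (2 : ℝ)..x, A.eval t * √(t ^ 2 - 4)
  else if x < -2 then ∫ t in x..(-2 : ℝ), A.eval t * √(t ^ 2 - 4)
  else 0

theorem eigenWeight_add (A B : ℝ[X]) (x : ℝ) :
    eigenWeight (A + B) x = eigenWeight A x + eigenWeight B x := by
  have h : ∀ (A : ℝ[X]) (a b : ℝ),
      IntervalIntegrable (fun t => A.eval t * √(t ^ 2 - 4)) volume a b :=
    fun A a b => Continuous.intervalIntegrable (by fun_prop) _ _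
  simp only [eigenWeight, eval_add, add_mul]
  split_ifs
  · rw [intervalIntegral.integral_add (h _ _ _) (h _ _ _)]
  · rw [intervalIntegral.integral_add (h _ _ _) (h _ _ _)]
  · simp

theorem eigenWeight_smul (c : ℝ) (A : ℝ[X]) (x : ℝ) :
    eigenWeight (c • A) x = c * eigenWeight A x := by
  simp only [eigenWeight, eval_smul, smul_eq_mul, mul_assoc, intervalIntegral.integral_const_mul,
    mul_ite, mul_zero]

theorem eval_freePoly_neg (k : ℕ) (x : ℝ) :
    (freePoly k).eval (-x) = (-1) ^ k * (freePoly k).eval x := by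
  induction k using Nat.twoStepInduction with
  | zero => simp [freePoly_zero]
  | one => simp [freePoly_one]
  | more k h1 h2 =>
    simp only [freePoly_add_two, eval_sub, eval_mul, eval_X, h1, h2]
    ring

theorem sub_inv_mul_eval_freePoly (k : ℕ) {z : ℝ} (hz : z ≠ 0) :
    (z - z⁻¹) * (freePoly k).eval (z + z⁻¹) = z ^ (k + 1) - z⁻¹ ^ (k + 1) := by
  induction k using Nat.twoStepInduction with
  | zero => simp [freePoly_zero]
  | one => rw [freePoly_one, eval_X]; ring
  | more k h1 h2 =>
    simp only [freePoly_add_two, eval_sub, eval_mul, eval_X]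
    have := mul_inv_cancel₀ hz
    linear_combination (z + z⁻¹) * h2 - h1 + (z ^ (k + 1) - z⁻¹ ^ (k + 1)) * this

theorem sqrt_add_inv_sq_sub_four {z : ℝ} (hz : 0 < z) (hz1 : z ≤ 1) :
    √((z + z⁻¹) ^ 2 - 4) = z⁻¹ - z := by
  have : (z + z⁻¹) ^ 2 - 4 = (z⁻¹ - z) ^ 2 := by
    field_simp; ring
  rw [this, Real.sqrt_sq]
  have := (one_le_inv₀ hz).2 hz1
  linarith

theorem integral_freePoly_mul_sqrt (k : ℕ) {z : ℝ} (hz : 0 < z) (hz1 : z ≤ 1) :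
    ∫ t in (2 : ℝ)..(z + z⁻¹), (freePoly k).eval t * √(t ^ 2 - 4) =
      (if k = 0 then 2 * Real.log z else (z ^ k - z⁻¹ ^ k) / k) +
        (z⁻¹ ^ (k + 2) - z ^ (k + 2)) / (k + 2) := by
  have hmem : ∀ y ∈ Set.uIcc 1 z, 0 < y ∧ y ≤ 1 := fun y hy => by
    rw [Set.uIcc_of_ge hz1] at hy
    exact ⟨hz.trans_le hy.1, hy.2⟩
  have hsub := intervalIntegral.integral_comp_mul_deriv (a := 1) (b := z)
    (f := fun y : ℝ => y + y⁻¹) (f' := fun y => 1 + -(y ^ 2)⁻¹)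
    (g := fun t => (freePoly k).eval t * √(t ^ 2 - 4))
    (fun y hy => (hasDerivAt_id y).add (hasDerivAt_inv (hmem y hy).1.ne'))
    (ContinuousOn.add continuousOn_const (ContinuousOn.neg (ContinuousOn.inv₀ (by fun_prop)
      fun y hy => pow_ne_zero _ (hmem y hy).1.ne'))) (by fun_prop)
  have h11 : (1 : ℝ) + 1⁻¹ = 2 := by norm_num
  simp only [h11] at hsub
  rw [← hsub]
  set G : ℝ → ℝ := fun y => (if k = 0 then 2 * Real.log y else (y ^ k - y⁻¹ ^ k) / k) +
        (y⁻¹ ^ (k + 2) - y ^ (k + 2)) / (k + 2) with hG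
  have hG1 : G 1 = 0 := by simp [hG]
  have hderiv : ∀ y ∈ Set.uIcc 1 z, HasDerivAt G
      (((fun t => (freePoly k).eval t * √(t ^ 2 - 4)) ∘ fun y => y + y⁻¹) y *
        (1 + -(y ^ 2)⁻¹)) y := by
    intro y hy
    obtain ⟨hy0, hy1⟩ := hmem y hy
    have hval : ((fun t => (freePoly k).eval t * √(t ^ 2 - 4)) ∘ fun y => y + y⁻¹) y *
        (1 + -(y ^ 2)⁻¹) = (y ^ (k + 1) - y⁻¹ ^ (k + 1)) * (y⁻¹ - y) * y⁻¹ := by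
      rw [← sub_inv_mul_eval_freePoly k hy0.ne', Function.comp_apply]
      simp only [sqrt_add_inv_sq_sub_four hy0 hy1]
      field_simp
      ring
    rw [hval]
    have hinv := hasDerivAt_inv hy0.ne'
    have h2 := ((hinv.pow (k + 2)).sub (hasDerivAt_pow (k + 2) y)).div_const ((k : ℝ) + 2)
    by_cases hk : k = 0
    · have h1 := (Real.hasDerivAt_log hy0.ne').const_mul 2
      simp only [hG, if_pos hk]
      refine (h1.add h2).congr_deriv ?_
      subst hk
      simp
      field_simp
      ring
    · have h1 := ((hasDerivAt_pow k y).sub (hinv.pow k)).div_const (k : ℝ)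
      simp only [hG, if_neg hk]
      refine (h1.add h2).congr_deriv ?_
      obtain ⟨n, rfl⟩ := Nat.exists_eq_succ_of_ne_zero hk
      simp
      field_simp
      ring
  rw [intervalIntegral.integral_eq_sub_of_hasDerivAt hderiv, hG1, sub_zero]
  refine ContinuousOn.intervalIntegrable (ContinuousOn.mul ?_ ?_)
  · refine Continuous.comp_continuousOn (by fun_prop) (continuousOn_id.add ?_)
    exact ContinuousOn.inv₀ continuousOn_id fun y hy => (hmem y hy).1.ne'
  · exact continuousOn_const.add (ContinuousOn.inv₀ (by fun_prop)
      fun y hy => pow_ne_zero _ (hmem y hy).1.ne').neg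

theorem eigenWeight_freePoly (k : ℕ) {z : ℝ} (hz : z ≠ 0) (hz1 : |z| < 1) :
    eigenWeight (freePoly k) (z + z⁻¹) =
      (if k = 0 then 2 * Real.log |z| else (z ^ k - z⁻¹ ^ k) / k) +
        (z⁻¹ ^ (k + 2) - z ^ (k + 2)) / (k + 2) := by
  rw [abs_lt] at hz1
  rcases hz.lt_or_gt with h | h
  · have h0 : 0 < -z := neg_pos.2 h
    have h2 := two_lt_add_inv h0 (by linarith)
    rw [inv_neg] at h2
    rw [eigenWeight, if_neg (by linarith), if_pos (by linarith)]
    have := integral_freePoly_mul_sqrt k h0 (by linarith)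
    have hneg := intervalIntegral.integral_comp_neg (a := 2) (b := -z + (-z)⁻¹)
      (fun t => (freePoly k).eval t * √(t ^ 2 - 4))
    simp only [eval_freePoly_neg, neg_sq, mul_assoc, intervalIntegral.integral_const_mul] at hneg
    rw [inv_neg, neg_add, neg_neg, neg_neg] at hneg
    rw [inv_neg] at this
    rw [← hneg, this, abs_of_neg h]
    have hpow : ((-1 : ℝ) ^ k) * (-1) ^ k = 1 := by rw [← mul_pow]; simp
    split_ifs with hk
    · subst hk
      simp
    · simp only [neg_pow z, neg_pow z⁻¹, pow_add]
      linear_combination ((z ^ k - z⁻¹ ^ k) / k +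
        (z⁻¹ ^ k * z⁻¹ ^ 2 - z ^ k * z ^ 2) / (k + 2)) * hpow
  · have := two_lt_add_inv h hz1.2
    rw [eigenWeight, if_pos this, integral_freePoly_mul_sqrt k h hz1.2.le, abs_of_pos h]

end

theorem sum_map_filter_eq (s : Multiset ℂ) (P : ℂ → Prop) [DecidablePred P] (f : ℂ → ℝ) :
    ((s.filter P).map f).sum = (s.map fun ζ => if P ζ then f ζ else 0).sum := by
  induction s using Multiset.induction_on with
  | empty => simp
  | cons a s ih =>
    by_cases h : P a <;> simp [h, ih]

section

variable {p q : ℕ → ℝ} {N : ℕ} {J J₀ : H →L[ℝ] H}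

theorem finite_support_diagDiff (hJ : IsJacobi p q J)
    (hJ₀ : IsJacobi (fun _ => 1) (fun _ => 0) J₀) (hN : ∀ k, N ≤ k → p k = 1 ∧ q k = 0) (f : ℝ[X]) :
    (Function.support (diagDiff J J₀ f)).Finite := by
  refine (Set.finite_lt_nat (N + f.natDegree)).subset fun k hk => ?_
  by_contra h
  exact hk (diagDiff_eq_zero hJ hJ₀ hN f (not_lt.1 h))

theorem finite_support_log (hN : ∀ k, N ≤ k → p k = 1 ∧ q k = 0) :
    (Function.support fun k => Real.log (p (k + 1))).Finite := by
  refine (Set.finite_lt_nat N).subset fun k hk => ?_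
  by_contra h
  rw [Set.mem_ofPred_eq] at h
  exact hk (by simp [(hN (k + 1) ((not_lt.1 h).trans k.le_succ)).1])

theorem log_eval_zero_jostPoly (hp : ∀ k, 1 ≤ k → 0 < p k)
    (hN : ∀ k, N ≤ k → p k = 1 ∧ q k = 0) :
    Real.log ((jostPoly p q N).eval 0) = -∑' k, Real.log (p (k + 1)) := by
  rw [eval_zero_jostPoly, Real.log_prod fun i _ => (inv_pos.2 (hp (i + 1) (by omega))).ne',
    tsum_eq_sum (s := Finset.range (N + 1)) fun k hk => ?_, ← Finset.sum_neg_distrib]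
  · simp only [Real.log_inv]
  · rw [Finset.mem_range] at hk
    simp [(hN (k + 1) (by omega)).1]

theorem diagDiff_add (f g : ℝ[X]) : diagDiff J J₀ (f + g) = diagDiff J J₀ f + diagDiff J J₀ g := by
  funext k
  simp only [diagDiff, map_add, Pi.add_apply, ← inner_add_left, ← add_apply]
  rw [add_sub_add_comm]

theorem diagDiff_smul (c : ℝ) (f : ℝ[X]) : diagDiff J J₀ (c • f) = c • diagDiff J J₀ f := by
  funext k
  simp only [diagDiff, map_smul, Pi.smul_apply, smul_eq_mul, ← smul_sub, smul_apply]
  rw [real_inner_smul_left]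

/-- The sum rule for a weight `A`, with a potential `Φ` to be determined. -/
def SumRule (p q : ℕ → ℝ) (N : ℕ) (J J₀ : H →L[ℝ] H) (A Φ : ℝ[X]) : Prop :=
  ((((jostPoly p q N).aroots ℂ).filter (‖·‖ < 1)).map
      fun ζ => eigenWeight A (ζ.re + ζ.re⁻¹)).sum +
    1 / (2 * π) * ∫ x in Set.Icc (-2 : ℝ) 2,
      Real.log ((jostSq p q N).eval x) * A.eval x * √(4 - x ^ 2) =
  -(1 / π * ∫ x in Set.Icc (-2 : ℝ) 2, A.eval x * √(4 - x ^ 2)) * ∑' k, Real.log (p (k + 1)) +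
    ∑' k, diagDiff J J₀ Φ k

theorem SumRule.add (hp : ∀ k, 1 ≤ k → 0 < p k) (hJ : IsJacobi p q J)
    (hJ₀ : IsJacobi (fun _ => 1) (fun _ => 0) J₀) (hN : ∀ k, N ≤ k → p k = 1 ∧ q k = 0)
    {A B Φ Ψ : ℝ[X]} (hA : SumRule p q N J J₀ A Φ) (hB : SumRule p q N J J₀ B Ψ) :
    SumRule p q N J J₀ (A + B) (Φ + Ψ) := by
  have hi : ∀ A : ℝ[X], IntegrableOn (fun x => A.eval x * √(4 - x ^ 2)) (Set.Icc (-2 : ℝ) 2) :=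
    fun A => Continuous.integrableOn_Icc (by fun_prop)
  have hs : ∀ Φ, Summable (diagDiff J J₀ Φ) := fun Φ =>
    summable_of_hasFiniteSupport (finite_support_diagDiff hJ hJ₀ hN Φ)
  rw [SumRule] at hA hB ⊢
  simp only [eigenWeight_add, Multiset.sum_map_add, eval_add, mul_add, add_mul, diagDiff_add,
    Pi.add_apply]
  rw [integral_add (integrableOn_log_jostSq_mul hp A) (integrableOn_log_jostSq_mul hp B),
    integral_add (hi A) (hi B), (hs Φ).tsum_add (hs Ψ)]
  linear_combination hA + hB

theorem SumRule.smul {A Φ : ℝ[X]} (c : ℝ) (hA : SumRule p q N J J₀ A Φ) :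
    SumRule p q N J J₀ (c • A) (c • Φ) := by
  rw [SumRule] at hA ⊢
  simp only [eigenWeight_smul, Multiset.sum_map_mul_left, eval_smul, smul_eq_mul, diagDiff_smul,
    Pi.smul_apply, mul_assoc, mul_left_comm _ c, integral_const_mul, tsum_mul_left] at hA ⊢
  linear_combination c * hA

theorem sumRule_freePoly (hp : ∀ k, 1 ≤ k → 0 < p k) (hJ : IsJacobi p q J)
    (hJ₀ : IsJacobi (fun _ => 1) (fun _ => 0) J₀) (hN : ∀ k, N ≤ k → p k = 1 ∧ q k = 0) (k : ℕ) :
    SumRule p q N J J₀ (freePoly k) (freePotential k) := by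
  have hs : ∀ Φ, Summable (diagDiff J J₀ Φ) := fun Φ =>
    summable_of_hasFiniteSupport (finite_support_diagDiff hJ hJ₀ hN Φ)
  have hD0 := (eval_zero_jostPoly_pos (q := q) hp N).ne'
  have hmain : ∀ ζ ∈ (jostPoly p q N).aroots ℂ,
      (if ‖ζ‖ < 1 then eigenWeight (freePoly k) (ζ.re + ζ.re⁻¹) else 0) =
      (1 / ((k : ℝ) + 2)) * (ζ⁻¹ ^ (k + 2)).re - (1 / ((k : ℝ) + 2)) * (reflect ζ ^ (k + 2)).re -
      if k = 0 then 2 * log⁺ ‖ζ‖⁻¹ else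
        1 / (k : ℝ) * (ζ⁻¹ ^ k).re - 1 / (k : ℝ) * (reflect ζ ^ k).re := by
    intro ζ hζ
    have hroot := (mem_aroots.1 hζ).2
    by_cases h1 : ‖ζ‖ < 1
    · have him := im_eq_zero_of_jostPoly hp hN h1 hroot
      obtain ⟨z, rfl⟩ : ∃ z : ℝ, ζ = z := ⟨ζ.re, Complex.ext (by simp) (by simpa using him)⟩
      have hz : z ≠ 0 := by
        rintro rfl
        rw [aeval_ofReal_jostPoly] at hroot
        exact hD0 (by exact_mod_cast hroot)
      have hz1 : |z| < 1 := by simpa using h1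
      have hlog : log⁺ |z|⁻¹ = -Real.log |z| := by
        rw [Real.posLog_eq_log, Real.log_inv]
        rw [abs_of_nonneg (by positivity)]
        exact (one_le_inv₀ (abs_pos.2 hz)).2 hz1.le
      rw [if_pos h1, reflect, if_pos h1, Complex.ofReal_re, eigenWeight_freePoly k hz hz1,
        Complex.norm_real, Real.norm_eq_abs, hlog]
      norm_cast
      split_ifs
      · push_cast; ring
      · push_cast; ring
    · have hlog : log⁺ ‖ζ‖⁻¹ = 0 := by
        rw [Real.posLog_eq_zero_iff, abs_of_nonneg (by positivity)]
        exact inv_le_one_of_one_le₀ (not_lt.1 h1)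
      rw [if_neg h1, reflect, if_neg h1, hlog]
      split_ifs <;> ring
  rw [SumRule, sum_map_filter_eq, Multiset.map_congr rfl hmain, integral_log_jostSq_mul_freePoly hp,
    integral_freePoly, log_eval_zero_jostPoly hp hN, freePotential, sub_eq_add_neg, ← neg_smul,
    diagDiff_add, diagDiff_smul, diagDiff_smul]
  simp only [Pi.add_apply, Pi.smul_apply, smul_eq_mul]
  rw [((hs _).mul_left _).tsum_add ((hs _).mul_left _), tsum_mul_left, tsum_mul_left,
    tsum_diagDiff_freeDiff hJ hJ₀ hp hN (k := k + 2) (by omega)]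
  have hpi := Real.pi_pos.ne'
  by_cases hk : k = 0
  · subst hk
    simp only [if_pos, Multiset.sum_map_sub, Multiset.sum_map_mul_left]
    field_simp
    simp
    ring
  · simp only [if_neg hk, Multiset.sum_map_sub, Multiset.sum_map_mul_left]
    rw [tsum_diagDiff_freeDiff hJ hJ₀ hp hN hk]
    ring

theorem exists_sumRule (hp : ∀ k, 1 ≤ k → 0 < p k) (hJ : IsJacobi p q J)
    (hJ₀ : IsJacobi (fun _ => 1) (fun _ => 0) J₀) (hN : ∀ k, N ≤ k → p k = 1 ∧ q k = 0)
    (A : ℝ[X]) : ∃ Φ, (∀ z, (derivative Φ).eval z = z * A.eval z - secondKind A z) ∧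
      SumRule p q N J J₀ A Φ := by
  induction A using orthoPoly_induction (p := fun _ => 1) (q := fun _ => 0) (by simp) with
  | hbasis k =>
    exact ⟨freePotential k, eval_derivative_freePotential k, sumRule_freePoly hp hJ hJ₀ hN k⟩
  | hadd A B hA hB =>
    obtain ⟨Φ, hΦ, hA⟩ := hA
    obtain ⟨Ψ, hΨ, hB⟩ := hB
    refine ⟨Φ + Ψ, fun z => ?_, hA.add hp hJ hJ₀ hN hB⟩
    rw [derivative_add, eval_add, hΦ, hΨ, secondKind_add, eval_add]
    ring
  | hsmul c A hA =>
    obtain ⟨Φ, hΦ, hA⟩ := hA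
    refine ⟨c • Φ, fun z => ?_, hA.smul c⟩
    rw [derivative_smul, eval_smul, hΦ, secondKind_smul, eval_smul, smul_eq_mul, smul_eq_mul]
    ring

theorem sumRule (hp : ∀ k, 1 ≤ k → 0 < p k) (hJ : IsJacobi p q J)
    (hJ₀ : IsJacobi (fun _ => 1) (fun _ => 0) J₀) (hN : ∀ k, N ≤ k → p k = 1 ∧ q k = 0)
    {A Φ : ℝ[X]} (hΦ : ∀ z, (derivative Φ).eval z = z * A.eval z - secondKind A z) :
    SumRule p q N J J₀ A Φ := by
  obtain ⟨Ψ, hΨ, h⟩ := exists_sumRule hp hJ hJ₀ hN A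
  have hd : derivative (Φ - Ψ) = 0 := Polynomial.funext fun z => by
    rw [derivative_sub, eval_sub, hΦ, hΨ, sub_self, eval_zero]
  have hC := eq_C_of_derivative_eq_zero hd
  have : diagDiff J J₀ Φ = diagDiff J J₀ Ψ := by
    rw [← sub_add_cancel Φ Ψ, hC, diagDiff_add]
    funext k
    simp [diagDiff]
  rwa [SumRule, this]

end

end FiniteRankJacobi

/-- Sum rule for a finite-dimensional perturbation of the free Jacobi matrix. -/
theorem stmt_2
    -- the Jacobi matrix, a finite rank perturbation of the free one
    (p q : ℕ → ℝ) (hp : ∀ k, 1 ≤ k → 0 < p k)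
    (n₀ : ℕ) (hfin : ∀ k, n₀ ≤ k → p k = 1 ∧ q k = 0)
    (J J₀ : H →L[ℝ] H)
    (hJ0 : J (e 0) = q 0 • e 0 + p 1 • e 1)
    (hJ : ∀ k, 1 ≤ k → J (e k) = p k • e (k - 1) + q k • e k + p (k + 1) • e (k + 1))
    (hJ₀0 : J₀ (e 0) = e 1)
    (hJ₀ : ∀ k, 1 ≤ k → J₀ (e k) = e (k - 1) + e (k + 1))
    -- the spectral measure and its data
    (σ : Measure ℝ) [IsProbabilityMeasure σ]
    (hmom : ∀ k : ℕ, (∫ x, x ^ k ∂σ) = ⟪(J ^ k) (e 0), e 0⟫)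
    (X : Set ℝ) (hX : X = {x : ℝ | σ {x} ≠ 0 ∧ x ∉ Set.Icc (-2 : ℝ) 2})
    (w : ℝ → ℝ) (hw : w = fun x => (σ.rnDeriv volume x).toReal)
    -- the polynomial `A` and the data built from it
    (A : Polynomial ℝ) (m : ℕ) (hdeg : A.natDegree = m) (hA : ∀ x : ℝ, 0 ≤ A.eval x)
    (a : ℝ) (ha : a = (1 / π) * ∫ x in (-2 : ℝ)..2, A.eval x * Real.sqrt (4 - x ^ 2))
    (Φ : Polynomial ℝ) (hΦdeg : Φ.natDegree = m + 2)
    (hΦ : ∀ z : ℝ, (derivative Φ).eval z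
      = z * A.eval z
        - (1 / π) * ∫ x in (-2 : ℝ)..2,
            ((A.eval x - A.eval z) / (x - z)) * Real.sqrt (4 - x ^ 2))
    (F : ℝ → ℝ)
    (hF : ∀ x : ℝ, F x
      = if 2 < x then ∫ t in (2 : ℝ)..x, A.eval t * Real.sqrt (t ^ 2 - 4)
        else if x < -2 then ∫ t in x..(-2 : ℝ), A.eval t * Real.sqrt (t ^ 2 - 4)
        else 0) :
    -- conclusions
    X.Finite
    ∧ IntegrableOn
        (fun x => Real.log (Real.sqrt (4 - x ^ 2) / (2 * π * w x))
          * A.eval x * Real.sqrt (4 - x ^ 2)) (Set.Icc (-2 : ℝ) 2) volume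
    ∧ (Function.support (fun k : ℕ => Real.log (p (k + 1)))).Finite
    ∧ (Function.support (fun k : ℕ => ⟪(aeval J Φ - aeval J₀ Φ) (e k), e k⟫)).Finite
    ∧ (∑' x : X, F x)
        + (1 / (2 * π)) * (∫ x in Set.Icc (-2 : ℝ) 2,
            Real.log (Real.sqrt (4 - x ^ 2) / (2 * π * w x))
              * A.eval x * Real.sqrt (4 - x ^ 2))
      = -a * (∑' k : ℕ, Real.log (p (k + 1)))
        + ∑' k : ℕ, ⟪(aeval J Φ - aeval J₀ Φ) (e k), e k⟫ := by
  have hJ' : FiniteRankJacobi.IsJacobi p q J := ⟨hJ0, fun k => by simpa using hJ (k + 1) (by omega)⟩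
  have hJ₀' : FiniteRankJacobi.IsJacobi (fun _ => 1) (fun _ => 0) J₀ :=
    ⟨by simpa using hJ₀0, fun k => by simpa using hJ₀ (k + 1) (by omega)⟩
  have hσ : FiniteRankJacobi.IsSpectral J σ := hmom
  have hint : ∀ f : ℝ → ℝ, ∫ x in (-2 : ℝ)..2, f x = ∫ x in Set.Icc (-2 : ℝ) 2, f x := fun f => by
    rw [intervalIntegral.integral_of_le (by norm_num), integral_Icc_eq_integral_Ioc]
  have hae : (fun x => Real.log ((FiniteRankJacobi.jostSq p q n₀).eval x) * A.eval x *
      √(4 - x ^ 2)) =ᵐ[volume.restrict (Set.Icc (-2 : ℝ) 2)]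
      fun x => Real.log (√(4 - x ^ 2) / (2 * π * w x)) * A.eval x * √(4 - x ^ 2) := by
    filter_upwards [hσ.ae_density_eq hJ' hp hJ₀' hfin] with x hx
    rw [hw, hx]
  have hFA : F = FiniteRankJacobi.eigenWeight A := funext hF
  have hrule := FiniteRankJacobi.sumRule (A := A) (Φ := Φ) hp hJ' hJ₀' hfin fun z => by
    rw [hΦ, hint, FiniteRankJacobi.secondKind]
  refine ⟨?_, (FiniteRankJacobi.integrableOn_log_jostSq_mul hp A).congr hae,
    FiniteRankJacobi.finite_support_log hfin,
    FiniteRankJacobi.finite_support_diagDiff hJ' hJ₀' hfin Φ, ?_⟩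
  · rw [hX, hσ.setOf_atoms hJ' hp hfin]
    exact (FiniteRankJacobi.finite_jostPoly_zeros hp).image _
  · subst hX
    rw [hσ.tsum_atoms hJ' hp hfin, ha, hint, ← integral_congr_ae hae, hFA]
    exact hrule

end
end

section
/- For every integer k ≥ 1, every integer l ≥ 1 and every n ≥ l − 1, one has (J^{(k)})^l e_n = (J^l)^{(k)} e_n, where G^{(k)} := (S*)^k G S^k. -/
open Polynomial ContinuousLinearMap
open scoped ENNReal RealInnerProductSpace

noncomputable section

theorem inner_e_left (k : ℕ) (x : H) : ⟪e k, x⟫ = x k := by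
  simp [e, lp.inner_single_left]

theorem adjoint_shift_e (S : H →L[ℝ] H) (hS : ∀ k, S (e k) = e (k + 1)) (n : ℕ) :
    adjoint S (e (n + 1)) = e n := by
  ext i
  rw [← inner_e_left, adjoint_inner_right, hS, inner_e_left]
  simp [e, lp.single_apply, Pi.single_apply]

theorem shift_pow_e (S : H →L[ℝ] H) (hS : ∀ k, S (e k) = e (k + 1)) (k n : ℕ) :
    (S ^ k) (e n) = e (n + k) := by
  induction k with
  | zero => rfl
  | succ k ih => rw [pow_succ', mul_apply_eq_comp, ih, hS, add_assoc]

theorem adjoint_shift_pow_e (S : H →L[ℝ] H) (hS : ∀ k, S (e k) = e (k + 1)) (k n : ℕ) :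
    (adjoint S ^ k) (e (n + k)) = e n := by
  induction k with
  | zero => rfl
  | succ k ih => rw [pow_succ, mul_apply_eq_comp, ← add_assoc, adjoint_shift_e S hS, ih]

/-- The compression `J⁽ᵏ⁾` of a Jacobi matrix acts on `eₙ`, `n ≥ 1`, by the shifted three-term
recurrence. -/
theorem compression_e {p q : ℕ → ℝ} {J S : H →L[ℝ] H}
    (hJ : ∀ k, 1 ≤ k → J (e k) = p k • e (k - 1) + q k • e k + p (k + 1) • e (k + 1))
    (hS : ∀ k, S (e k) = e (k + 1)) (k n : ℕ) :
    ((adjoint S ^ k) ∘L J ∘L (S ^ k)) (e (n + 1)) =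
      p (n + 1 + k) • e n + q (n + 1 + k) • e (n + 1) + p (n + 1 + k + 1) • e (n + 2) := by
  have h₁ : n + 1 + k - 1 = n + k := by omega
  have h₂ : n + 1 + k + 1 = n + 2 + k := by omega
  rw [comp_apply, comp_apply, shift_pow_e S hS, hJ _ (by omega), h₁, h₂]
  simp only [map_add, map_smul, adjoint_shift_pow_e S hS]

/-- Up to time `m ≤ n`, the orbit of `eₙ` under `J⁽ᵏ⁾` is intertwined by `Sᵏ` with that of
`Sᵏ eₙ` under `J`. -/
theorem shift_pow_compression_pow_e {p q : ℕ → ℝ} {J S : H →L[ℝ] H}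
    (hJ : ∀ k, 1 ≤ k → J (e k) = p k • e (k - 1) + q k • e k + p (k + 1) • e (k + 1))
    (hS : ∀ k, S (e k) = e (k + 1)) (k m n : ℕ) (hmn : m ≤ n) :
    (S ^ k) ((((adjoint S ^ k) ∘L J ∘L (S ^ k)) ^ m) (e n)) = (J ^ m) ((S ^ k) (e n)) := by
  induction m generalizing n with
  | zero => rfl
  | succ m ih =>
    obtain ⟨n, rfl⟩ : ∃ i, n = i + 1 := ⟨n - 1, by omega⟩
    have h₁ : n + 1 + k - 1 = n + k := by omega
    have h₂ : n + 1 + k + 1 = n + 2 + k := by omega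
    rw [pow_succ, mul_apply_eq_comp, compression_e hJ hS, pow_succ, mul_apply_eq_comp,
      shift_pow_e S hS k (n + 1), hJ _ (by omega), h₁, h₂]
    simp only [map_add, map_smul]
    rw [ih n (by omega), ih (n + 1) (by omega), ih (n + 2) (by omega)]
    simp only [shift_pow_e S hS]

/-- For a one-sided Jacobi matrix `J` and the right shift `S`, writing
`G⁽ᵏ⁾ = (S*)ᵏ G Sᵏ`, one has `(J⁽ᵏ⁾)ˡ eₙ = (Jˡ)⁽ᵏ⁾ eₙ` for all `k ≥ 1`, `l ≥ 1`
and `n ≥ l - 1`. -/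
theorem stmt_3
    (p q : ℕ → ℝ) (hp : ∀ k, 1 ≤ k → 0 < p k)
    (hpb : ∃ C, ∀ k, |p k| ≤ C) (hqb : ∃ C, ∀ k, |q k| ≤ C)
    (J : H →L[ℝ] H)
    (hJ0 : J (e 0) = q 0 • e 0 + p 1 • e 1)
    (hJ : ∀ k, 1 ≤ k → J (e k) = p k • e (k - 1) + q k • e k + p (k + 1) • e (k + 1))
    (S : H →L[ℝ] H) (hS : ∀ k, S (e k) = e (k + 1))
    (k l n : ℕ) (hk : 1 ≤ k) (hl : 1 ≤ l) (hn : l - 1 ≤ n) :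
    ((((adjoint S) ^ k : H →L[ℝ] H) ∘L J ∘L ((S ^ k : H →L[ℝ] H))) ^ l) (e n)
      = ((adjoint S) ^ k) ((J ^ l) ((S ^ k) (e n))) := by
  obtain ⟨m, rfl⟩ : ∃ m, l = m + 1 := ⟨l - 1, by omega⟩
  rw [pow_succ', mul_apply_eq_comp, comp_apply, comp_apply,
    shift_pow_compression_pow_e hJ hS k m n (by omega), pow_succ', mul_apply_eq_comp]

end
end

section
/- Let ρ : 𝕋 → [0,∞) be measurable with ∫_𝕋 ρ dm = 1 and ρ·log ρ ∈ L¹(m). For a finite positive Borel measure ν on 𝕋, the integral E(ν) := ∫_𝕋 log( dm/dν_ac )·ρ dm is well defined with values in (−∞, +∞] (the negative part of the integrand ρ·log(1/(dν_ac/dm)) is integrable, being bounded by dν_ac/dm + |ρ·log ρ|). If finite positive Borel measures μ_k on 𝕋 converge weakly to μ, then liminf_{k→∞} E(μ_k) ≥ E(μ). -/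
open MeasureTheory Filter Topology
open scoped ENNReal

noncomputable section

/-- The negative part of the integrand `ρ·log(dm/dν_ac)`, integrated:
`∫ max(ρ·log(dν_ac/dm), 0) dm` (a finite real number). -/
def negPartE (ρ : UnitAddCircle → ℝ) (ν : Measure UnitAddCircle) : ℝ :=
  ∫ x, max (ρ x * Real.log ((ν.rnDeriv volume x).toReal)) 0
    ∂(volume : Measure UnitAddCircle)

/-- The positive part of the integrand `ρ·log(dm/dν_ac)`, integrated in `[0,∞]`;
on the set where `dν_ac/dm = 0` the integrand is `ρ·(+∞)`. -/
def posPartE (ρ : UnitAddCircle → ℝ) (ν : Measure UnitAddCircle) : ℝ≥0∞ :=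
  ∫⁻ x, ENNReal.ofReal (ρ x)
      * (if ν.rnDeriv volume x = 0 then ⊤
         else ENNReal.ofReal (-(Real.log ((ν.rnDeriv volume x).toReal))))
    ∂(volume : Measure UnitAddCircle)

/-- `E(ν) = ∫ log(dm/dν_ac)·ρ dm ∈ (-∞, +∞]`. -/
def EFun (ρ : UnitAddCircle → ℝ) (ν : Measure UnitAddCircle) : EReal :=
  ((posPartE ρ ν : ℝ≥0∞) : EReal) - ((negPartE ρ ν : ℝ) : EReal)

/-- Fenchel–Young inequality for the relative entropy integrand. -/
lemma young_mul_log {r f g : ℝ} (hr : 0 ≤ r) (hf : 0 ≤ f) (hrf : f = 0 → r = 0) :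
    r * g + r - r * Real.log r - f * Real.exp g ≤ -(r * Real.log f) := by
  rcases hr.eq_or_lt with rfl | hr
  · simpa using mul_nonneg hf (Real.exp_pos g).le
  have hf' : 0 < f := hf.lt_of_ne' fun h => hr.ne' (hrf h)
  have h1 : f * Real.exp g = r * Real.exp (Real.log f + g - Real.log r) := by
    rw [Real.exp_sub, Real.exp_add, Real.exp_log hf', Real.exp_log hr]
    field_simp
  have h2 := mul_le_mul_of_nonneg_left
    (Real.add_one_le_exp (Real.log f + g - Real.log r)) hr.le
  rw [h1]
  linarith

lemma max_mul_log_le {r f : ℝ} (hr : 0 ≤ r) (hf : 0 ≤ f) :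
    max (r * Real.log f) 0 ≤ f + |r * Real.log r| := by
  refine max_le ?_ (add_nonneg hf (abs_nonneg _))
  rcases hf.eq_or_lt with rfl | hf
  · simp only [Real.log_zero, mul_zero, zero_add, abs_nonneg]
  have h := young_mul_log (g := 0) hr hf.le fun h => absurd h hf.ne'
  have := le_abs_self (r * Real.log r)
  simp only [mul_zero, Real.exp_zero, mul_one] at h
  linarith

lemma measurable_mul_log_rnDeriv {ρ : UnitAddCircle → ℝ} (hρm : Measurable ρ)
    (ν : Measure UnitAddCircle) :
    Measurable fun x => ρ x * Real.log ((ν.rnDeriv volume x).toReal) :=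
  hρm.mul (Real.measurable_log.comp (Measure.measurable_rnDeriv ν volume).ennreal_toReal)

lemma integrable_max_mul_log_rnDeriv {ρ : UnitAddCircle → ℝ} (hρm : Measurable ρ)
    (hρ0 : ∀ x, 0 ≤ ρ x) (hρlog : Integrable fun x => ρ x * Real.log (ρ x))
    (ν : Measure UnitAddCircle) [IsFiniteMeasure ν] :
    Integrable fun x => max (ρ x * Real.log ((ν.rnDeriv volume x).toReal)) 0 := by
  refine (Measure.integrable_toReal_rnDeriv (μ := ν).add hρlog.abs).mono'
    ((measurable_mul_log_rnDeriv hρm ν).max measurable_const).aestronglyMeasurable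
    (ae_of_all _ fun x => ?_)
  rw [Real.norm_of_nonneg (le_max_right _ _)]
  exact max_mul_log_le (hρ0 x) ENNReal.toReal_nonneg

/-- The integrand of `posPartE` where `ρ` vanishes together with `dν_ac/dm`. -/
lemma ofReal_mul_ite_eq {r : ℝ} {f : ℝ≥0∞} (hr : 0 ≤ r) (h : f = 0 → r = 0) :
    ENNReal.ofReal r * (if f = 0 then ⊤ else ENNReal.ofReal (-(Real.log f.toReal)))
      = ENNReal.ofReal (-(r * Real.log f.toReal)) := by
  split_ifs with hf
  · simp [h hf]
  · rw [← ENNReal.ofReal_mul hr, mul_neg]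

lemma posPartE_eq_lintegral {ρ : UnitAddCircle → ℝ} (hρ0 : ∀ x, 0 ≤ ρ x)
    {ν : Measure UnitAddCircle} (h : ∀ᵐ x, ν.rnDeriv volume x = 0 → ρ x = 0) :
    posPartE ρ ν
      = ∫⁻ x, ENNReal.ofReal (-(ρ x * Real.log ((ν.rnDeriv volume x).toReal))) :=
  lintegral_congr_ae (h.mono fun x hx => ofReal_mul_ite_eq (hρ0 x) hx)

lemma EFun_eq_integral {ρ : UnitAddCircle → ℝ} (hρ0 : ∀ x, 0 ≤ ρ x)
    {ν : Measure UnitAddCircle} (h : ∀ᵐ x, ν.rnDeriv volume x = 0 → ρ x = 0)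
    (hint : Integrable fun x => ρ x * Real.log ((ν.rnDeriv volume x).toReal)) :
    EFun ρ ν
      = ((∫ x, -(ρ x * Real.log ((ν.rnDeriv volume x).toReal)) : ℝ) : EReal) := by
  have hneg : negPartE ρ ν
      = (∫⁻ x, ENNReal.ofReal (ρ x * Real.log ((ν.rnDeriv volume x).toReal))).toReal := by
    refine (integral_eq_lintegral_of_nonneg_ae (ae_of_all _ fun x => le_max_right _ _)
      hint.pos_part.aestronglyMeasurable).trans ?_
    simp
  have hpos : posPartE ρ ν ≠ ⊤ := by
    rw [posPartE_eq_lintegral hρ0 h]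
    exact hint.neg.lintegral_lt_top.ne
  rw [EFun, ← EReal.coe_ennreal_toReal hpos, ← EReal.coe_sub, EReal.coe_eq_coe_iff,
    posPartE_eq_lintegral hρ0 h, hneg]
  simpa using (integral_eq_lintegral_pos_part_sub_lintegral_neg_part hint.neg).symm

lemma integrable_of_posPartE_ne_top {ρ : UnitAddCircle → ℝ} (hρm : Measurable ρ)
    (hρ0 : ∀ x, 0 ≤ ρ x) (hρlog : Integrable fun x => ρ x * Real.log (ρ x))
    (ν : Measure UnitAddCircle) [IsFiniteMeasure ν] (hpos : posPartE ρ ν ≠ ⊤) :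
    (∀ᵐ x, ν.rnDeriv volume x = 0 → ρ x = 0) ∧
      Integrable fun x => ρ x * Real.log ((ν.rnDeriv volume x).toReal) := by
  have hf := Measure.measurable_rnDeriv ν volume
  have h : ∀ᵐ x, ν.rnDeriv volume x = 0 → ρ x = 0 := by
    refine (ae_lt_top ?_ hpos).mono fun x hx h0 => ?_
    · exact hρm.ennreal_ofReal.mul (Measurable.ite (hf (measurableSet_singleton 0))
        measurable_const (Real.measurable_log.comp hf.ennreal_toReal).neg.ennreal_ofReal)
    · by_contra hne
      simp [h0, ENNReal.mul_top, (hρ0 x).lt_of_ne' hne] at hx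
  refine ⟨h, ?_⟩
  have hm := measurable_mul_log_rnDeriv hρm ν
  rw [posPartE_eq_lintegral hρ0 h] at hpos
  have hn : Integrable fun x => max (-(ρ x * Real.log ((ν.rnDeriv volume x).toReal))) 0 := by
    refine ⟨(hm.neg.max measurable_const).aestronglyMeasurable, ?_⟩
    refine (hasFiniteIntegral_iff_ofReal (ae_of_all _ fun x => le_max_right _ _)).2 ?_
    simpa using hpos.lt_top
  refine ((integrable_max_mul_log_rnDeriv hρm hρ0 hρlog ν).sub hn).congr
    (ae_of_all _ fun x => ?_)
  exact max_zero_sub_eq_self _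

/-- The functional of `g` whose supremum is, up to a constant, `E(ν)`. -/
def entropyDual (ρ : UnitAddCircle → ℝ) (ν : Measure UnitAddCircle) (g : UnitAddCircle → ℝ) : ℝ :=
  (∫ x, ρ x * g x) + 1 - (∫ x, ρ x * Real.log (ρ x)) - ∫ x, Real.exp (g x) ∂ν

lemma integrable_exp_of_abs_le {g : UnitAddCircle → ℝ} (hg : Measurable g) {c : ℝ}
    (hc : ∀ x, |g x| ≤ c) (ν : Measure UnitAddCircle) [IsFiniteMeasure ν] :
    Integrable (fun x => Real.exp (g x)) ν := by
  refine Integrable.of_bound hg.exp.aestronglyMeasurable (Real.exp c) (ae_of_all _ fun x => ?_)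
  rw [Real.norm_of_nonneg (Real.exp_pos _).le]
  exact Real.exp_le_exp.2 ((le_abs_self _).trans (hc x))

lemma integrable_mul_of_abs_le {ρ g : UnitAddCircle → ℝ} (hρ : Integrable ρ) (hg : Measurable g)
    {c : ℝ} (hc : ∀ x, |g x| ≤ c) : Integrable fun x => ρ x * g x :=
  hρ.mul_bdd (c := c) hg.aestronglyMeasurable (ae_of_all _ hc)

lemma integrable_rnDeriv_mul {h : UnitAddCircle → ℝ} {ν : Measure UnitAddCircle}
    [IsFiniteMeasure ν] (hh : Integrable h ν) :
    Integrable fun x => (ν.rnDeriv volume x).toReal * h x :=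
  (integrable_withDensity_iff_integrable_smul' (Measure.measurable_rnDeriv ν volume)
    (Measure.rnDeriv_lt_top ν volume)).1 (hh.mono_measure (Measure.withDensity_rnDeriv_le ν _))

lemma integral_eq_rnDeriv_add_singularPart {h : UnitAddCircle → ℝ} {ν : Measure UnitAddCircle}
    [IsFiniteMeasure ν] (hh : Integrable h ν) :
    ∫ x, h x ∂ν = (∫ x, (ν.rnDeriv volume x).toReal * h x)
      + ∫ x, h x ∂(ν.singularPart volume) := by
  conv_lhs => rw [← Measure.rnDeriv_add_singularPart ν volume]
  rw [integral_add_measure (hh.mono_measure (Measure.withDensity_rnDeriv_le ν _))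
    (hh.mono_measure (Measure.singularPart_le ν _)),
    integral_withDensity_eq_integral_toReal_smul (Measure.measurable_rnDeriv ν volume)
      (Measure.rnDeriv_lt_top ν volume)]
  rfl

lemma entropyDual_le_EFun {ρ : UnitAddCircle → ℝ} (hρm : Measurable ρ)
    (hρ0 : ∀ x, 0 ≤ ρ x) (hρ1 : ∫ x, ρ x = 1)
    (hρlog : Integrable fun x => ρ x * Real.log (ρ x))
    (ν : Measure UnitAddCircle) [IsFiniteMeasure ν] {g : UnitAddCircle → ℝ} (hg : Measurable g)
    {c : ℝ} (hc : ∀ x, |g x| ≤ c) : (entropyDual ρ ν g : EReal) ≤ EFun ρ ν := by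
  by_cases hpos : posPartE ρ ν = ⊤
  · simp [EFun, hpos]
  obtain ⟨h, hint⟩ := integrable_of_posPartE_ne_top hρm hρ0 hρlog ν hpos
  rw [EFun_eq_integral hρ0 h hint, EReal.coe_le_coe_iff]
  have hρi : Integrable ρ := .of_integral_ne_zero (by simp [hρ1])
  have hρg := integrable_mul_of_abs_le hρi hg hc
  have hexp := integrable_exp_of_abs_le hg hc ν
  have hfexp := integrable_rnDeriv_mul hexp
  have hle : ∫ x, (ν.rnDeriv volume x).toReal * Real.exp (g x) ≤ ∫ x, Real.exp (g x) ∂ν := by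
    rw [integral_eq_rnDeriv_add_singularPart hexp]
    have : 0 ≤ ∫ x, Real.exp (g x) ∂(ν.singularPart volume) :=
      integral_nonneg fun x => (Real.exp_pos _).le
    linarith
  have hmono := integral_mono_ae (((hρg.add hρi).sub hρlog).sub hfexp) hint.neg <| by
    filter_upwards [h, Measure.rnDeriv_lt_top ν volume] with x hx hlt
    refine young_mul_log (hρ0 x) ENNReal.toReal_nonneg fun h0 => hx ?_
    exact ((ENNReal.toReal_eq_zero_iff _).1 h0).resolve_right hlt.ne
  rw [integral_sub' ((hρg.add hρi).sub hρlog) hfexp, integral_sub' (hρg.add hρi) hρlog,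
    integral_add' hρg hρi, hρ1] at hmono
  rw [entropyDual]
  simp only [Pi.neg_apply] at hmono
  linarith

lemma tendsto_entropyDual {ρ : UnitAddCircle → ℝ} {μ : ℕ → Measure UnitAddCircle}
    {ν : Measure UnitAddCircle}
    (hweak : ∀ f : C(UnitAddCircle, ℝ),
      Tendsto (fun k => ∫ x, f x ∂(μ k)) atTop (𝓝 (∫ x, f x ∂ν)))
    (g : C(UnitAddCircle, ℝ)) :
    Tendsto (fun k => entropyDual ρ (μ k) g) atTop (𝓝 (entropyDual ρ ν g)) :=
  (hweak ⟨fun x => Real.exp (g x), by fun_prop⟩).const_sub _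

/-- A bounded measurable function is an almost everywhere limit of continuous functions
with the same bound. -/
lemma exists_continuous_tendsto_ae {X : Type*} [TopologicalSpace X] [NormalSpace X]
    [MeasurableSpace X] [BorelSpace X] (μ : Measure X) [IsFiniteMeasure μ] [μ.WeaklyRegular]
    {g : X → ℝ} (hg : Measurable g) {c : ℝ} (hc : ∀ x, |g x| ≤ c) (hc0 : 0 ≤ c) :
    ∃ G : ℕ → C(X, ℝ), (∀ j x, |G j x| ≤ c) ∧
      ∀ᵐ x ∂μ, Tendsto (fun j => G j x) atTop (𝓝 (g x)) := by
  have hmem : MemLp g 1 μ := .of_bound hg.aestronglyMeasurable c (ae_of_all _ hc)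
  choose F hF hFm using fun n : ℕ => hmem.exists_boundedContinuous_eLpNorm_sub_le
    ENNReal.one_ne_top (ENNReal.inv_ne_zero.2 (ENNReal.natCast_ne_top n))
  have hlim : Tendsto (fun n => eLpNorm ((F n : X → ℝ) - g) 1 μ) atTop (𝓝 0) := by
    refine tendsto_of_tendsto_of_tendsto_of_le_of_le tendsto_const_nhds
      ENNReal.tendsto_inv_nat_nhds_zero (fun _ => zero_le) fun n => ?_
    rw [eLpNorm_sub_comm]
    exact hF n
  obtain ⟨ns, -, hns⟩ := (tendstoInMeasure_of_tendsto_eLpNorm one_ne_zero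
    (fun n => (hFm n).aestronglyMeasurable) hmem.aestronglyMeasurable hlim).exists_seq_tendsto_ae
  refine ⟨fun j => ⟨fun x => max (-c) (min c (F (ns j) x)), by fun_prop⟩, fun j x => ?_, ?_⟩
  · exact abs_le.2 ⟨le_max_left _ _, max_le (by linarith) (min_le_left _ _)⟩
  · filter_upwards [hns] with x hx
    have h := (tendsto_const_nhds (x := -c)).max ((tendsto_const_nhds (x := c)).min hx)
    rwa [min_eq_right (abs_le.1 (hc x)).2, max_eq_right (abs_le.1 (hc x)).1] at h

/-- A bound for `entropyDual` over continuous functions holds over bounded measurable ones. -/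
lemma entropyDual_le_of_forall_continuous {ρ : UnitAddCircle → ℝ} (hρi : Integrable ρ)
    {ν : Measure UnitAddCircle} [IsFiniteMeasure ν] {b : ℝ}
    (hb : ∀ g : C(UnitAddCircle, ℝ), entropyDual ρ ν g ≤ b) {g : UnitAddCircle → ℝ}
    (hg : Measurable g) {c : ℝ} (hc : ∀ x, |g x| ≤ c) : entropyDual ρ ν g ≤ b := by
  obtain ⟨G, hGc, hG⟩ := exists_continuous_tendsto_ae (ν + volume) hg hc
    ((abs_nonneg _).trans (hc 0))
  rw [ae_add_measure_iff] at hG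
  refine le_of_tendsto' (f := fun j => entropyDual ρ ν (G j)) (x := atTop) ?_ fun j => hb _
  refine Tendsto.sub (Tendsto.sub_const (Tendsto.add_const _ ?_) _) ?_
  · refine tendsto_integral_of_dominated_convergence (fun x => |ρ x| * c)
      (fun j => (hρi.1.mul (G j).continuous.aestronglyMeasurable)) (hρi.abs.mul_const c)
      (fun j => ae_of_all _ fun x => ?_) (hG.2.mono fun x hx => hx.const_mul _)
    rw [norm_mul]
    exact mul_le_mul_of_nonneg_left (hGc j x) (abs_nonneg _)
  · refine tendsto_integral_of_dominated_convergence (fun x => Real.exp c)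
      (fun j => by fun_prop) (integrable_const _)
      (fun j => ae_of_all _ fun x => ?_)
      (hG.1.mono fun x hx => (Real.continuous_exp.tendsto _).comp hx)
    rw [Real.norm_of_nonneg (Real.exp_pos _).le]
    exact Real.exp_le_exp.2 ((le_abs_self _).trans (hGc j x))

/-- The truncation to `[-n, n]` of `log (r / f)`, with value `-n` if `r = 0` and `n` if
`r ≠ 0 = f`. -/
def truncLogRatio (n r f : ℝ) : ℝ :=
  if r = 0 then -n else if f = 0 then n else max (-n) (min n (Real.log r - Real.log f))

lemma abs_truncLogRatio_le {n : ℝ} (hn : 0 ≤ n) (r f : ℝ) : |truncLogRatio n r f| ≤ n := by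
  unfold truncLogRatio
  split_ifs
  · rw [abs_neg, abs_of_nonneg hn]
  · rw [abs_of_nonneg hn]
  · exact abs_le.2 ⟨le_max_left _ _, max_le (by linarith) (min_le_left _ _)⟩

lemma measurable_truncLogRatio {X : Type*} [MeasurableSpace X] (n : ℝ) {r f : X → ℝ}
    (hr : Measurable r) (hf : Measurable f) :
    Measurable fun x => truncLogRatio n (r x) (f x) :=
  .ite (hr (measurableSet_singleton 0)) measurable_const <|
    .ite (hf (measurableSet_singleton 0)) measurable_const <|
      measurable_const.max (measurable_const.min (hr.log.sub hf.log))

lemma truncLogRatio_gain_nonneg {n r f : ℝ} (hn : 0 ≤ n) (hr : 0 ≤ r) (hf : 0 ≤ f) :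
    0 ≤ r * truncLogRatio n r f - f * (Real.exp (truncLogRatio n r f) - 1) := by
  by_cases hr0 : r = 0
  · have h : Real.exp (-n) ≤ 1 := Real.exp_le_one_iff.2 (by linarith)
    simp only [truncLogRatio, hr0, if_true, zero_mul]
    nlinarith
  by_cases hf0 : f = 0
  · simp only [truncLogRatio, hr0, hf0, if_true, if_false, zero_mul, sub_zero]
    positivity
  have hr' : 0 < r := hr.lt_of_ne' hr0
  have hf' : 0 < f := hf.lt_of_ne' hf0
  set t := Real.log r - Real.log f with ht
  have hrt : r = f * Real.exp t := by
    rw [ht, Real.exp_sub, Real.exp_log hr', Real.exp_log hf']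
    field_simp
  have hg : truncLogRatio n r f = max (-n) (min n t) := by simp [truncLogRatio, hr0, hf0, ht]
  rw [hg]
  set g := max (-n) (min n t) with hgdef
  have h1 : g * Real.exp g ≤ g * Real.exp t := by
    rcases le_total 0 t with h0 | h0
    · have hg0 : 0 ≤ g := le_max_of_le_right (le_min hn h0)
      have hgt : g ≤ t := max_le (by linarith) (min_le_right _ _)
      exact mul_le_mul_of_nonneg_left (Real.exp_le_exp.2 hgt) hg0
    · have hg0 : g ≤ 0 := max_le (by linarith) ((min_le_right _ _).trans h0)
      have hgt : t ≤ g := le_max_of_le_right (le_min (h0.trans hn) le_rfl)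
      exact mul_le_mul_of_nonpos_left (Real.exp_le_exp.2 hgt) hg0
  have h2 : Real.exp g - 1 ≤ g * Real.exp g := by
    have h := mul_le_mul_of_nonneg_right (Real.add_one_le_exp (-g)) (Real.exp_pos g).le
    rw [← Real.exp_add, neg_add_cancel, Real.exp_zero] at h
    linarith
  have h3 : r * g = f * (g * Real.exp t) := by rw [hrt]; ring
  rw [h3, ← mul_sub]
  exact mul_nonneg hf (by linarith)

lemma tendsto_truncLogRatio_gain {r f : ℝ} (hr : 0 ≤ r) (hf : 0 ≤ f) :
    Tendsto (fun n : ℕ => ENNReal.ofReal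
        (r * truncLogRatio n r f - f * (Real.exp (truncLogRatio n r f) - 1))) atTop
      (𝓝 (if f = 0 ∧ r ≠ 0 then ⊤
        else ENNReal.ofReal (r * Real.log r - r * Real.log f - r + f))) := by
  by_cases hr0 : r = 0
  · simp only [truncLogRatio, hr0, if_true, zero_mul, ne_eq, not_true_eq_false, and_false,
      if_false]
    refine ENNReal.tendsto_ofReal ?_
    have h : Tendsto (fun n : ℕ => Real.exp (-(n : ℝ))) atTop (𝓝 0) :=
      Real.tendsto_exp_neg_atTop_nhds_zero.comp tendsto_natCast_atTop_atTop
    simpa using ((h.sub_const 1).const_mul f).const_sub 0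
  by_cases hf0 : f = 0
  · simp only [truncLogRatio, hr0, hf0, if_true, if_false, zero_mul, sub_zero, ne_eq,
      not_false_eq_true, and_self]
    exact ENNReal.tendsto_ofReal_atTop.comp
      (tendsto_natCast_atTop_atTop.const_mul_atTop (hr.lt_of_ne' hr0))
  have hr' : 0 < r := hr.lt_of_ne' hr0
  have hf' : 0 < f := hf.lt_of_ne' hf0
  simp only [hf0, false_and, if_false]
  refine tendsto_const_nhds.congr' ?_
  obtain ⟨N, hN⟩ := exists_nat_ge |Real.log r - Real.log f|
  filter_upwards [eventually_ge_atTop N] with n hn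
  have hn' := abs_le.1 (hN.trans (Nat.cast_le.2 hn))
  have hg : truncLogRatio n r f = Real.log r - Real.log f := by
    simp only [truncLogRatio, hr0, hf0, if_false]
    rw [min_eq_right hn'.2, max_eq_right hn'.1]
  rw [hg, Real.exp_sub, Real.exp_log hr', Real.exp_log hf']
  congr 1
  field_simp
  ring

lemma EFun_le_of_forall_entropyDual_le {ρ : UnitAddCircle → ℝ} (hρm : Measurable ρ)
    (hρ0 : ∀ x, 0 ≤ ρ x) (hρ1 : ∫ x, ρ x = 1)
    (hρlog : Integrable fun x => ρ x * Real.log (ρ x))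
    {ν : Measure UnitAddCircle} [IsFiniteMeasure ν] {b : ℝ}
    (hb : ∀ g : C(UnitAddCircle, ℝ), entropyDual ρ ν g ≤ b) : EFun ρ ν ≤ b := by
  have hρi : Integrable ρ := .of_integral_ne_zero (by simp [hρ1])
  set f : UnitAddCircle → ℝ := fun x => (ν.rnDeriv volume x).toReal with hfdef
  have hfm : Measurable f := (Measure.measurable_rnDeriv ν volume).ennreal_toReal
  have hf0 : ∀ x, 0 ≤ f x := fun x => ENNReal.toReal_nonneg
  have hfi : Integrable f := Measure.integrable_toReal_rnDeriv
  have hsing := Measure.mutuallySingular_singularPart ν volume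
  classical
  let g : ℕ → UnitAddCircle → ℝ := fun n x =>
    if x ∈ hsing.nullSet then truncLogRatio n (ρ x) (f x) else -n
  have hgm : ∀ n, Measurable (g n) := fun n =>
    .ite hsing.measurableSet_nullSet (measurable_truncLogRatio n hρm hfm) measurable_const
  have hgn : ∀ n x, |g n x| ≤ n := fun n x => by
    by_cases hx : x ∈ hsing.nullSet
    · simpa [g, hx] using abs_truncLogRatio_le n.cast_nonneg (ρ x) (f x)
    · simp [g, hx]
  have hgvol : ∀ᵐ x, ∀ n, g n x = truncLogRatio n (ρ x) (f x) := by
    filter_upwards [measure_eq_zero_iff_ae_notMem.1 hsing.measure_compl_nullSet] with x hx n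
    simp only [Set.mem_compl_iff, not_not] at hx
    simp [g, hx]
  have hgsing : ∀ n, ∫ x, Real.exp (g n x) ∂(ν.singularPart volume)
      = (ν.singularPart volume).real Set.univ * Real.exp (-n) := fun n => by
    rw [← smul_eq_mul, ← integral_const]
    refine integral_congr_ae ?_
    filter_upwards [measure_eq_zero_iff_ae_notMem.1 hsing.measure_nullSet] with x hx
    simp [g, hx]
  set H := ∫ x, ρ x * Real.log (ρ x)
  set M := ∫ x, f x
  set S := (ν.singularPart volume).real Set.univ
  let u : ℕ → UnitAddCircle → ℝ := fun n x => ρ x * g n x - f x * (Real.exp (g n x) - 1)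
  have hu0 : ∀ n, 0 ≤ᵐ[volume] u n := fun n => hgvol.mono fun x hx => by
    simp only [u, hx, Pi.zero_apply]
    exact truncLogRatio_gain_nonneg n.cast_nonneg (hρ0 x) (hf0 x)
  have hρg := fun n => integrable_mul_of_abs_le hρi (hgm n) (hgn n)
  have hexp := fun n => integrable_exp_of_abs_le (hgm n) (hgn n) ν
  have hfexp : ∀ n, Integrable fun x => f x * Real.exp (g n x) :=
    fun n => integrable_rnDeriv_mul (hexp n)
  have hu_eq : ∀ n, u n = ((fun x => ρ x * g n x) - fun x => f x * Real.exp (g n x)) + f :=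
    fun n => by
      ext x
      simp only [u, Pi.add_apply, Pi.sub_apply]
      ring
  have hui : ∀ n, Integrable (u n) := fun n => by
    rw [hu_eq]
    exact ((hρg n).sub (hfexp n)).add hfi
  have hule : ∀ n, ∫ x, u n x ≤ b - 1 + H + M + S * Real.exp (-n) := fun n => by
    have h := entropyDual_le_of_forall_continuous hρi hb (hgm n) (hgn n)
    rw [entropyDual, integral_eq_rnDeriv_add_singularPart (hexp n), hgsing] at h
    rw [hu_eq, integral_add' ((hρg n).sub (hfexp n)) hfi, integral_sub' (hρg n) (hfexp n)]
    linarith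
  have hlim : Tendsto (fun n : ℕ => b - 1 + H + M + S * Real.exp (-(n : ℝ))) atTop
      (𝓝 (b - 1 + H + M)) := by
    have h : Tendsto (fun n : ℕ => Real.exp (-(n : ℝ))) atTop (𝓝 0) :=
      Real.tendsto_exp_neg_atTop_nhds_zero.comp tendsto_natCast_atTop_atTop
    simpa using (h.const_mul S).const_add (b - 1 + H + M)
  have hC0 : 0 ≤ b - 1 + H + M :=
    ge_of_tendsto' hlim fun n => (integral_nonneg_of_ae (hu0 n)).trans (hule n)
  let U : UnitAddCircle → ℝ≥0∞ := fun x => if f x = 0 ∧ ρ x ≠ 0 then ⊤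
    else ENNReal.ofReal (ρ x * Real.log (ρ x) - ρ x * Real.log (f x) - ρ x + f x)
  have hU : ∫⁻ x, U x ≤ ENNReal.ofReal (b - 1 + H + M) := by
    calc ∫⁻ x, U x = ∫⁻ x, liminf (fun n => ENNReal.ofReal (u n x)) atTop := by
          refine lintegral_congr_ae (hgvol.mono fun x hx => ?_)
          simp only [u, hx]
          exact (tendsto_truncLogRatio_gain (hρ0 x) (hf0 x)).liminf_eq.symm
      _ ≤ liminf (fun n => ∫⁻ x, ENNReal.ofReal (u n x)) atTop :=
          lintegral_liminf_le' fun n => (hui n).aemeasurable.ennreal_ofReal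
      _ ≤ liminf (fun n : ℕ => ENNReal.ofReal (b - 1 + H + M + S * Real.exp (-(n : ℝ))))
            atTop := by
          refine liminf_le_liminf (Eventually.of_forall fun n => ?_)
          rw [← ofReal_integral_eq_lintegral_ofReal (hui n) (hu0 n)]
          exact ENNReal.ofReal_le_ofReal (hule n)
      _ = ENNReal.ofReal (b - 1 + H + M) := (ENNReal.tendsto_ofReal hlim).liminf_eq
  have hWm : Measurable fun x =>
      ρ x * Real.log (ρ x) - ρ x * Real.log (f x) - ρ x + f x := by fun_prop
  have hUm : Measurable U := .ite
    ((hfm (measurableSet_singleton 0)).inter (hρm (measurableSet_singleton 0)).compl)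
    measurable_const hWm.ennreal_ofReal
  have hz : ∀ᵐ x, f x = 0 → ρ x = 0 := by
    filter_upwards [ae_lt_top hUm (hU.trans_lt ENNReal.ofReal_lt_top).ne] with x hx h0
    by_contra hne
    simp [U, h0, hne] at hx
  have hW0 : 0 ≤ᵐ[volume] fun x =>
      ρ x * Real.log (ρ x) - ρ x * Real.log (f x) - ρ x + f x := by
    filter_upwards [hz] with x hx
    have h := young_mul_log (g := 0) (hρ0 x) (hf0 x) hx
    simp only [mul_zero, Real.exp_zero, mul_one] at h
    simp only [Pi.zero_apply]
    linarith
  have hWU : ∫⁻ x, ENNReal.ofReal (ρ x * Real.log (ρ x) - ρ x * Real.log (f x) - ρ x + f x)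
      ≤ ENNReal.ofReal (b - 1 + H + M) := by
    refine le_of_eq_of_le (lintegral_congr_ae (hz.mono fun x hx => ?_)) hU
    simp only [U]
    rw [if_neg fun h => h.2 (hx h.1)]
  have hWi : Integrable fun x =>
      ρ x * Real.log (ρ x) - ρ x * Real.log (f x) - ρ x + f x :=
    ⟨hWm.aestronglyMeasurable, (hasFiniteIntegral_iff_ofReal hW0).2
      (hWU.trans_lt ENNReal.ofReal_lt_top)⟩
  have hWle : ∫ x, (ρ x * Real.log (ρ x) - ρ x * Real.log (f x) - ρ x + f x)
      ≤ b - 1 + H + M := by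
    rw [integral_eq_lintegral_of_nonneg_ae hW0 hWm.aestronglyMeasurable]
    exact ENNReal.toReal_le_of_le_ofReal hC0 hWU
  have hneg : (fun x => -(ρ x * Real.log (f x)))
      = (((fun x => ρ x * Real.log (ρ x) - ρ x * Real.log (f x) - ρ x + f x)
        - fun x => ρ x * Real.log (ρ x)) + ρ) - f := by
    ext x
    simp only [Pi.add_apply, Pi.sub_apply]
    ring
  have hint : Integrable fun x => ρ x * Real.log (f x) := by
    refine integrable_neg_iff.1 ?_
    change Integrable fun x => -(ρ x * Real.log (f x))
    rw [hneg]
    exact ((hWi.sub hρlog).add hρi).sub hfi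
  rw [EFun_eq_integral hρ0 (hz.mono fun x hx h0 => hx (by simp [hfdef, h0])) hint,
    EReal.coe_le_coe_iff]
  change ∫ x, -(ρ x * Real.log (f x)) ≤ b
  rw [hneg, integral_sub' ((hWi.sub hρlog).add hρi) hfi, integral_add' (hWi.sub hρlog) hρi,
    integral_sub' hWi hρlog, hρ1]
  linarith

/-- For a normalized weight `ρ ≥ 0` with `ρ log ρ ∈ L¹`, the entropy-type functional
`E(ν) = ∫ log(dm/dν_ac)·ρ dm` is well defined with values in `(-∞, +∞]` (its negative
part is integrable for every finite measure `ν`), and it is weakly lower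
semicontinuous: if `μ_k → μ` weakly then `liminf E(μ_k) ≥ E(μ)`. -/
theorem stmt_5
    (ρ : UnitAddCircle → ℝ) (hρm : Measurable ρ) (hρ0 : ∀ x, 0 ≤ ρ x)
    (hρ1 : (∫ x, ρ x ∂(volume : Measure UnitAddCircle)) = 1)
    (hρlog : Integrable (fun x => ρ x * Real.log (ρ x))
      (volume : Measure UnitAddCircle))
    (μ : ℕ → Measure UnitAddCircle) (ν : Measure UnitAddCircle)
    [∀ k, IsFiniteMeasure (μ k)] [IsFiniteMeasure ν]
    (hweak : ∀ f : C(UnitAddCircle, ℝ),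
      Tendsto (fun k => ∫ x, f x ∂(μ k)) atTop (𝓝 (∫ x, f x ∂ν))) :
    (∀ ν' : Measure UnitAddCircle, IsFiniteMeasure ν' →
      Integrable (fun x => max (ρ x * Real.log ((ν'.rnDeriv volume x).toReal)) 0)
        (volume : Measure UnitAddCircle))
    ∧ EFun ρ ν ≤ liminf (fun k => EFun ρ (μ k)) atTop := by
  refine ⟨fun ν' _ => integrable_max_mul_log_rnDeriv hρm hρ0 hρlog ν', ?_⟩
  have hle : ∀ g : C(UnitAddCircle, ℝ),
      (entropyDual ρ ν g : EReal) ≤ liminf (fun k => EFun ρ (μ k)) atTop := fun g => by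
    have ht := (continuous_coe_real_ereal.tendsto _).comp (tendsto_entropyDual (ρ := ρ) hweak g)
    rw [← ht.liminf_eq]
    exact liminf_le_liminf (Eventually.of_forall fun k =>
      entropyDual_le_EFun hρm hρ0 hρ1 hρlog (μ k) g.continuous.measurable g.norm_coe_le_norm)
  induction h : liminf (fun k => EFun ρ (μ k)) atTop with
  | bot => simpa [h] using hle 0
  | top => exact le_top
  | coe b =>
    refine EFun_le_of_forall_entropyDual_le hρm hρ0 hρ1 hρlog fun g => ?_
    simpa [h] using hle g

end
end

section
/- If there exists C ∈ ℝ such that H(x) ≥ C for every finitely supported I-valued sequence x, then there exists a continuous function γ : I^{l−1} → ℝ such that h(x₁, …, x_l) + γ(x₂, …, x_l) − γ(x₁, …, x_{l−1}) ≥ 0 for all (x₁, …, x_l) ∈ I^l. -/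
open Filter

noncomputable section

/-- The infinite word whose first `m` letters are `y`, followed by the letters of `t`. -/
def wordAppend {m : ℕ} (y : Fin m → ℝ) (t : ℕ → ℝ) (n : ℕ) : ℝ :=
  if hn : n < m then y ⟨n, hn⟩ else t (n - m)

/-- The sum of `h` over all windows of length `l` of the word `w`. -/
def windowSum {l : ℕ} (h : (Fin l → ℝ) → ℝ) (w : ℕ → ℝ) : ℝ :=
  ∑' i : ℕ, h (fun j : Fin l => w (i + j))

/-- Finitely supported sequences with values in `[α, β]`. -/
def finSuppSeq (α β : ℝ) : Set (ℕ → ℝ) :=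
  {t | (∀ i, t i ∈ Set.Icc α β) ∧ ∃ N, ∀ i, N ≤ i → t i = 0}

lemma zero_mem_finSuppSeq {α β : ℝ} (hα : α ≤ 0) (hβ : 0 ≤ β) :
    (fun _ => 0) ∈ finSuppSeq α β :=
  ⟨fun _ => ⟨hα, hβ⟩, 0, fun _ _ => rfl⟩

lemma wordAppend_mem_finSuppSeq {α β : ℝ} {m : ℕ} {y : Fin m → ℝ}
    (hy : ∀ i, y i ∈ Set.Icc α β) {t : ℕ → ℝ} (ht : t ∈ finSuppSeq α β) :
    wordAppend y t ∈ finSuppSeq α β := by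
  obtain ⟨ht, N, hN⟩ := ht
  refine ⟨fun i => ?_, N + m, fun i hi => ?_⟩
  · unfold wordAppend
    split_ifs
    exacts [hy _, ht _]
  · rw [wordAppend, dif_neg (by omega), hN _ (by omega)]

lemma summable_windows {α β : ℝ} {l : ℕ} {h : (Fin l → ℝ) → ℝ} (h0 : h (fun _ => 0) = 0)
    {w : ℕ → ℝ} (hw : w ∈ finSuppSeq α β) :
    Summable fun i : ℕ => h (fun j : Fin l => w (i + j)) := by
  obtain ⟨-, N, hN⟩ := hw
  refine summable_of_ne_finset_zero (s := Finset.range N) fun i hi => ?_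
  rw [Finset.mem_range, not_lt] at hi
  rw [← h0]
  congr 1
  funext j
  exact hN _ (by omega)

lemma windowSum_eq_add {α β : ℝ} {l : ℕ} {h : (Fin l → ℝ) → ℝ} (h0 : h (fun _ => 0) = 0)
    {w : ℕ → ℝ} (hw : w ∈ finSuppSeq α β) :
    windowSum h w = h (fun j => w j) + windowSum h (fun n => w (n + 1)) := by
  unfold windowSum
  rw [(summable_windows h0 hw).tsum_eq_zero_add]
  simp only [zero_add, add_right_comm]

/-- Changing the first `m` letters of a word only affects its first `m` windows. -/
lemma windowSum_wordAppend_sub {α β : ℝ} {l m : ℕ} {h : (Fin l → ℝ) → ℝ}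
    (h0 : h (fun _ => 0) = 0) {y z : Fin m → ℝ} (hy : ∀ i, y i ∈ Set.Icc α β)
    (hz : ∀ i, z i ∈ Set.Icc α β) {t : ℕ → ℝ} (ht : t ∈ finSuppSeq α β) :
    windowSum h (wordAppend y t) - windowSum h (wordAppend z t) =
      ∑ i ∈ Finset.range m, (h (fun j : Fin l => wordAppend y t (i + j)) -
        h (fun j : Fin l => wordAppend z t (i + j))) := by
  unfold windowSum
  rw [← (summable_windows h0 (wordAppend_mem_finSuppSeq hy ht)).tsum_sub
    (summable_windows h0 (wordAppend_mem_finSuppSeq hz ht))]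
  refine tsum_eq_sum fun i hi => ?_
  rw [Finset.mem_range, not_lt] at hi
  rw [sub_eq_zero]
  congr 1
  funext j
  rw [wordAppend, wordAppend, dif_neg (by omega), dif_neg (by omega)]

lemma dist_wordAppend_lt {m : ℕ} {y z : Fin m → ℝ} {δ : ℝ} (hδ : 0 < δ) (hyz : dist y z < δ)
    (t : ℕ → ℝ) (n : ℕ) : dist (wordAppend y t n) (wordAppend z t n) < δ := by
  unfold wordAppend
  split_ifs
  · exact (dist_le_pi_dist y z _).trans_lt hyz
  · simpa using hδ

/-- The least window sum of a finitely supported word beginning with `y`. -/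
def minWindowSum (α β : ℝ) {l m : ℕ} (h : (Fin l → ℝ) → ℝ) (y : Fin m → ℝ) : ℝ :=
  ⨅ t : finSuppSeq α β, windowSum h (wordAppend y t)

section
variable {α β C : ℝ} {l m : ℕ} {h : (Fin l → ℝ) → ℝ}

lemma minWindowSum_le (hbd : ∀ w ∈ finSuppSeq α β, C ≤ windowSum h w) {y : Fin m → ℝ}
    (hy : ∀ i, y i ∈ Set.Icc α β) {t : ℕ → ℝ} (ht : t ∈ finSuppSeq α β) :
    minWindowSum α β h y ≤ windowSum h (wordAppend y t) := by
  refine ciInf_le (f := fun t : finSuppSeq α β => windowSum h (wordAppend y t))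
    ⟨C, ?_⟩ ⟨t, ht⟩
  rintro _ ⟨s, rfl⟩
  exact hbd _ (wordAppend_mem_finSuppSeq hy s.2)

lemma continuousOn_minWindowSum (hα : α ≤ 0) (hβ : 0 ≤ β)
    (hcont : ContinuousOn h {x : Fin l → ℝ | ∀ i, x i ∈ Set.Icc α β})
    (h0 : h (fun _ => 0) = 0) (hbd : ∀ w ∈ finSuppSeq α β, C ≤ windowSum h w) :
    ContinuousOn (minWindowSum α β h) {y : Fin m → ℝ | ∀ i, y i ∈ Set.Icc α β} := by
  have : Nonempty (finSuppSeq α β) := ⟨⟨_, zero_mem_finSuppSeq hα hβ⟩⟩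
  have hK : IsCompact {x : Fin l → ℝ | ∀ i, x i ∈ Set.Icc α β} :=
    isCompact_pi_infinite fun _ => isCompact_Icc
  have huc := Metric.uniformContinuousOn_iff.1 (hK.uniformContinuousOn_of_continuous hcont)
  refine UniformContinuousOn.continuousOn (Metric.uniformContinuousOn_iff.2 fun ε hε => ?_)
  have hε' : 0 < ε / (m + 1) := by positivity
  obtain ⟨δ, hδ, hh⟩ := huc _ hε'
  have key : ∀ y : Fin m → ℝ, (∀ i, y i ∈ Set.Icc α β) → ∀ z : Fin m → ℝ,
      (∀ i, z i ∈ Set.Icc α β) → dist y z < δ →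
      minWindowSum α β h y - m * (ε / (m + 1)) ≤ minWindowSum α β h z := by
    intro y hy z hz hyz
    refine le_ciInf fun t => ?_
    have hsum := windowSum_wordAppend_sub h0 hy hz t.2
    have hle : ∑ i ∈ Finset.range m, (h (fun j : Fin l => wordAppend y t (i + j)) -
        h (fun j : Fin l => wordAppend z t (i + j))) ≤ m * (ε / (m + 1)) := by
      refine (Finset.sum_le_card_nsmul _ _ (ε / (m + 1)) fun i _ => ?_).trans_eq (by simp)
      refine (le_abs_self _).trans (hh _ ?_ _ ?_ ?_).le
      · exact fun j => (wordAppend_mem_finSuppSeq hy t.2).1 _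
      · exact fun j => (wordAppend_mem_finSuppSeq hz t.2).1 _
      · exact (dist_pi_lt_iff hδ).2 fun j => dist_wordAppend_lt hδ hyz _ _
    have := minWindowSum_le hbd hy t.2
    linarith
  refine ⟨δ, hδ, fun y hy z hz hyz => ?_⟩
  have hlt : m * (ε / (m + 1)) < ε := by
    rw [mul_div_assoc', div_lt_iff₀ (by positivity)]
    linarith
  have h1 := key y hy z hz hyz
  have h2 := key z hz y hy (by rwa [dist_comm])
  rw [Real.dist_eq, abs_sub_lt_iff]
  constructor <;> linarith

end

lemma minWindowSum_init_le {α β C : ℝ} {m : ℕ} {h : (Fin (m + 1) → ℝ) → ℝ}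
    (hα : α ≤ 0) (hβ : 0 ≤ β) (h0 : h (fun _ => 0) = 0)
    (hbd : ∀ w ∈ finSuppSeq α β, C ≤ windowSum h w) {x : Fin (m + 1) → ℝ}
    (hx : ∀ i, x i ∈ Set.Icc α β) :
    minWindowSum α β h (fun j : Fin m => x j.castSucc) ≤
      h x + minWindowSum α β h (fun j : Fin m => x j.succ) := by
  have : Nonempty (finSuppSeq α β) := ⟨⟨_, zero_mem_finSuppSeq hα hβ⟩⟩
  rw [← sub_le_iff_le_add']
  refine le_ciInf fun t => ?_
  set s : ℕ → ℝ := fun n => if n = 0 then x (Fin.last m) else t.1 (n - 1) with hs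
  have hsmem : s ∈ finSuppSeq α β := by
    obtain ⟨ht, N, hN⟩ := t.2
    refine ⟨fun i => ?_, N + 1, fun i hi => ?_⟩
    · simp only [hs]
      split_ifs
      exacts [hx _, ht _]
    · simp only [hs]
      rw [if_neg (by omega), hN _ (by omega)]
  have hfirst : (fun j : Fin (m + 1) => wordAppend (fun j : Fin m => x j.castSucc) s j) = x := by
    funext j
    refine Fin.lastCases ?_ (fun i => ?_) j
    · simp [wordAppend, hs]
    · simp [wordAppend]
  have hshift : (fun n => wordAppend (fun j : Fin m => x j.castSucc) s (n + 1)) =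
      wordAppend (fun j : Fin m => x j.succ) t := by
    funext n
    rcases lt_trichotomy (n + 1) m with hn | hn | hn
    · rw [wordAppend, wordAppend, dif_pos hn, dif_pos (by omega)]
      rfl
    · rw [wordAppend, wordAppend, dif_neg (by omega), dif_pos (by omega)]
      simp only [hs, hn, Nat.sub_self, if_true]
      congr 1
      ext
      simp [hn]
    · rw [wordAppend, wordAppend, dif_neg (by omega), dif_neg (by omega)]
      simp only [hs]
      rw [if_neg (by omega), show n + 1 - m - 1 = n - m by omega]
  have hle := minWindowSum_le hbd (y := fun j : Fin m => x j.castSucc) (fun j => hx _) hsmem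
  rw [windowSum_eq_add h0 (wordAppend_mem_finSuppSeq (fun j => hx _) hsmem), hfirst, hshift] at hle
  linarith

/-- Lemma on positiveness: if `H(x) = Σ_i h(x_{i+1},…,x_{i+l})` is bounded from below
over all finitely supported `I`-valued sequences, then `h` can be corrected by a
coboundary `γ∘tail - γ∘init` of a continuous `γ` so as to become nonnegative. -/
theorem stmt_6
    (l : ℕ) (hl : 2 ≤ l) (α β : ℝ) (hα : α ≤ 0) (hβ : 0 ≤ β)
    (h : (Fin l → ℝ) → ℝ)
    (hcont : ContinuousOn h {x : Fin l → ℝ | ∀ i, x i ∈ Set.Icc α β})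
    (h0 : h (fun _ => 0) = 0)
    (C : ℝ)
    (hbd : ∀ x : ℕ → ℝ, (∀ i, x i ∈ Set.Icc α β) → (∃ N, ∀ i, N ≤ i → x i = 0) →
      C ≤ ∑' i : ℕ, h (fun j : Fin l => x (i + 1 + (j : ℕ)))) :
    ∃ γ : (Fin (l - 1) → ℝ) → ℝ,
      ContinuousOn γ {y : Fin (l - 1) → ℝ | ∀ i, y i ∈ Set.Icc α β} ∧
      ∀ x : Fin l → ℝ, (∀ i, x i ∈ Set.Icc α β) →
        0 ≤ h x + γ (fun j : Fin (l - 1) => x ⟨(j : ℕ) + 1, by have := j.2; omega⟩)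
              - γ (fun j : Fin (l - 1) => x ⟨(j : ℕ), by have := j.2; omega⟩) := by
  obtain ⟨m, rfl⟩ : ∃ m, l = m + 1 := ⟨l - 1, by omega⟩
  have hbd' : ∀ w ∈ finSuppSeq α β, C ≤ windowSum h w := by
    rintro w ⟨hw, N, hN⟩
    have hsum := hbd (fun n => w (n - 1)) (fun i => hw _)
      ⟨N + 1, fun i hi => hN _ (by omega)⟩
    simpa only [windowSum, add_right_comm _ 1, Nat.add_sub_cancel] using hsum
  refine ⟨minWindowSum α β h, continuousOn_minWindowSum hα hβ hcont h0 hbd', fun x hx => ?_⟩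
  have hle := minWindowSum_init_le hα hβ h0 hbd' hx
  rw [sub_nonneg]
  exact hle

end
end
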